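/- The group of isometries of the Leech lattice fixing both A and B (with O, A, B a regular triangle of edge 2) is isomorphic to the simple group PSU(6,4), of order 9196830720; moreover the group of isometries of Λ₂₄ preserving the sublattice R_{AB} setwise is isomorphic to O(Λ₂₂), of order 2·6·9196830720, and O(Λ₂₂)/{±Id} ≅ PΓU(6,4). -/

import Mathlib

open scoped BigOperators

/-- A generator matrix of the extended binary Golay code (MOG coordinates). -/
def golayMatrix : Matrix (Fin 12) (Fin 24) (ZMod 2) :=
  !![0, 0, 0, 0, 0, 0, 0, 0, 0, 0, 0, 0, 0, 0, 0, 0, 1, 1, 1, 1, 1, 1, 1, 1;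
    0, 0, 0, 0, 0, 0, 0, 0, 0, 0, 0, 0, 1, 1, 1, 1, 0, 0, 0, 0, 1, 1, 1, 1;
    0, 0, 0, 0, 0, 0, 0, 0, 0, 0, 1, 1, 0, 0, 1, 1, 0, 0, 1, 1, 0, 0, 1, 1;
    0, 0, 0, 0, 0, 0, 0, 0, 0, 1, 0, 1, 0, 1, 0, 1, 0, 1, 0, 1, 0, 1, 0, 1;
    0, 0, 0, 0, 0, 0, 0, 0, 1, 0, 0, 1, 0, 1, 1, 0, 0, 1, 1, 0, 1, 0, 0, 1;
    0, 0, 0, 0, 0, 0, 1, 1, 0, 0, 0, 0, 0, 0, 1, 1, 0, 1, 1, 0, 0, 1, 0, 1;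
    0, 0, 0, 0, 0, 1, 0, 1, 0, 0, 0, 0, 0, 1, 0, 1, 0, 0, 1, 1, 0, 1, 1, 0;
    0, 0, 0, 0, 1, 0, 0, 1, 0, 0, 0, 0, 0, 1, 1, 0, 0, 1, 0, 1, 1, 1, 0, 0;
    0, 0, 0, 1, 0, 0, 0, 1, 0, 0, 0, 1, 0, 0, 0, 1, 0, 1, 1, 1, 1, 0, 0, 0;
    0, 0, 1, 0, 0, 0, 0, 1, 0, 0, 0, 1, 0, 0, 1, 0, 0, 0, 1, 0, 1, 1, 1, 0;
    0, 1, 0, 0, 0, 0, 0, 1, 0, 0, 0, 1, 0, 1, 0, 0, 0, 0, 0, 1, 1, 0, 1, 1;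
    1, 0, 0, 0, 0, 0, 0, 1, 0, 0, 0, 1, 0, 1, 1, 1, 0, 1, 0, 0, 0, 0, 1, 0]

/-- The extended binary Golay code `C₂₄`. -/
def GolayCode : Submodule (ZMod 2) (Fin 24 → ZMod 2) :=
  Submodule.span (ZMod 2) (Set.range fun i => golayMatrix i)

/-- Membership in the Leech lattice `Λ₂₄ ⊂ ℤ²⁴` (coordinates scaled by `√8`),
via the standard congruence characterization. -/
def IsLeech (x : Fin 24 → ℤ) : Prop :=
  ∃ m : ℤ, (m = 0 ∨ m = 1) ∧ (∀ i, (2:ℤ) ∣ (x i - m)) ∧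
    ((fun i => if (4:ℤ) ∣ (x i - m - 2) then (1 : ZMod 2) else 0) ∈ GolayCode) ∧
    (8:ℤ) ∣ ((∑ i, x i) - 4 * m)

/-- The inner product `⟨x, y⟩ = (Σ xᵢ yᵢ)/8` on the Leech lattice. -/
def leechInner (x y : Fin 24 → ℤ) : ℚ := (∑ i, (x i : ℚ) * (y i : ℚ)) / 8

/-- The lattice point `A = (0²¹, 4, 0, −4)`. -/
def vA : Fin 24 → ℤ := fun i => if i.val = 21 then 4 else if i.val = 23 then -4 else 0

/-- The lattice point `B = (0²¹, 0, 4, −4)`. -/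
def vB : Fin 24 → ℤ := fun i => if i.val = 22 then 4 else if i.val = 23 then -4 else 0

/-- `T_AB`: lattice points `T` with `|OT| = |AT| = |BT| = 2`. -/
def TAB : Set (Fin 24 → ℤ) :=
  {T | IsLeech T ∧ leechInner T T = 4 ∧
       leechInner (T - vA) (T - vA) = 4 ∧ leechInner (T - vB) (T - vB) = 4}

/-- The inner product `(Σ xᵢyᵢ)/8` on `ℚ²⁴`. -/
def ratInner (x y : Fin 24 → ℚ) : ℚ := (∑ i, x i * y i) / 8

/-- Integer vectors regarded as rational vectors. -/
def toRat (x : Fin 24 → ℤ) : Fin 24 → ℚ := fun i => (x i : ℚ)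

/-- The Leech lattice inside `ℚ²⁴`. -/
def LeechQ : Set (Fin 24 → ℚ) := {x | ∃ y : Fin 24 → ℤ, IsLeech y ∧ x = toRat y}

/-- `·0 = O(Λ₂₄)`: the automorphism group of the Leech lattice. -/
def LeechAut : Subgroup ((Fin 24 → ℚ) ≃ₗ[ℚ] (Fin 24 → ℚ)) where
  carrier := {g | (∀ x y, ratInner (g x) (g y) = ratInner x y) ∧
                  (∀ x, x ∈ LeechQ ↔ g x ∈ LeechQ)}
  one_mem' := ⟨fun _ _ => rfl, fun _ => Iff.rfl⟩
  mul_mem' := @fun a b ha hb => ⟨fun x y => by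
      show ratInner (a (b x)) (a (b y)) = _
      rw [ha.1, hb.1], fun x => by
      show _ ↔ a (b x) ∈ _
      rw [hb.2, ha.2]⟩
  inv_mem' := @fun a ha => ⟨fun x y => by
      show ratInner (a.symm x) (a.symm y) = _
      conv_rhs => rw [← a.apply_symm_apply x, ← a.apply_symm_apply y]
      rw [ha.1], fun x => by
      show _ ↔ a.symm x ∈ _
      conv_lhs => rw [← a.apply_symm_apply x]
      rw [← ha.2]⟩

/-- `·222_AB`: elements of `·0` fixing `A` and `B`. -/
def dot222 : Subgroup ((Fin 24 → ℚ) ≃ₗ[ℚ] (Fin 24 → ℚ)) where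
  carrier := {g | g ∈ LeechAut ∧ g (toRat vA) = toRat vA ∧ g (toRat vB) = toRat vB}
  one_mem' := ⟨LeechAut.one_mem, rfl, rfl⟩
  mul_mem' := @fun a b ha hb => ⟨LeechAut.mul_mem ha.1 hb.1, by
      show a (b (toRat vA)) = _
      rw [hb.2.1, ha.2.1], by
      show a (b (toRat vB)) = _
      rw [hb.2.2, ha.2.2]⟩
  inv_mem' := @fun a ha => ⟨LeechAut.inv_mem ha.1, by
      show a.symm (toRat vA) = _
      conv_lhs => rw [← ha.2.1]
      exact a.symm_apply_apply _, by
      show a.symm (toRat vB) = _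
      conv_lhs => rw [← ha.2.2]
      exact a.symm_apply_apply _⟩

/-- The primitive rank-2 sublattice `R_AB ⊂ Λ₂₄` containing `A` and `B`. -/
def RABQ : Set (Fin 24 → ℚ) :=
  {x | x ∈ LeechQ ∧ x ∈ Submodule.span ℚ ({toRat vA, toRat vB} : Set (Fin 24 → ℚ))}

/-- `∘222_AB`: elements of `·0` preserving `R_AB` setwise. -/
def circ222 : Subgroup ((Fin 24 → ℚ) ≃ₗ[ℚ] (Fin 24 → ℚ)) where
  carrier := {g | g ∈ LeechAut ∧ ∀ x, x ∈ RABQ ↔ g x ∈ RABQ}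
  one_mem' := ⟨LeechAut.one_mem, fun _ => Iff.rfl⟩
  mul_mem' := @fun a b ha hb => ⟨LeechAut.mul_mem ha.1 hb.1, fun x => by
      show _ ↔ a (b x) ∈ _
      rw [hb.2, ha.2]⟩
  inv_mem' := @fun a ha => ⟨LeechAut.inv_mem ha.1, fun x => by
      show _ ↔ a.symm x ∈ _
      conv_lhs => rw [← a.apply_symm_apply x]
      rw [← ha.2]⟩

/-- The laminated lattice `Λ₂₂`, as the section of `Λ₂₄` by `x₂₂ = x₂₃ = x₂₄`. -/
def Lam22Q : Set (Fin 24 → ℚ) :=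
  {x | x ∈ LeechQ ∧ x ⟨21, by omega⟩ = x ⟨22, by omega⟩ ∧
       x ⟨22, by omega⟩ = x ⟨23, by omega⟩}

/-- `Λ₂₂ ⊗ ℚ`. -/
def W22 : Submodule ℚ (Fin 24 → ℚ) := Submodule.span ℚ Lam22Q

/-- `O(Λ₂₂)`: the automorphism group of the laminated lattice `Λ₂₂`. -/
def OLam22 : Subgroup (↥W22 ≃ₗ[ℚ] ↥W22) where
  carrier := {g | (∀ x y : ↥W22, ratInner ((g x) : Fin 24 → ℚ) ((g y) : Fin 24 → ℚ)
                    = ratInner (x : Fin 24 → ℚ) (y : Fin 24 → ℚ)) ∧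
                  (∀ x : ↥W22, (x : Fin 24 → ℚ) ∈ Lam22Q ↔
                    ((g x) : Fin 24 → ℚ) ∈ Lam22Q)}
  one_mem' := ⟨fun _ _ => rfl, fun _ => Iff.rfl⟩
  mul_mem' := @fun a b ha hb => ⟨fun x y => by
      show ratInner ((a (b x)) : Fin 24 → ℚ) ((a (b y)) : Fin 24 → ℚ) = _
      rw [ha.1, hb.1], fun x => by
      show _ ↔ ((a (b x)) : Fin 24 → ℚ) ∈ _
      rw [hb.2, ha.2]⟩
  inv_mem' := @fun a ha => ⟨fun x y => by
      show ratInner ((a.symm x) : Fin 24 → ℚ) ((a.symm y) : Fin 24 → ℚ) = _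
      conv_rhs => rw [← a.apply_symm_apply x, ← a.apply_symm_apply y]
      rw [ha.1], fun x => by
      show _ ↔ ((a.symm x) : Fin 24 → ℚ) ∈ _
      conv_lhs => rw [← a.apply_symm_apply x]
      rw [← ha.2]⟩

/-- The field `F₄`. -/
abbrev F4 : Type := GaloisField 2 2

/-- `F₄` with the Frobenius `x ↦ x²` as conjugation, so that
`Matrix.unitaryGroup (Fin 6) F4` is the unitary group `GU(6,4)`. -/
noncomputable instance : Fintype F4 := Fintype.ofFinite F4

noncomputable instance : StarRing F4 where
  star x := frobenius F4 2 x
  star_involutive x := by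
    show (x ^ 2) ^ 2 = x
    have h4 : Fintype.card F4 = 4 := by
      rw [← Nat.card_eq_fintype_card, GaloisField.card 2 2 (by norm_num)]; norm_num
    calc (x ^ 2) ^ 2 = x ^ Fintype.card F4 := by rw [← pow_mul, h4]
    _ = x := FiniteField.pow_card x
  star_mul x y := by
    show (x * y) ^ 2 = y ^ 2 * x ^ 2
    rw [mul_pow, mul_comm]
  star_add x y := by
    show (x + y) ^ 2 = x ^ 2 + y ^ 2
    exact add_pow_char x y 2

/-- `SU(6,4)`: unitary matrices of determinant 1. -/
noncomputable def SU6 : Subgroup ↥(Matrix.unitaryGroup (Fin 6) F4) where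
  carrier := {g | ((g : Matrix (Fin 6) (Fin 6) F4)).det = 1}
  one_mem' := by
    simp only [Set.mem_setOf_eq, Matrix.UnitaryGroup.one_val, Matrix.det_one]
  mul_mem' := @fun a b ha hb => by
    simp only [Set.mem_setOf_eq, Matrix.UnitaryGroup.mul_val, Matrix.det_mul] at *
    rw [ha, hb, mul_one]
  inv_mem' := @fun a ha => by
    simp only [Set.mem_setOf_eq, Matrix.UnitaryGroup.inv_val] at *
    rw [Matrix.star_eq_conjTranspose, Matrix.det_conjTranspose, ha, star_one]

/-- `PSU(6,4) = SU(6,4)/center`. -/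
noncomputable def PSU6 : Type := ↥SU6 ⧸ Subgroup.center ↥SU6

noncomputable instance : Group PSU6 := by
  unfold PSU6; infer_instance

/-- The `F₄`-rational points of the Fermat cubic `X`, as 1-dimensional
subspaces of `F₄⁶`. -/
def FermatPoint : Type :=
  {p : Submodule F4 (Fin 6 → F4) //
    Module.finrank F4 ↥p = 1 ∧ ∀ x ∈ p, ∑ i, x i ^ 3 = 0}

/-- `PΓU(6,4)`: the subgroup of the symmetric group of `X(F₄)` generated by
the permutations induced by `PGU(6,4)` and by the Frobenius. -/
def PGammaU : Subgroup (Equiv.Perm FermatPoint) :=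
  Subgroup.closure
    {σ | (∃ g ∈ Matrix.unitaryGroup (Fin 6) F4,
            ∀ p : FermatPoint, ((σ p).val : Set (Fin 6 → F4))
              = (fun x => g.mulVec x) '' (p.val : Set (Fin 6 → F4))) ∨
         (∀ p : FermatPoint, ((σ p).val : Set (Fin 6 → F4))
              = (fun x i => x i ^ 2) '' (p.val : Set (Fin 6 → F4)))}

section

/-! ## A computable model of the field with four elements -/

/-- The field with four elements `{0, 1, ω, ω²}`. -/
inductive K4 : Type
  | o | i | w | z

namespace K4

def toNat : K4 → ℕ
  | o => 0
  | i => 1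
  | w => 2
  | z => 3

theorem toNat_inj {a b : K4} (h : toNat a = toNat b) : a = b := by
  cases a <;> cases b <;> first | rfl | (exact absurd h (by decide))

instance : DecidableEq K4 := fun a b =>
  decidable_of_iff (toNat a = toNat b) ⟨toNat_inj, fun h => h ▸ rfl⟩

instance : Fintype K4 := ⟨⟨↑[K4.o, K4.i, K4.w, K4.z], by decide⟩, fun x => by cases x <;> decide⟩

def add : K4 → K4 → K4
  | o, b => b
  | a, o => a
  | i, i => o
  | i, w => z
  | i, z => w
  | w, i => z
  | w, w => o
  | w, z => i
  | z, i => w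
  | z, w => i
  | z, z => o

def mul : K4 → K4 → K4
  | o, _ => o
  | _, o => o
  | i, b => b
  | a, i => a
  | w, w => z
  | w, z => i
  | z, w => i
  | z, z => w

def inv : K4 → K4
  | o => o
  | i => i
  | w => z
  | z => w

instance : Zero K4 := ⟨o⟩
instance : One K4 := ⟨i⟩
instance : Add K4 := ⟨add⟩
instance : Mul K4 := ⟨mul⟩
instance : Neg K4 := ⟨id⟩
instance : Inv K4 := ⟨inv⟩

instance : CommRing K4 where
  add_assoc := by decide +kernel
  zero_add := by decide +kernel
  add_zero := by decide +kernel
  add_comm := by decide +kernel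
  mul_assoc := by decide +kernel
  one_mul := by decide +kernel
  mul_one := by decide +kernel
  mul_comm := by decide +kernel
  left_distrib := by decide +kernel
  right_distrib := by decide +kernel
  zero_mul := by decide +kernel
  mul_zero := by decide +kernel
  neg_add_cancel := by decide +kernel
  nsmul := nsmulRec
  zsmul := zsmulRec

instance : Field K4 where
  inv := inv
  exists_pair_ne := ⟨o, i, by decide⟩
  mul_inv_cancel := by decide +kernel
  inv_zero := by decide +kernel
  nnqsmul := _
  nnqsmul_def := fun _ _ => rfl
  qsmul := _
  qsmul_def := fun _ _ => rfl

instance : StarRing K4 where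
  star := inv
  star_involutive := fun a => by cases a <;> rfl
  star_mul := by decide +kernel
  star_add := by decide +kernel

theorem star_eq_sq (a : K4) : star a = a ^ 2 := by revert a; decide +kernel

theorem add_self (a : K4) : a + a = 0 := by revert a; decide +kernel

theorem neg_eq (a : K4) : -a = a := rfl

theorem sub_eq (a b : K4) : a - b = a + b := by revert a b; decide +kernel

instance : CharP K4 2 := by
  refine CharTwo.of_one_ne_zero_of_two_eq_zero (by decide) (by decide)

theorem card_K4 : Fintype.card K4 = 4 := by decide

/-- The additive character `(-1)^Tr(x)`. -/
def chi : K4 → ℚ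
  | o => 1
  | i => 1
  | w => -1
  | z => -1

/-- The additive character `(-1)^Tr(ωx)`. -/
def psi : K4 → ℚ
  | o => 1
  | i => -1
  | w => -1
  | z => 1

theorem chi_add (a b : K4) : chi (a + b) = chi a * chi b := by
  cases a <;> cases b <;> norm_num [chi, HAdd.hAdd, Add.add, add]
theorem psi_add (a b : K4) : psi (a + b) = psi a * psi b := by
  cases a <;> cases b <;> norm_num [psi, HAdd.hAdd, Add.add, add]
theorem chi_star (a : K4) : chi (star a) = chi a := by
  cases a <;> rfl
theorem psi_tr (a : K4) : psi (a + star a) = chi a := by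
  cases a <;> rfl
theorem chi_zero : chi 0 = 1 := rfl
theorem psi_zero : psi 0 = 1 := rfl
theorem chi_sq (a : K4) : chi a * chi a = 1 := by cases a <;> norm_num [chi]
theorem psi_sq (a : K4) : psi a * psi a = 1 := by cases a <;> norm_num [psi]
theorem sum_K4 {M : Type*} [AddCommMonoid M] (f : K4 → M) :
    ∑ t, f t = f 0 + f 1 + f w + f z := by
  show Multiset.sum (Multiset.map f (↑[K4.o, K4.i, K4.w, K4.z])) = _
  simp only [Multiset.map_coe, List.map_cons, List.map_nil, Multiset.sum_coe, List.sum_cons,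
    List.sum_nil, add_zero, ← add_assoc]
  rfl

end K4

open K4 in
/-- Index in `{0,…,20}` of the point of `PG(2,4)` through a nonzero vector. -/
def idx3 : K4 → K4 → K4 → Fin 24
  | .o, .o, _ => 4
  | .o, y, c => match y⁻¹ * c with
    | .o => 1
    | .i => 17
    | .w => 14
    | .z => 11
  | x, y, c => match x⁻¹ * y, x⁻¹ * c with
    | .o, .o => 0
    | .o, .i => 16
    | .o, .w => 12
    | .o, .z => 8
    | .i, .o => 20
    | .i, .i => 5
    | .i, .w => 7
    | .i, .z => 6
    | .w, .o => 3
    | .w, .i => 13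
    | .w, .w => 10
    | .w, .z => 19
    | .z, .o => 2
    | .z, .i => 9
    | .z, .w => 18
    | .z, .z => 15

abbrev V3 : Type := Fin 3 → K4

def idx (v : V3) : Fin 24 := idx3 (v 0) (v 1) (v 2)

/-- Representative vectors of the points of `PG(2,4)`. -/
def rep : Fin 24 → V3 := ![
  ![.i, .o, .o], ![.o, .i, .o], ![.i, .z, .o], ![.i, .w, .o], ![.o, .o, .i], ![.i, .i, .i],
  ![.i, .i, .z], ![.i, .i, .w], ![.i, .o, .z], ![.i, .z, .i], ![.i, .w, .w], ![.o, .i, .z],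
  ![.i, .o, .w], ![.i, .w, .i], ![.o, .i, .w], ![.i, .z, .z], ![.i, .o, .i], ![.o, .i, .i],
  ![.i, .z, .w], ![.i, .w, .z], ![.i, .i, .o], ![.o, .o, .o], ![.o, .o, .o], ![.o, .o, .o]]

/-- The three extra coordinates, labelled by the nonzero elements of `K4`. -/
def th : K4 → Fin 24
  | .o => 21
  | .i => 21
  | .w => 22
  | .z => 23

def thi (i : Fin 24) : K4 := if i = 21 then .i else if i = 22 then .w else .z

theorem V3_eta (v : V3) : v = ![v 0, v 1, v 2] := by
  ext i; fin_cases i <;> rfl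

theorem V3_forall {p : V3 → Prop} : (∀ v, p v) ↔ ∀ x y c, p ![x, y, c] :=
  ⟨fun h x y c => h _, fun h v => by rw [V3_eta v]; exact h _ _ _⟩

theorem idx_lt (v : V3) : (idx v).val < 21 := by
  revert v; rw [V3_forall]; decide +kernel

theorem idx_rep : ∀ i : Fin 24, i.val < 21 → idx (rep i) = i := by decide +kernel

theorem rep_ne : ∀ i : Fin 24, i.val < 21 → rep i ≠ 0 := by decide +kernel

theorem idx_smul (c : K4) (hc : c ≠ 0) (v : V3) : idx (c • v) = idx v := by
  revert v; rw [V3_forall]; revert c; decide +kernel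

theorem exists_smul_rep (v : V3) (hv : v ≠ 0) : ∃ c : K4, c ≠ 0 ∧ v = c • rep (idx v) := by
  revert v; rw [V3_forall]; decide +kernel

theorem th_thi : ∀ i : Fin 24, 21 ≤ i.val → th (thi i) = i := by decide +kernel
theorem thi_th (c : K4) (hc : c ≠ 0) : thi (th c) = c := by revert c; decide +kernel
theorem thi_ne : ∀ i : Fin 24, thi i ≠ 0 := by decide +kernel
theorem th_ge (c : K4) : 21 ≤ (th c).val := by revert c; decide +kernel

end

section

open Matrix

/-! ## The Weil representation operators -/


abbrev V24 : Type := Fin 24 → ℚ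
abbrev Fun64 : Type := V3 → ℚ
abbrev W6 : Type := Fin 3 ⊕ Fin 3 → K4

/-- the hermitian pairing on `K4³` -/
def hp (a b : V3) : K4 := a ⬝ᵥ star b

theorem hp_add_left (a b c : V3) : hp (a + b) c = hp a c + hp b c := by
  simp [hp, add_dotProduct]
theorem hp_add_right (a b c : V3) : hp a (b + c) = hp a b + hp a c := by
  simp [hp, dotProduct_add]
theorem hp_star (a b : V3) : star (hp a b) = hp b a := by
  simp [hp, dotProduct, mul_comm]
theorem hp_smul_left (c : K4) (a b : V3) : hp (c • a) b = c * hp a b := by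
  simp [hp, smul_dotProduct]
theorem hp_smul_right (c : K4) (a b : V3) : hp a (c • b) = star c * hp a b := by
  simp [hp, dotProduct_smul]
theorem hp_three (a b : V3) : hp a b = a 0 * star (b 0) + a 1 * star (b 1) + a 2 * star (b 2) := by
  simp [hp, dotProduct, Fin.sum_univ_three]
theorem hp_mulVec (m : Matrix (Fin 3) (Fin 3) K4) (a b : V3) :
    hp (m *ᵥ a) b = hp a (mᴴ *ᵥ b) := by
  simp only [hp, star_mulVec, conjTranspose_conjTranspose]
  rw [dotProduct_comm, dotProduct_mulVec, dotProduct_comm]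

def Ep (a b : V3) : Fun64 →ₗ[ℚ] Fun64 where
  toFun f v := K4.psi (hp a b) * K4.chi (hp v b) * f (v + a)
  map_add' f g := by ext v; simp [mul_add]
  map_smul' c f := by ext v; simp [mul_left_comm]

theorem Ep_apply (a b : V3) (f : Fun64) (v : V3) :
    Ep a b f v = K4.psi (hp a b) * K4.chi (hp v b) * f (v + a) := rfl

def tau (a b : V3) : Fun64 →ₗ[ℚ] Fun64 :=
  (1/2 : ℚ) • (Ep a b + Ep (K4.w • a) (K4.w • b) + Ep (K4.z • a) (K4.z • b) - LinearMap.id)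

theorem tau_apply (a b : V3) (f : Fun64) :
    tau a b f = (1/2 : ℚ) • (Ep a b f + Ep (K4.w • a) (K4.w • b) f + Ep (K4.z • a) (K4.z • b) f - f) :=
  rfl

theorem tau_smul (c : K4) (hc : c ≠ 0) (a b : V3) : tau (c • a) (c • b) = tau a b := by
  have h1 : K4.w * K4.w = K4.z := rfl
  have h2 : K4.w * K4.z = 1 := rfl
  have h3 : K4.z * K4.w = 1 := rfl
  have h4 : K4.z * K4.z = K4.w := rfl
  have h5 : K4.i = 1 := rfl
  cases c
  · exact absurd rfl hc
  · rw [h5, one_smul, one_smul]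
  · simp only [tau, smul_smul, h1, h3, one_smul]
    congr 2; abel
  · simp only [tau, smul_smul, h2, h4, one_smul]
    congr 2; abel

/-- lower an intertwining relation to `tau` -/
theorem tau_conj (G : Fun64 →ₗ[ℚ] Fun64) (α β : V3 → V3 → V3)
    (hα : ∀ (c : K4) a b, α (c • a) (c • b) = c • α a b) (hβ : ∀ (c : K4) a b, β (c • a) (c • b) = c • β a b)
    (h : ∀ a b f, G (Ep a b f) = Ep (α a b) (β a b) (G f)) (a b : V3) (f : Fun64) :
    G (tau a b f) = tau (α a b) (β a b) (G f) := by
  simp only [tau_apply, map_smul, map_add, map_sub, h, hα, hβ]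

/-- `(Gf)(v) = f(m' v)` -/
def opD (m' : Matrix (Fin 3) (Fin 3) K4) : Fun64 →ₗ[ℚ] Fun64 where
  toFun f v := f (m' *ᵥ v)
  map_add' f g := rfl
  map_smul' c f := rfl

theorem opD_Ep (m m' : Matrix (Fin 3) (Fin 3) K4) (h2 : m' * m = 1)
    (a b : V3) (f : Fun64) : opD m' (Ep a b f) = Ep (m *ᵥ a) (m'ᴴ *ᵥ b) (opD m' f) := by
  ext v
  have e1 : m' *ᵥ (v + m *ᵥ a) = m' *ᵥ v + a := by
    rw [mulVec_add, mulVec_mulVec, h2, one_mulVec]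
  have e2 : hp (m *ᵥ a) (m'ᴴ *ᵥ b) = hp a b := by
    rw [← hp_mulVec, mulVec_mulVec, h2, one_mulVec]
  show Ep a b f (m' *ᵥ v) = _
  rw [Ep_apply, Ep_apply, e2, ← hp_mulVec]
  show _ = _ * f (m' *ᵥ (v + m *ᵥ a))
  rw [e1]

theorem opD_tau (m m' : Matrix (Fin 3) (Fin 3) K4) (h2 : m' * m = 1)
    (a b : V3) (f : Fun64) : opD m' (tau a b f) = tau (m *ᵥ a) (m'ᴴ *ᵥ b) (opD m' f) :=
  tau_conj _ (fun a _ => m *ᵥ a) (fun _ b => m'ᴴ *ᵥ b) (by intros; simp [mulVec_smul])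
    (by intros; simp [mulVec_smul]) (opD_Ep m m' h2) a b f

/-- `(Gf)(v) = (-1)^{H(v)} f(v)` -/
def opT (h : Matrix (Fin 3) (Fin 3) K4) : Fun64 →ₗ[ℚ] Fun64 where
  toFun f v := K4.psi (hp v (h *ᵥ v)) * f v
  map_add' f g := by ext v; simp [mul_add]
  map_smul' c f := by ext v; simp [mul_left_comm]

theorem opT_Ep (h : Matrix (Fin 3) (Fin 3) K4) (hh : hᴴ = h)
    (a b : V3) (f : Fun64) : opT h (Ep a b f) = Ep a (b + h *ᵥ a) (opT h f) := by
  ext v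
  show K4.psi (hp v (h *ᵥ v)) * (K4.psi (hp a b) * K4.chi (hp v b) * f (v + a)) =
    K4.psi (hp a (b + h *ᵥ a)) * K4.chi (hp v (b + h *ᵥ a)) *
      (K4.psi (hp (v + a) (h *ᵥ (v + a))) * f (v + a))
  have e : hp a (h *ᵥ v) = star (hp v (h *ᵥ a)) := by
    rw [hp_star, hp_mulVec, hh]
  have e2 : hp (v + a) (h *ᵥ (v + a)) = hp v (h *ᵥ v) + hp a (h *ᵥ a) +
      (hp v (h *ᵥ a) + star (hp v (h *ᵥ a))) := by
    rw [mulVec_add, hp_add_left, hp_add_right, hp_add_right, e]; ring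
  rw [e2, hp_add_right, hp_add_right, K4.psi_add, K4.psi_add, K4.psi_add, K4.psi_tr, K4.chi_add]
  have h1 := K4.psi_sq (hp a (h *ᵥ a))
  have h2 := K4.chi_sq (hp v (h *ᵥ a))
  linear_combination (-K4.psi (hp v (h *ᵥ v)) * (K4.psi (hp a b) * K4.chi (hp v b) * f (v + a))) * h1
    + (-K4.psi (hp v (h *ᵥ v)) * (K4.psi (hp a b) * K4.chi (hp v b) * f (v + a))) *
      (K4.psi (hp a (h *ᵥ a)) * K4.psi (hp a (h *ᵥ a))) * h2

theorem opT_tau (h : Matrix (Fin 3) (Fin 3) K4) (hh : hᴴ = h)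
    (a b : V3) (f : Fun64) : opT h (tau a b f) = tau a (b + h *ᵥ a) (opT h f) :=
  tau_conj _ (fun a _ => a) (fun a b => b + h *ᵥ a) (by intros; rfl)
    (by intros; simp [mulVec_smul]) (opT_Ep h hh) a b f

/-- partial Fourier transform in the first coordinate -/
def opK : Fun64 →ₗ[ℚ] Fun64 where
  toFun f v := (-1/2 : ℚ) * ∑ t : K4, K4.chi (v 0 * star t) * f ![t, v 1, v 2]
  map_add' f g := by ext v; simp [mul_add, Finset.sum_add_distrib]
  map_smul' c f := by
    ext v; simp only [Pi.smul_apply, smul_eq_mul, RingHom.id_apply, Finset.mul_sum]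
    refine Finset.sum_congr rfl fun t _ => by ring

theorem opK_Ep (a b : V3) (f : Fun64) :
    opK (Ep a b f) = Ep ![b 0, a 1, a 2] ![a 0, b 1, b 2] (opK f) := by
  ext v
  show (-1/2 : ℚ) * ∑ t : K4, K4.chi (v 0 * star t) *
      (K4.psi (hp a b) * K4.chi (hp ![t, v 1, v 2] b) * f (![t, v 1, v 2] + a)) =
    K4.psi (hp ![b 0, a 1, a 2] ![a 0, b 1, b 2]) * K4.chi (hp v ![a 0, b 1, b 2]) *
      ((-1/2 : ℚ) * ∑ t : K4, K4.chi ((v 0 + b 0) * star t) * f ![t, v 1 + a 1, v 2 + a 2])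
  rw [← Equiv.sum_comp (Equiv.addRight (a 0))]
  simp only [Finset.mul_sum]
  refine Finset.sum_congr rfl fun t _ => ?_
  have e0 : ![t + a 0, v 1, v 2] + a = ![t, v 1 + a 1, v 2 + a 2] := by
    ext i; fin_cases i
    · show t + a 0 + a 0 = t
      rw [add_assoc, K4.add_self, add_zero]
    · rfl
    · rfl
  simp only [Equiv.coe_addRight, e0, hp_three, cons_val_zero, cons_val_one, cons_val, star_add,
    mul_add, add_mul, K4.chi_add, K4.psi_add]
  have h1 : K4.psi (b 0 * star (a 0)) = K4.chi (a 0 * star (b 0)) * K4.psi (a 0 * star (b 0)) := by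
    rw [← K4.psi_tr, ← K4.psi_add]; congr 1
    rw [star_mul, star_star, add_right_comm, K4.add_self, zero_add, mul_comm]
  have h2 : K4.chi (b 0 * star t) = K4.chi (t * star (b 0)) := by
    rw [← K4.chi_star, star_mul, star_star]
  rw [h1, h2]; ring

theorem opK_tau (a b : V3) (f : Fun64) :
    opK (tau a b f) = tau ![b 0, a 1, a 2] ![a 0, b 1, b 2] (opK f) :=
  tau_conj _ (fun a b => ![b 0, a 1, a 2]) (fun a b => ![a 0, b 1, b 2])
    (by intros; ext i; fin_cases i <;> rfl) (by intros; ext i; fin_cases i <;> rfl) opK_Ep a b f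

/-- Frobenius -/
def opS : Fun64 →ₗ[ℚ] Fun64 where
  toFun f v := f (star v)
  map_add' f g := rfl
  map_smul' c f := rfl

theorem opS_Ep (a b : V3) (hab : hp a b = star (hp a b)) (f : Fun64) :
    opS (Ep a b f) = Ep (star a) (star b) (opS f) := by
  ext v
  show K4.psi (hp a b) * K4.chi (hp (star v) b) * f (star v + a) =
    K4.psi (hp (star a) (star b)) * K4.chi (hp v (star b)) * f (star (v + star a))
  have e1 : hp (star a) (star b) = star (hp a b) := by simp [hp_three]
  have e2 : hp v (star b) = star (hp (star v) b) := by simp [hp_three]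
  rw [e1, e2, ← hab, K4.chi_star, star_add, star_star]

theorem opS_tau (a b : V3) (hab : hp a b = star (hp a b)) (f : Fun64) :
    opS (tau a b f) = tau (star a) (star b) (opS f) := by
  have hc : ∀ c : K4, c ≠ 0 → hp (c • a) (c • b) = star (hp (c • a) (c • b)) := by
    intro c _
    rw [hp_smul_left, hp_smul_right, star_mul, star_mul, star_star, ← hab]; ring
  have hw : star K4.w = K4.z := rfl
  have hz : star K4.z = K4.w := rfl
  simp only [tau_apply, map_smul, map_add, map_sub]
  rw [opS_Ep a b hab, opS_Ep _ _ (hc K4.w (by decide)), opS_Ep _ _ (hc K4.z (by decide))]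
  simp only [star_smul, hw, hz]
  congr 2
  abel

/-- The linear map from `ℚ²⁴` to functions. -/
def FF : V24 →ₗ[ℚ] Fun64 where
  toFun x v := if v = 0 then -(x 21 + x 22 + x 23) else x (idx v)
  map_add' x y := by
    ext v; simp only [Pi.add_apply]; split_ifs <;> ring
  map_smul' c x := by
    ext v; simp only [Pi.smul_apply, smul_eq_mul, RingHom.id_apply]; split_ifs <;> ring

theorem FF_zero (x : V24) : FF x 0 = -(x 21 + x 22 + x 23) := by
  simp [FF]
theorem FF_ne (x : V24) {v : V3} (hv : v ≠ 0) : FF x v = x (idx v) := by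
  simp [FF, hv]

end

section

open Matrix

/-! ## The Golay code and the Leech lattice -/


def piv : Fin 12 → Fin 24 := ![16, 12, 10, 9, 8, 6, 5, 4, 3, 2, 1, 0]

def gol (w : Fin 24 → ZMod 2) : Prop := ∀ j, w j = ∑ i, w (piv i) * golayMatrix i j

instance (w : Fin 24 → ZMod 2) : Decidable (gol w) := by unfold gol; infer_instance

/-- bit masks of the rows of the generator matrix -/
def gmask : Fin 12 → ℕ := ![16711680, 15790080, 13421568, 11184640, 9857280, 10928320, 7119008, 3825808, 2001032, 7620740, 14166146, 4384897]

def gbit (i : Fin 12) (j : Fin 24) : Bool := Nat.testBit (gmask i) j.val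

def b2z (b : Bool) : ZMod 2 := cond b 1 0

theorem golay_gbit' : ∀ (j : Fin 24) (i : Fin 12), golayMatrix i j = b2z (gbit i j) := by
  decide +kernel
theorem golay_gbit (i : Fin 12) (j : Fin 24) : golayMatrix i j = b2z (gbit i j) := golay_gbit' j i

theorem b2z_xor : ∀ a b, b2z (xor a b) = b2z a + b2z b := by decide
theorem b2z_and : ∀ a b, b2z (a && b) = b2z a * b2z b := by decide

/-- Codeword test on bit masks. -/
def golN (e : ℕ) : Bool := Nat.beq e
  ((List.finRange 12).foldr (fun i acc => Nat.xor (cond (Nat.testBit e (piv i).val) (gmask i) 0) acc) 0)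

/-- Boolean version of `gol` -/
def golB (w : Fin 24 → Bool) : Prop := golN (Nat.ofBits w) = true

instance (w : Fin 24 → Bool) : Decidable (golB w) := by unfold golB; infer_instance

theorem gol_of_golB {w : Fin 24 → Bool} (h : golB w) : gol (fun j => b2z (w j)) := by
  intro j
  show b2z (w j) = _
  have e : ∀ i : Fin 24, w i = Nat.testBit (Nat.ofBits w) i.val := fun i =>
    (Nat.testBit_ofBits_lt w i.val i.isLt).symm
  have h' := Nat.eq_of_beq_eq_true h
  rw [e j, h', Fin.sum_univ_def]
  simp only [← e]
  generalize List.finRange 12 = l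
  induction l with
  | nil => simp [b2z]
  | cons a l ih =>
    simp only [List.foldr_cons, List.map_cons, List.sum_cons]
    rw [← ih]
    show b2z (Nat.testBit (_ ^^^ _) _) = _
    rw [Nat.testBit_xor, b2z_xor]
    congr 1
    rw [golay_gbit, ← b2z_and]
    cases w (piv a) <;> simp [gbit]

theorem golB_rows : ∀ i, golB (gbit i) := by decide +kernel

theorem row_eq (i : Fin 12) : golayMatrix i = fun j => b2z (gbit i j) :=
  funext fun j => golay_gbit i j

theorem gol_rows (i : Fin 12) : gol (golayMatrix i) := by
  rw [row_eq]; exact gol_of_golB (golB_rows i)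

theorem mem_golay_iff (w : Fin 24 → ZMod 2) : w ∈ GolayCode ↔ gol w := by
  constructor
  · intro h
    unfold GolayCode at h
    induction h using Submodule.span_induction with
    | mem x hx => obtain ⟨i, rfl⟩ := hx; exact gol_rows i
    | zero => intro j; simp
    | add x y _ _ hx hy =>
      intro j
      simp only [Pi.add_apply, add_mul, Finset.sum_add_distrib]
      rw [hx j, hy j]
    | smul a x _ hx =>
      intro j
      simp only [Pi.smul_apply, smul_eq_mul, mul_assoc, ← Finset.mul_sum]
      rw [hx j]
  · intro h
    have : w = ∑ i, w (piv i) • golayMatrix i := by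
      ext j; rw [h j]; simp
    rw [this]
    exact Submodule.sum_mem _ fun i _ => Submodule.smul_mem _ _ (Submodule.subset_span ⟨i, rfl⟩)

theorem one_mem_golay : (1 : Fin 24 → ZMod 2) ∈ GolayCode := by
  rw [mem_golay_iff]; decide +kernel

theorem golay_comp (π : Fin 24 → Fin 24) (h : ∀ i, golB (gbit i ∘ π))
    (w : Fin 24 → ZMod 2) (hw : w ∈ GolayCode) : w ∘ π ∈ GolayCode := by
  unfold GolayCode at hw
  induction hw using Submodule.span_induction with
  | mem x hx => 
    obtain ⟨i, rfl⟩ := hx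
    refine (mem_golay_iff _).2 ?_
    show gol ((golayMatrix i) ∘ π)
    rw [row_eq]; exact gol_of_golB (h i)
  | zero => exact Submodule.zero_mem _
  | add x y _ _ hx hy => exact Submodule.add_mem _ hx hy
  | smul a x _ hx => exact Submodule.smul_mem _ a hx

/-! ### coordinate permutations -/

def mv3 (m : Matrix (Fin 3) (Fin 3) K4) (v : V3) : V3 :=
  ![m 0 0 * v 0 + m 0 1 * v 1 + m 0 2 * v 2, m 1 0 * v 0 + m 1 1 * v 1 + m 1 2 * v 2,
    m 2 0 * v 0 + m 2 1 * v 1 + m 2 2 * v 2]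

theorem mv3_eq (m : Matrix (Fin 3) (Fin 3) K4) (v : V3) : mv3 m v = m *ᵥ v := by
  ext i; fin_cases i <;> simp [mv3, mulVec, dotProduct, Fin.sum_univ_three]

def det3 (m : Matrix (Fin 3) (Fin 3) K4) : K4 :=
  m 0 0 * m 1 1 * m 2 2 - m 0 0 * m 1 2 * m 2 1 - m 0 1 * m 1 0 * m 2 2 +
  m 0 1 * m 1 2 * m 2 0 + m 0 2 * m 1 0 * m 2 1 - m 0 2 * m 1 1 * m 2 0

theorem det3_eq (m : Matrix (Fin 3) (Fin 3) K4) : det3 m = m.det := by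
  rw [Matrix.det_fin_three]; rfl

def pmf (m : Matrix (Fin 3) (Fin 3) K4) (i : Fin 24) : Fin 24 :=
  if i.val < 21 then idx (mv3 m (rep i)) else th (det3 m * thi i)

theorem mulVec_ne {m : Matrix (Fin 3) (Fin 3) K4} (hm : m.det ≠ 0) {v : V3} (hv : v ≠ 0) :
    m *ᵥ v ≠ 0 := fun h => hv (by
  have := congrArg (m⁻¹ *ᵥ ·) h
  simpa [Matrix.mulVec_mulVec, Matrix.nonsing_inv_mul m (isUnit_iff_ne_zero.2 hm)] using this)

theorem pmf_idx (m : Matrix (Fin 3) (Fin 3) K4) {v : V3} (hv : v ≠ 0) :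
    pmf m (idx v) = idx (m *ᵥ v) := by
  obtain ⟨c, hc, hvc⟩ := exists_smul_rep v hv
  rw [pmf, if_pos (idx_lt v), mv3_eq]
  conv_rhs => rw [hvc, mulVec_smul, idx_smul c hc]

theorem pmf_th (m : Matrix (Fin 3) (Fin 3) K4) {c : K4} (hc : c ≠ 0) :
    pmf m (th c) = th (m.det * c) := by
  rw [pmf, if_neg (by have := th_ge c; omega), thi_th c hc, det3_eq]

theorem coord_cases (i : Fin 24) : (∃ v : V3, v ≠ 0 ∧ i = idx v) ∨ ∃ c : K4, c ≠ 0 ∧ i = th c := by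
  by_cases h : i.val < 21
  · exact Or.inl ⟨rep i, rep_ne i h, (idx_rep i h).symm⟩
  · exact Or.inr ⟨thi i, thi_ne i, (th_thi i (by omega)).symm⟩

theorem pmf_mul (a b : Matrix (Fin 3) (Fin 3) K4) (hb : b.det ≠ 0) (i : Fin 24) :
    pmf (a * b) i = pmf a (pmf b i) := by
  rcases coord_cases i with ⟨v, hv, rfl⟩ | ⟨c, hc, rfl⟩
  · rw [pmf_idx _ hv, pmf_idx _ hv, pmf_idx _ (mulVec_ne hb hv), mulVec_mulVec]
  · rw [pmf_th _ hc, pmf_th _ hc, pmf_th _ (mul_ne_zero hb hc), det_mul, mul_assoc]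

theorem pmf_one (i : Fin 24) : pmf 1 i = i := by
  rcases coord_cases i with ⟨v, hv, rfl⟩ | ⟨c, hc, rfl⟩
  · rw [pmf_idx _ hv, one_mulVec]
  · rw [pmf_th _ hc, det_one, one_mul]

theorem pmf_transv : ∀ i j : Fin 3, i ≠ j → ∀ c : K4, ∀ r : Fin 12,
    golB (gbit r ∘ pmf (transvection i j c)) := by decide +kernel

theorem pmf_diag : ∀ a b c : K4, a ≠ 0 → b ≠ 0 → c ≠ 0 → ∀ r : Fin 12,
    golB (gbit r ∘ pmf !![a, 0, 0; 0, b, 0; 0, 0, c]) := by decide +kernel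

end

section

open Matrix

/-! ## Leech lattice: additive structure and generators -/


theorem isLeech_iff (x : Fin 24 → ℤ) : IsLeech x ↔
    ∃ n : ℤ, ∃ c ∈ GolayCode, (∀ i, (4:ℤ) ∣ x i - n - 2 * ((c i).val : ℤ)) ∧
      (8:ℤ) ∣ (∑ i, x i) - 4 * n := by
  constructor
  · rintro ⟨m, _, h2, hc, h8⟩
    refine ⟨m, _, hc, fun i => ?_, h8⟩
    have := h2 i
    split_ifs with h
    · simpa [ZMod.val_one] using h
    · simp only [ZMod.val_zero, Nat.cast_zero]; omega
  · rintro ⟨n, c, hc, h4, h8⟩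
    have key : ∀ k m : ℤ, (m = 0 ∨ m = 1) → n = 2 * k + m → IsLeech x := by
      intro k m hm hn
      have hv : ∀ i, c i = 0 ∨ c i = 1 := fun i => by
        generalize c i = a; revert a; decide
      refine ⟨m, hm, fun i => ?_, ?_, by omega⟩
      · have := h4 i; omega
      · have e : (fun i => if (4:ℤ) ∣ (x i - m - 2) then (1 : ZMod 2) else 0) =
            c + (k : ZMod 2) • (1 : Fin 24 → ZMod 2) := by
          ext i
          have h := h4 i
          have hk : (k : ZMod 2) = if k % 2 = 0 then 0 else 1 := by
            split_ifs with h0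
            · exact (ZMod.intCast_zmod_eq_zero_iff_dvd k 2).2 (by push_cast; omega)
            · have : ((k - 1 : ℤ) : ZMod 2) = 0 :=
                (ZMod.intCast_zmod_eq_zero_iff_dvd (k-1) 2).2 (by push_cast; omega)
              push_cast at this
              linear_combination this
          simp only [Pi.add_apply, Pi.smul_apply, Pi.one_apply, smul_eq_mul, mul_one]
          rw [hk]
          rcases hv i with h0 | h0 <;> rw [h0] at h ⊢ <;>
            simp only [ZMod.val_zero, ZMod.val_one, Nat.cast_zero, Nat.cast_one] at h <;>
            split_ifs <;> first | omega | rfl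
        rw [e]
        exact Submodule.add_mem _ hc (Submodule.smul_mem _ _ one_mem_golay)
    rcases Int.even_or_odd' n with ⟨k, h | h⟩
    · exact key k 0 (Or.inl rfl) (by omega)
    · exact key k 1 (Or.inr rfl) (by omega)

/-- The Leech lattice as an additive subgroup. -/
def LeechL : AddSubgroup (Fin 24 → ℤ) where
  carrier := {x | IsLeech x}
  zero_mem' := by
    refine (isLeech_iff _).2 ⟨0, 0, Submodule.zero_mem _, fun i => by simp, by simp⟩
  add_mem' := by
    intro x y hx hy
    obtain ⟨n, c, hc, h4, h8⟩ := (isLeech_iff _).1 hx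
    obtain ⟨n', c', hc', h4', h8'⟩ := (isLeech_iff _).1 hy
    refine (isLeech_iff _).2 ⟨n + n', c + c', Submodule.add_mem _ hc hc', fun i => ?_, ?_⟩
    · have h1 := h4 i
      have h2 := h4' i
      have h3 : (2:ℤ) ∣ ((c i).val : ℤ) + ((c' i).val : ℤ) - (((c + c') i).val : ℤ) := by
        rw [Pi.add_apply]; generalize c i = a; generalize c' i = b; revert a b; decide
      rw [Pi.add_apply]; omega
    · simp only [Pi.add_apply, Finset.sum_add_distrib]; omega
  neg_mem' := by
    intro x hx
    obtain ⟨n, c, hc, h4, h8⟩ := (isLeech_iff _).1 hx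
    refine (isLeech_iff _).2 ⟨-n, c, hc, fun i => ?_, ?_⟩
    · have h1 := h4 i
      rw [Pi.neg_apply]; omega
    · simp only [Pi.neg_apply, Finset.sum_neg_distrib]; omega

theorem mem_LeechL {x : Fin 24 → ℤ} : x ∈ LeechL ↔ IsLeech x := Iff.rfl

/-- Generators of the Leech lattice. -/
def lgen (k : Fin 37) : Fin 24 → ℤ := fun j =>
  if k.val < 12 then cond (gbit (Fin.ofNat 12 k.val) j) 2 0
  else if k.val = 12 then (if j = 0 then -3 else 1)
  else if k.val = 13 then (if j = 0 then 8 else 0)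
  else (if j.val = k.val - 13 then 4 else if j = 0 then -4 else 0)

theorem lgen_row (i : Fin 12) : lgen (Fin.castLE (by omega) i) = fun j => cond (gbit i j) 2 0 := by
  funext j
  have : (Fin.ofNat 12 (Fin.castLE (by omega : 12 ≤ 37) i).val) = i := by
    ext; simp
  simp only [lgen, this]
  rw [if_pos (by simp)]

theorem leech_gen {x : Fin 24 → ℤ} (hx : IsLeech x) : x ∈ AddSubgroup.closure (Set.range lgen) := by
  obtain ⟨m, c, hc, h4, h8⟩ := (isLeech_iff _).1 hx
  have hS : ∀ k, lgen k ∈ AddSubgroup.closure (Set.range lgen) :=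
    fun k => AddSubgroup.subset_closure ⟨k, rfl⟩
  set S := AddSubgroup.closure (Set.range lgen)
  -- the final piece
  have hz : ∀ z : Fin 24 → ℤ, (2:ℤ) ∣ ∑ i, z i → (fun i => 4 * z i) ∈ S := by
    intro z hz
    obtain ⟨q, hq⟩ := hz
    have hd : ∀ j : Fin 23, (fun i : Fin 24 => if i = j.succ then (4:ℤ) else if i = 0 then -4 else 0) ∈ S := by
      intro j
      have := hS (Fin.natAdd 14 j)
      convert this using 1
      funext i
      have h1 : ¬ (Fin.natAdd 14 j : Fin 37).val < 12 := by simp; omega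
      have h2 : ¬ (Fin.natAdd 14 j : Fin 37).val = 12 := by simp; omega
      have h3 : ¬ (Fin.natAdd 14 j : Fin 37).val = 13 := by simp; omega
      have h5 : i.val = (Fin.natAdd 14 j : Fin 37).val - 13 ↔ i = j.succ := by
        rw [Fin.ext_iff]; simp; omega
      simp only [lgen, if_neg h1, if_neg h2, if_neg h3, h5]
    have e : (fun i => 4 * z i) = (∑ j : Fin 23, z j.succ • (fun i : Fin 24 =>
        if i = j.succ then (4:ℤ) else if i = 0 then -4 else 0)) + q • lgen 13 := by
      funext i
      rw [Pi.add_apply, Finset.sum_apply]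
      simp only [Pi.smul_apply, smul_eq_mul]
      rw [Fin.sum_univ_succ] at hq
      have l13 : ∀ j, lgen 13 j = if j = 0 then 8 else 0 := by decide +kernel
      rw [l13]
      refine Fin.cases ?_ (fun j => ?_) i
      · have : ∀ j : Fin 23, (0 : Fin 24) = j.succ ↔ False := fun j => iff_false_intro (Fin.succ_ne_zero j).symm
        simp only [this, if_false, if_true, ← Finset.sum_mul]
        linarith
      · simp only [Fin.succ_ne_zero, if_false, Fin.succ_inj]
        simp [mul_comm]
    rw [e]
    exact S.add_mem (S.sum_mem fun j _ => S.zsmul_mem (hd j) _) (S.zsmul_mem (hS 13) _)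
  -- subtract the odd vector
  have hrow : ∀ b : Fin 12 → ZMod 2, (∑ i, ((b i).val : ℤ) • (fun j => cond (gbit i j) (2:ℤ) 0)) ∈ S := by
    intro b
    refine S.sum_mem fun i _ => S.zsmul_mem ?_ _
    rw [← lgen_row]; exact hS _
  have h8row : ∀ i, (8:ℤ) ∣ ∑ j, cond (gbit i j) (2:ℤ) 0 := by decide +kernel
  set r : Fin 24 → ℤ := ∑ i, ((c (piv i)).val : ℤ) • (fun j => cond (gbit i j) (2:ℤ) 0) with hr
  have hr8 : (8:ℤ) ∣ ∑ j, r j := by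
    simp only [hr, Finset.sum_apply, Pi.smul_apply, smul_eq_mul]
    rw [Finset.sum_comm]
    refine Finset.dvd_sum fun i _ => ?_
    rw [← Finset.mul_sum]
    exact Dvd.dvd.mul_left (h8row i) _
  have hrj : ∀ j, (4:ℤ) ∣ r j - 2 * ((c j).val : ℤ) := by
    intro j
    have h1 : r j = 2 * ∑ i, ((c (piv i)).val : ℤ) * ((golayMatrix i j).val : ℤ) := by
      simp only [hr, Finset.sum_apply, Pi.smul_apply, smul_eq_mul]
      rw [Finset.mul_sum]
      refine Finset.sum_congr rfl fun i _ => ?_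
      rw [golay_gbit]
      have : ∀ b, cond b (2:ℤ) 0 = 2 * ((b2z b).val : ℤ) := by decide
      rw [this]; ring
    have h2 : (2:ℤ) ∣ (∑ i, ((c (piv i)).val : ℤ) * ((golayMatrix i j).val : ℤ)) - ((c j).val : ℤ) := by
      have := (ZMod.intCast_zmod_eq_zero_iff_dvd ((∑ i, ((c (piv i)).val : ℤ) *
        ((golayMatrix i j).val : ℤ)) - ((c j).val : ℤ)) 2).1
      refine this ?_
      push_cast
      simp only [ZMod.natCast_val, ZMod.cast_id', id_eq]
      rw [← (mem_golay_iff c).1 hc j, sub_self]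
    omega
  have l12 : ∀ j, lgen 12 j = if j = 0 then -3 else 1 := by decide +kernel
  have l12' : ∀ j, (4:ℤ) ∣ lgen 12 j - 1 := by decide +kernel
  have l12s : ∑ j, lgen 12 j = 20 := by decide +kernel
  have hy4 : ∀ j, ∃ z, x j - m * lgen 12 j - r j = 4 * z := by
    intro j
    have h1 := h4 j
    have h2 := hrj j
    obtain ⟨t, ht⟩ := l12' j
    have : m * lgen 12 j = m + 4 * (m * t) := by linear_combination m * ht
    exact (by omega : (4:ℤ) ∣ x j - m * lgen 12 j - r j)
  choose z hz' using hy4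
  have hzs : (2:ℤ) ∣ ∑ j, z j := by
    have e : ∑ j, (x j - m * lgen 12 j - r j) = 4 * ∑ j, z j := by
      rw [Finset.mul_sum]; exact Finset.sum_congr rfl fun j _ => hz' j
    simp only [Finset.sum_sub_distrib, ← Finset.mul_sum, l12s] at e
    omega
  have e : x = (fun j => 4 * z j) + m • lgen 12 + r := by
    funext j
    have := hz' j
    simp only [Pi.add_apply, Pi.smul_apply, smul_eq_mul]
    linarith
  rw [e]
  exact S.add_mem (S.add_mem (hz z hzs) (S.zsmul_mem (hS 12) _)) (hrow _)

end

section

open Matrix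

/-! ## Elements of the automorphism group of the Leech lattice -/


/-- `toRat` as an additive homomorphism -/
def toRatHom : (Fin 24 → ℤ) →+ V24 where
  toFun := toRat
  map_zero' := by ext i; simp [toRat]
  map_add' x y := by ext i; simp [toRat]

theorem mem_LeechQ_iff (x : V24) : x ∈ LeechQ ↔ x ∈ LeechL.map toRatHom := by
  constructor
  · rintro ⟨y, hy, rfl⟩; exact ⟨y, hy, rfl⟩
  · rintro ⟨y, hy, rfl⟩; exact ⟨y, hy, rfl⟩

theorem LeechQ_add {x y : V24} (hx : x ∈ LeechQ) (hy : y ∈ LeechQ) : x + y ∈ LeechQ := by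
  rw [mem_LeechQ_iff] at *; exact AddSubgroup.add_mem _ hx hy

theorem LeechQ_neg {x : V24} (hx : x ∈ LeechQ) : -x ∈ LeechQ := by
  rw [mem_LeechQ_iff] at *; exact AddSubgroup.neg_mem _ hx

theorem LeechQ_zero : (0 : V24) ∈ LeechQ := by
  rw [mem_LeechQ_iff]; exact AddSubgroup.zero_mem _

theorem LeechQ_map {g : V24 →ₗ[ℚ] V24} (hg : ∀ k, g (toRat (lgen k)) ∈ LeechQ) {x : V24}
    (hx : x ∈ LeechQ) : g x ∈ LeechQ := by
  obtain ⟨y, hy, rfl⟩ := hx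
  have := leech_gen hy
  induction this using AddSubgroup.closure_induction with
  | mem x hx => obtain ⟨k, rfl⟩ := hx; exact hg k
  | zero => rw [show toRat 0 = 0 from toRatHom.map_zero, map_zero]; exact LeechQ_zero
  | add x y hx' hy' hx hy =>
    rw [show toRat (x + y) = toRat x + toRat y from toRatHom.map_add _ _, map_add]
    have h3 : ∀ {x}, x ∈ AddSubgroup.closure (Set.range lgen) → g (toRat x) ∈ LeechQ := by
      intro x h
      induction h using AddSubgroup.closure_induction with
      | mem x hx => obtain ⟨k, rfl⟩ := hx; exact hg k
      | zero => rw [show toRat 0 = 0 from toRatHom.map_zero, map_zero]; exact LeechQ_zero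
      | add x y _ _ hx hy =>
        rw [show toRat (x + y) = toRat x + toRat y from toRatHom.map_add _ _, map_add]
        exact LeechQ_add hx hy
      | neg x _ hx =>
        rw [show toRat (-x) = -toRat x from toRatHom.map_neg _, map_neg]
        exact LeechQ_neg hx
    exact LeechQ_add (h3 hx') (h3 hy')
  | neg x hx' hx =>
    rw [show toRat (-x) = -toRat x from toRatHom.map_neg _, map_neg]
    exact LeechQ_neg (hx (by
      have := LeechL.neg_mem (x := -x) hy
      rwa [neg_neg] at this))

theorem leechAut_of_gen (g : V24 ≃ₗ[ℚ] V24) (hi : ∀ x y, ratInner (g x) (g y) = ratInner x y)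
    (hgg : ∀ x, g (g x) = x) (hgen : ∀ k, g (toRat (lgen k)) ∈ LeechQ) : g ∈ LeechAut := by
  have h : ∀ x, x ∈ LeechQ → g x ∈ LeechQ := fun x hx => LeechQ_map (g := g.toLinearMap) hgen hx
  exact ⟨hi, fun x => ⟨h x, fun hx => by have := h _ hx; rwa [hgg] at this⟩⟩

/-- computable sufficient test for membership in the Leech lattice -/
def leechB (y : Fin 24 → ℤ) : Prop :=
  (∀ i, (y i - y 0 % 2) % 2 = 0) ∧ golB (fun i => decide ((y i - y 0 % 2 - 2) % 4 = 0)) ∧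
    ((∑ i, y i) - 4 * (y 0 % 2)) % 8 = 0

instance (y : Fin 24 → ℤ) : Decidable (leechB y) := by unfold leechB; infer_instance

theorem isLeech_of_leechB {y : Fin 24 → ℤ} (h : leechB y) : IsLeech y := by
  obtain ⟨h2, hc, h8⟩ := h
  refine ⟨y 0 % 2, by omega, fun i => by have := h2 i; omega, ?_, by omega⟩
  rw [mem_golay_iff]
  convert gol_of_golB hc using 2 with i
  simp only [b2z, Int.dvd_iff_emod_eq_zero]
  by_cases h : (y i - y 0 % 2 - 2) % 4 = 0
  · simp [h]
  · simp [h]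

theorem lgen_leech (k : Fin 37) : IsLeech (lgen k) := by
  have : ∀ k, leechB (lgen k) := by decide +kernel
  exact isLeech_of_leechB (this k)

/-! ### permutations -/

theorem perm_leech (π : Fin 24 ≃ Fin 24) (h : ∀ w ∈ GolayCode, w ∘ π ∈ GolayCode) (x : V24)
    (hx : x ∈ LeechQ) : x ∘ π ∈ LeechQ := by
  obtain ⟨y, ⟨m, hm, h2, hc, h8⟩, rfl⟩ := hx
  refine ⟨y ∘ π, ⟨m, hm, fun i => h2 _, h _ hc, ?_⟩, rfl⟩
  rwa [show (∑ i, (y ∘ π) i) = ∑ i, y i from Equiv.sum_comp π y]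

theorem perm_aut (π : Fin 24 ≃ Fin 24) (h : ∀ w ∈ GolayCode, w ∘ π ∈ GolayCode)
    (h' : ∀ w ∈ GolayCode, w ∘ π.symm ∈ GolayCode) :
    LinearEquiv.funCongrLeft ℚ ℚ π ∈ LeechAut := by
  refine ⟨fun x y => ?_, fun x => ⟨fun hx => perm_leech π h x hx, fun hx => ?_⟩⟩
  · show (∑ i, x (π i) * y (π i)) / 8 = (∑ i, x i * y i) / 8
    rw [Equiv.sum_comp π (fun i => x i * y i)]
  · have := perm_leech π.symm h' _ hx
    convert this using 1
    funext i
    show x i = x (π (π.symm i))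
    simp

theorem pmf_golay (m : Matrix (Fin 3) (Fin 3) K4) (hm : m.det ≠ 0) :
    ∀ w ∈ GolayCode, w ∘ pmf m ∈ GolayCode := by
  refine Matrix.diagonal_transvection_induction_of_det_ne_zero
    (fun m => ∀ w ∈ GolayCode, w ∘ pmf m ∈ GolayCode) m hm ?_ ?_ ?_
  · intro D hD
    rw [det_diagonal, Fin.prod_univ_three] at hD
    have e : diagonal D = !![D 0, 0, 0; 0, D 1, 0; 0, 0, D 2] := by
      ext i j; fin_cases i <;> fin_cases j <;> rfl
    rw [e]
    refine golay_comp _ (pmf_diag _ _ _ ?_ ?_ ?_) <;> rintro h0 <;> simp [h0] at hD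
  · rintro ⟨i, j, hij, c⟩
    exact golay_comp _ (pmf_transv i j hij c)
  · intro A B hA hB h1 h2 w hw
    have e : w ∘ pmf (A * B) = (w ∘ pmf A) ∘ pmf B := by
      funext i; exact congrArg w (pmf_mul A B hB i)
    rw [e]; exact h2 _ (h1 _ hw)

def pmE (m m' : Matrix (Fin 3) (Fin 3) K4) (h1 : m * m' = 1) (h2 : m' * m = 1) : Fin 24 ≃ Fin 24 where
  toFun := pmf m'
  invFun := pmf m
  left_inv i := by
    rw [← pmf_mul, h1, pmf_one]
    exact fun h => one_ne_zero (α := K4) (by rw [← det_one (n := Fin 3), ← h1, det_mul, h, mul_zero])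
  right_inv i := by
    rw [← pmf_mul, h2, pmf_one]
    exact fun h => one_ne_zero (α := K4) (by rw [← det_one (n := Fin 3), ← h1, det_mul, h, zero_mul])

theorem det_ne_of_mul {m m' : Matrix (Fin 3) (Fin 3) K4} (h1 : m * m' = 1) :
    m.det ≠ 0 ∧ m'.det ≠ 0 := by
  have : m.det * m'.det = 1 := by rw [← det_mul, h1, det_one]
  exact ⟨left_ne_zero_of_mul_eq_one this, right_ne_zero_of_mul_eq_one this⟩

/-- the automorphism of `ℚ²⁴` attached to `m` (with inverse `m'`) -/
def gD (m m' : Matrix (Fin 3) (Fin 3) K4) (h1 : m * m' = 1) (h2 : m' * m = 1) : V24 ≃ₗ[ℚ] V24 :=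
  LinearEquiv.funCongrLeft ℚ ℚ (pmE m m' h1 h2)

theorem gD_apply (m m' : Matrix (Fin 3) (Fin 3) K4) (h1 : m * m' = 1) (h2 : m' * m = 1) (x : V24)
    (i : Fin 24) : gD m m' h1 h2 x i = x (pmf m' i) := rfl

theorem gD_aut (m m' : Matrix (Fin 3) (Fin 3) K4) (h1 : m * m' = 1) (h2 : m' * m = 1) :
    gD m m' h1 h2 ∈ LeechAut :=
  perm_aut _ (pmf_golay m' (det_ne_of_mul h1).2) (pmf_golay m (det_ne_of_mul h1).1)

/-- Frobenius permutation -/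
def frf (i : Fin 24) : Fin 24 := if i.val < 21 then idx (star (rep i)) else th (star (thi i))

theorem frf_frf : ∀ i, frf (frf i) = i := by decide +kernel
theorem frf_gol : ∀ i, golB (gbit i ∘ frf) := by decide +kernel

def gS : V24 ≃ₗ[ℚ] V24 := LinearEquiv.funCongrLeft ℚ ℚ ⟨frf, frf, frf_frf, frf_frf⟩

theorem gS_apply (x : V24) (i : Fin 24) : gS x i = x (frf i) := rfl

theorem gS_aut : gS ∈ LeechAut :=
  perm_aut _ (golay_comp _ frf_gol) (golay_comp _ frf_gol)

theorem frf_idx (v : V3) (hv : v ≠ 0) : frf (idx v) = idx (star v) := by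
  revert v; rw [V3_forall]; decide +kernel
theorem frf_th (c : K4) (hc : c ≠ 0) : frf (th c) = th (star c) := by
  revert c; decide +kernel

/-! ### sign changes -/

theorem psi_mul_self (a : K4) : K4.psi a * K4.psi a = 1 := K4.psi_sq a

def sgnT (h : Matrix (Fin 3) (Fin 3) K4) (i : Fin 24) : ℚ :=
  if i.val < 21 then K4.psi (hp (rep i) (h *ᵥ rep i)) else 1

theorem sgnT_sq (h : Matrix (Fin 3) (Fin 3) K4) (i : Fin 24) : sgnT h i * sgnT h i = 1 := by
  unfold sgnT; split_ifs
  · exact K4.psi_sq _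
  · norm_num

theorem sgnT_add (h h' : Matrix (Fin 3) (Fin 3) K4) (i : Fin 24) :
    sgnT (h + h') i = sgnT h i * sgnT h' i := by
  unfold sgnT; split_ifs
  · rw [add_mulVec, hp_add_right, K4.psi_add]
  · norm_num

def gT (h : Matrix (Fin 3) (Fin 3) K4) : V24 ≃ₗ[ℚ] V24 :=
  LinearEquiv.ofInvolutive
    { toFun := fun x i => sgnT h i * x i
      map_add' := fun x y => by ext i; simp [mul_add]
      map_smul' := fun c x => by ext i; simp [mul_left_comm] }
    (fun x => by
      ext i
      show sgnT h i * (sgnT h i * x i) = x i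
      rw [← mul_assoc, sgnT_sq, one_mul])

theorem gT_apply (h : Matrix (Fin 3) (Fin 3) K4) (x : V24) (i : Fin 24) :
    gT h x i = sgnT h i * x i := rfl

theorem gT_add (h h' : Matrix (Fin 3) (Fin 3) K4) : gT (h + h') = gT h * gT h' := by
  ext x i
  show sgnT (h + h') i * _ = sgnT h i * (sgnT h' i * _)
  rw [sgnT_add, mul_assoc]

/-- explicit hermitian matrices -/
def hmat (a b c x y z : K4) : Matrix (Fin 3) (Fin 3) K4 :=
  !![a, z, star y; star z, b, x; y, star x, c]

def psiZ : K4 → ℤ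
  | .o => 1
  | .i => -1
  | .w => -1
  | .z => 1

theorem psiZ_cast (a : K4) : (psiZ a : ℚ) = K4.psi a := by cases a <;> simp [psiZ, K4.psi]

def sgnZ (h : Matrix (Fin 3) (Fin 3) K4) (i : Fin 24) : ℤ :=
  if i.val < 21 then psiZ (rep i 0 * star (mv3 h (rep i) 0) + rep i 1 * star (mv3 h (rep i) 1)
    + rep i 2 * star (mv3 h (rep i) 2)) else 1

theorem sgnZ_cast (h : Matrix (Fin 3) (Fin 3) K4) (i : Fin 24) : (sgnZ h i : ℚ) = sgnT h i := by
  unfold sgnZ sgnT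
  split_ifs
  · rw [psiZ_cast, hp_three, mv3_eq]
  · simp

theorem gT_aut_of (h : Matrix (Fin 3) (Fin 3) K4) (H : ∀ k, leechB (fun i => sgnZ h i * lgen k i)) :
    gT h ∈ LeechAut := by
  refine leechAut_of_gen _ (fun x y => ?_) (fun x => (gT h).left_inv x) (fun k => ?_)
  · show (∑ i, (sgnT h i * x i) * (sgnT h i * y i)) / 8 = _
    unfold ratInner
    congr 1
    refine Finset.sum_congr rfl fun i _ => ?_
    linear_combination (x i * y i) * sgnT_sq h i
  · refine ⟨_, isLeech_of_leechB (H k), ?_⟩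
    ext i
    simp only [gT_apply, toRat, Int.cast_mul, sgnZ_cast]

theorem gT_check : ∀ (x : K4) (k : Fin 37),
    (leechB (fun i => sgnZ (hmat (x * star x) 0 0 0 0 0) i * lgen k i)) ∧
    (leechB (fun i => sgnZ (hmat 0 (x * star x) 0 0 0 0) i * lgen k i)) ∧
    (leechB (fun i => sgnZ (hmat 0 0 (x * star x) 0 0 0) i * lgen k i)) ∧
    (leechB (fun i => sgnZ (hmat 0 0 0 x 0 0) i * lgen k i)) ∧
    (leechB (fun i => sgnZ (hmat 0 0 0 0 x 0) i * lgen k i)) ∧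
    (leechB (fun i => sgnZ (hmat 0 0 0 0 0 x) i * lgen k i)) := by decide +kernel

theorem herm_eq (h : Matrix (Fin 3) (Fin 3) K4) (hh : hᴴ = h) :
    h = hmat (h 0 0 * star (h 0 0)) 0 0 0 0 0 + hmat 0 (h 1 1 * star (h 1 1)) 0 0 0 0
      + hmat 0 0 (h 2 2 * star (h 2 2)) 0 0 0 + hmat 0 0 0 (h 1 2) 0 0 + hmat 0 0 0 0 (h 2 0) 0
      + hmat 0 0 0 0 0 (h 0 1) := by
  have e : ∀ i j, star (h i j) = h j i := fun i j => by
    conv_rhs => rw [← hh]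
    rfl
  have d : ∀ a : K4, star a = a → a * star a = a := by decide +kernel
  ext i j
  fin_cases i <;> fin_cases j <;> simp [hmat, e, d]
  · exact (d _ (e 0 0)).symm.trans (by rw [e])
  · exact (d _ (e 1 1)).symm.trans (by rw [e])
  · exact (d _ (e 2 2)).symm.trans (by rw [e])

theorem gT_aut (h : Matrix (Fin 3) (Fin 3) K4) (hh : hᴴ = h) : gT h ∈ LeechAut := by
  rw [herm_eq h hh]
  simp only [gT_add]
  refine LeechAut.mul_mem (LeechAut.mul_mem (LeechAut.mul_mem (LeechAut.mul_mem
    (LeechAut.mul_mem ?_ ?_) ?_) ?_) ?_) ?_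
  · exact gT_aut_of _ fun k => (gT_check (h 0 0) k).1
  · exact gT_aut_of _ fun k => (gT_check (h 1 1) k).2.1
  · exact gT_aut_of _ fun k => (gT_check (h 2 2) k).2.2.1
  · exact gT_aut_of _ fun k => (gT_check (h 1 2) k).2.2.2.1
  · exact gT_aut_of _ fun k => (gT_check (h 2 0) k).2.2.2.2.1
  · exact gT_aut_of _ fun k => (gT_check (h 0 1) k).2.2.2.2.2

end

section

open Matrix

/-! ## The partial Fourier transform as an automorphism of the Leech lattice -/


def chiZ : K4 → ℤ
  | .o => 1
  | .i => 1
  | .w => -1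
  | .z => -1

theorem chiZ_cast (a : K4) : (chiZ a : ℚ) = K4.chi a := by cases a <;> simp [chiZ, K4.chi]

/-- `FF` of the `j`-th basis vector -/
def FZ (j : Fin 24) (v : V3) : ℤ :=
  if v = 0 then (if 21 ≤ j.val then -1 else 0) else (if j = idx v then 1 else 0)

theorem FZ_cast (j : Fin 24) (v : V3) : (FZ j v : ℚ) = FF (Pi.single j 1) v := by
  by_cases hv : v = 0
  · subst hv
    rw [FF_zero]
    have : ∀ j : Fin 24, FZ j 0 = -((if (21 : Fin 24) = j then 1 else 0) + (if (22 : Fin 24) = j then 1 else 0)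
      + (if (23 : Fin 24) = j then 1 else 0)) := by decide +kernel
    rw [this]
    simp only [Pi.single_apply]
    push_cast
    rfl
  · rw [FF_ne _ hv, FZ, if_neg hv, Pi.single_apply]
    simp [eq_comm]

def KZ (i j : Fin 24) : ℤ :=
  if i = 0 then (if j = 0 ∨ 21 ≤ j.val then 1 else 0)
  else if 21 ≤ i.val then (if i = j then 1 else if j = 0 then 1 else if 21 ≤ j.val then -1 else 0)
  else -(FZ j ![.o, rep i 1, rep i 2] + chiZ (rep i 0) * FZ j ![.i, rep i 1, rep i 2]
    + chiZ (rep i 0 * .z) * FZ j ![.w, rep i 1, rep i 2]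
    + chiZ (rep i 0 * .w) * FZ j ![.z, rep i 1, rep i 2])

theorem KZ_sq : ∀ i j, ∑ k, KZ i k * KZ k j = if i = j then 4 else 0 := by decide +kernel
theorem KZ_symm : ∀ i j, KZ i j = KZ j i := by decide +kernel

theorem KZ_FF : ∀ (j : Fin 24) (x y c : K4),
    (if ![x, y, c] = 0 then -(KZ 21 j + KZ 22 j + KZ 23 j) else KZ (idx ![x, y, c]) j) =
      -(FZ j ![.o, y, c] + chiZ x * FZ j ![.i, y, c]
    + chiZ (x * .z) * FZ j ![.w, y, c] + chiZ (x * .w) * FZ j ![.z, y, c]) := by decide +kernel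

theorem KZ_gen : ∀ k : Fin 37, (∀ i, (∑ j, KZ i j * lgen k j) % 2 = 0) ∧
    leechB (fun i => (∑ j, KZ i j * lgen k j) / 2) := by decide +kernel

def gKlin : V24 →ₗ[ℚ] V24 where
  toFun x i := (1/2 : ℚ) * ∑ j, (KZ i j : ℚ) * x j
  map_add' x y := by ext i; simp [mul_add, Finset.sum_add_distrib]
  map_smul' c x := by
    ext i; simp only [Pi.smul_apply, smul_eq_mul, RingHom.id_apply, Finset.mul_sum]
    exact Finset.sum_congr rfl fun j _ => by ring

theorem KZ_sqQ (i j : Fin 24) : ∑ k, (KZ i k : ℚ) * KZ k j = if i = j then 4 else 0 := by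
  have := congrArg (Int.cast : ℤ → ℚ) (KZ_sq i j)
  push_cast at this
  exact this

def gK : V24 ≃ₗ[ℚ] V24 :=
  LinearEquiv.ofInvolutive gKlin (fun x => by
    ext i
    show (1/2 : ℚ) * ∑ j, (KZ i j : ℚ) * ((1/2 : ℚ) * ∑ k, (KZ j k : ℚ) * x k) = x i
    have e : ∑ j, (KZ i j : ℚ) * ((1/2 : ℚ) * ∑ k, (KZ j k : ℚ) * x k) =
        (1/2 : ℚ) * ∑ k, (∑ j, (KZ i j : ℚ) * KZ j k) * x k := by
      simp only [Finset.mul_sum, Finset.sum_mul]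
      rw [Finset.sum_comm]
      exact Finset.sum_congr rfl fun j _ => Finset.sum_congr rfl fun k _ => by ring
    rw [e]
    simp only [KZ_sqQ]
    simp
    ring)

theorem gK_apply (x : V24) (i : Fin 24) : gK x i = (1/2 : ℚ) * ∑ j, (KZ i j : ℚ) * x j := rfl

theorem gK_gK (x : V24) : gK (gK x) = x := gK.left_inv x

theorem gK_adj (x y : V24) : ratInner (gK x) y = ratInner x (gK y) := by
  unfold ratInner
  congr 1
  simp only [gK_apply, Finset.mul_sum, Finset.sum_mul]
  rw [Finset.sum_comm]
  refine Finset.sum_congr rfl fun j _ => Finset.sum_congr rfl fun k _ => ?_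
  rw [KZ_symm k j]; ring

theorem gK_aut : gK ∈ LeechAut := by
  refine leechAut_of_gen _ (fun x y => by rw [gK_adj, gK_gK]) gK_gK (fun k => ?_)
  obtain ⟨h1, h2⟩ := KZ_gen k
  refine ⟨_, isLeech_of_leechB h2, ?_⟩
  ext i
  simp only [gK_apply, toRat]
  have h3 : (((∑ j, KZ i j * lgen k j) / 2 : ℤ) : ℚ) = (∑ j, KZ i j * lgen k j : ℤ) / 2 := by
    have := h1 i
    rw [Int.cast_div (Int.dvd_of_emod_eq_zero this) (by norm_num)]
    norm_num
  rw [h3]; push_cast; ring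

theorem FF_gK (x : V24) : FF (gK x) = opK (FF x) := by
  have : FF ∘ₗ gK.toLinearMap = opK ∘ₗ FF := by
    refine LinearMap.pi_ext' fun j => LinearMap.ext_ring ?_
    show FF (gK (Pi.single j 1)) = opK (FF (Pi.single j 1))
    have hg : ∀ i, gK (Pi.single j 1) i = (1/2 : ℚ) * KZ i j := by
      intro i; rw [gK_apply]; simp [Pi.single_apply]
    funext v
    have e : opK (FF (Pi.single j 1)) v =
        (-1/2 : ℚ) * ∑ t : K4, K4.chi (v 0 * star t) * FF (Pi.single j 1) ![t, v 1, v 2] := rfl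
    have K := congrArg (Int.cast : ℤ → ℚ) (KZ_FF j (v 0) (v 1) (v 2))
    rw [← V3_eta v] at K
    rw [e, K4.sum_K4]
    simp only [← FZ_cast, ← chiZ_cast]
    push_cast at K
    have s0 : chiZ (v 0 * star 0) = 1 := by rw [star_zero, mul_zero]; rfl
    have s1 : chiZ (v 0 * star 1) = chiZ (v 0) := by rw [star_one, mul_one]
    rw [s0, s1, show star K4.w = K4.z from rfl, show star K4.z = K4.w from rfl]
    rw [show ![(0 : K4), v 1, v 2] = ![K4.o, v 1, v 2] from rfl,
      show ![(1 : K4), v 1, v 2] = ![K4.i, v 1, v 2] from rfl]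
    by_cases hv : v = 0
    · rw [if_pos hv] at K
      have : FF (gK (Pi.single j 1)) v = 1/2 * (-((KZ 21 j : ℚ) + KZ 22 j + KZ 23 j)) := by
        rw [hv, FF_zero, hg, hg, hg]; ring
      rw [this, K]; push_cast; ring
    · rw [if_neg hv] at K
      rw [FF_ne _ hv, hg, K]; push_cast; ring
  exact LinearMap.congr_fun this x

theorem FF_gD (m m' : Matrix (Fin 3) (Fin 3) K4) (h1 : m * m' = 1) (h2 : m' * m = 1) (x : V24) :
    FF (gD m m' h1 h2 x) = opD m' (FF x) := by
  funext v
  show _ = FF x (m' *ᵥ v)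
  by_cases hv : v = 0
  · rw [hv, mulVec_zero, FF_zero, FF_zero]
    have hd := (det_ne_of_mul h1).2
    have e1 := pmf_th m' (c := .i) (by decide)
    have e2 := pmf_th m' (c := .w) (by decide)
    have e3 := pmf_th m' (c := .z) (by decide)
    simp only [gD_apply]
    change pmf m' 21 = _ at e1
    change pmf m' 22 = _ at e2
    change pmf m' 23 = _ at e3
    rw [e1, e2, e3]
    generalize m'.det = d at hd
    cases d
    · exact absurd rfl hd
    · rfl
    · show -(x 22 + x 23 + x 21) = _
      ring
    · show -(x 23 + x 21 + x 22) = _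
      ring
  · rw [FF_ne _ hv, gD_apply, pmf_idx _ hv, FF_ne _ (mulVec_ne (det_ne_of_mul h1).2 hv)]

theorem FF_gS (x : V24) : FF (gS x) = opS (FF x) := by
  funext v
  show _ = FF x (star v)
  by_cases hv : v = 0
  · rw [hv, star_zero, FF_zero, FF_zero]
    show -(x 21 + x 23 + x 22) = _
    ring
  · rw [FF_ne _ hv, gS_apply, frf_idx v hv, FF_ne _ (by simpa using hv)]

theorem sgnT_idx (h : Matrix (Fin 3) (Fin 3) K4) {v : V3} (hv : v ≠ 0) :
    sgnT h (idx v) = K4.psi (hp v (h *ᵥ v)) := by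
  obtain ⟨c, hc, hvc⟩ := exists_smul_rep v hv
  have e : hp v (h *ᵥ v) = hp (rep (idx v)) (h *ᵥ rep (idx v)) := by
    conv_lhs => rw [hvc]
    rw [mulVec_smul, hp_smul_left, hp_smul_right, ← mul_assoc]
    have : ∀ c : K4, c ≠ 0 → c * star c = 1 := by decide +kernel
    rw [this c hc, one_mul]
  rw [e, sgnT, if_pos (idx_lt v)]

theorem sgnT_th (h : Matrix (Fin 3) (Fin 3) K4) (c : K4) : sgnT h (th c) = 1 := by
  rw [sgnT, if_neg (by have := th_ge c; omega)]

theorem FF_gT (h : Matrix (Fin 3) (Fin 3) K4) (x : V24) : FF (gT h x) = opT h (FF x) := by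
  funext v
  show _ = K4.psi (hp v (h *ᵥ v)) * FF x v
  by_cases hv : v = 0
  · have e : hp (0 : V3) (h *ᵥ 0) = 0 := by simp [hp]
    rw [hv, e, K4.psi_zero, one_mul, FF_zero, FF_zero]
    have h1 : gT h x 21 = x 21 := by rw [gT_apply]; exact (congrArg (· * _) (sgnT_th h .i)).trans (one_mul _)
    have h2 : gT h x 22 = x 22 := by rw [gT_apply]; exact (congrArg (· * _) (sgnT_th h .w)).trans (one_mul _)
    have h3 : gT h x 23 = x 23 := by rw [gT_apply]; exact (congrArg (· * _) (sgnT_th h .z)).trans (one_mul _)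
    rw [h1, h2, h3]
  · rw [FF_ne _ hv, FF_ne _ hv, gT_apply, sgnT_idx h hv]

/-! ## Good automorphisms -/

def wa (w : W6) : V3 := fun i => w (Sum.inl i)
def wb (w : W6) : V3 := fun i => w (Sum.inr i)

def Iso6 (w : W6) : Prop := hp (wa w) (wb w) = star (hp (wa w) (wb w))

def ta (w : W6) : Fun64 →ₗ[ℚ] Fun64 := tau (wa w) (wb w)

/-- `g` is an automorphism of the Leech lattice which acts on the operators `ta w` through `φ`,
and on the last three coordinates through `r` and the sign `s`. -/
structure Good (g : V24 ≃ₗ[ℚ] V24) (φ : W6 → W6) (r : K4 → K4) (s : ℚ) : Prop where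
  aut : g ∈ LeechAut
  op : ∃ G : Fun64 →ₗ[ℚ] Fun64, (∀ x, FF (g x) = G (FF x)) ∧
    ∀ w, Iso6 w → ∀ f, G (ta w f) = ta (φ w) (G f)
  iso : ∀ w, Iso6 w → Iso6 (φ w)
  act : ∀ x, ∀ c d : K4, c ≠ 0 → d ≠ 0 →
    g x (th c) - g x (th d) = s * (x (th (r c)) - x (th (r d)))
  rne : ∀ c, c ≠ 0 → r c ≠ 0

theorem Good.mul {g g' : V24 ≃ₗ[ℚ] V24} {φ φ' : W6 → W6} {r r' : K4 → K4} {s s' : ℚ}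
    (h : Good g φ r s) (h' : Good g' φ' r' s') :
    Good (g * g') (φ ∘ φ') (r' ∘ r) (s * s') where
  aut := LeechAut.mul_mem h.aut h'.aut
  op := by
    obtain ⟨G, h1, h2⟩ := h.op
    obtain ⟨G', h1', h2'⟩ := h'.op
    refine ⟨G ∘ₗ G', fun x => ?_, fun w hw f => ?_⟩
    · show FF (g (g' x)) = G (G' (FF x))
      rw [h1, h1']
    · show G (G' (ta w f)) = ta (φ (φ' w)) (G (G' f))
      rw [h2' w hw, h2 _ (h'.iso w hw)]
  iso := fun w hw => h.iso _ (h'.iso w hw)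
  act := fun x c d hc hd => by
    show g (g' x) (th c) - g (g' x) (th d) = _
    rw [h.act _ c d hc hd, h'.act _ _ _ (h.rne c hc) (h.rne d hd), mul_assoc]
    rfl
  rne := fun c hc => h'.rne _ (h.rne c hc)

theorem good_neg : Good (LinearEquiv.neg ℚ) id id (-1) where
  aut := by
    refine ⟨fun x y => ?_, fun x => ⟨fun h => LeechQ_neg h, fun h => ?_⟩⟩
    · show ratInner (-x) (-y) = _
      simp [ratInner]
    · have := LeechQ_neg h
      rwa [show -(LinearEquiv.neg ℚ x) = x from neg_neg x] at this
  op := ⟨-LinearMap.id, fun x => by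
      show FF (-x) = -FF x
      exact map_neg _ _, fun w _ f => by
      show -(ta w f) = ta w (-f)
      rw [map_neg]⟩
  iso := fun w hw => hw
  act := fun x c d _ _ => by
    show -x (th c) - -x (th d) = _
    simp only [id]; ring
  rne := fun c hc => hc

theorem good_S : Good gS star star 1 where
  aut := gS_aut
  op := ⟨opS, FF_gS, fun w hw f => opS_tau _ _ hw f⟩
  iso := fun w hw => by
    have e : hp (wa (star w)) (wb (star w)) = star (hp (wa w) (wb w)) := by
      simp [hp_three, wa, wb]
    unfold Iso6 at *
    rw [e, ← hw, ← hw]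
  act := fun x c d hc hd => by
    rw [gS_apply, gS_apply, frf_th c hc, frf_th d hd, one_mul]
  rne := fun c hc => by simpa using hc

/-- linear good elements -/
def GoodM (N : Matrix (Fin 3 ⊕ Fin 3) (Fin 3 ⊕ Fin 3) K4) (g : V24 ≃ₗ[ℚ] V24) : Prop :=
  Good g (fun w => N *ᵥ w) (fun c => N.det * c) 1

theorem GoodM.mul {N N' : Matrix (Fin 3 ⊕ Fin 3) (Fin 3 ⊕ Fin 3) K4} {g g' : V24 ≃ₗ[ℚ] V24}
    (h : GoodM N g) (h' : GoodM N' g') : GoodM (N * N') (g * g') := by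
  have := Good.mul h h'
  unfold GoodM
  convert this using 1
  · funext w; simp [Function.comp, mulVec_mulVec]
  · funext c; simp only [Function.comp, det_mul]; ring
  · norm_num

def matD (m m' : Matrix (Fin 3) (Fin 3) K4) : Matrix (Fin 3 ⊕ Fin 3) (Fin 3 ⊕ Fin 3) K4 :=
  fromBlocks m 0 0 m'ᴴ

def matT (h : Matrix (Fin 3) (Fin 3) K4) : Matrix (Fin 3 ⊕ Fin 3) (Fin 3 ⊕ Fin 3) K4 :=
  fromBlocks 1 0 h 1

theorem wa_blocks (A B C D : Matrix (Fin 3) (Fin 3) K4) (w : W6) :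
    wa (fromBlocks A B C D *ᵥ w) = A *ᵥ wa w + B *ᵥ wb w := by
  ext i
  simp only [wa, wb, fromBlocks_mulVec, Function.comp_def]
  rfl
theorem wb_blocks (A B C D : Matrix (Fin 3) (Fin 3) K4) (w : W6) :
    wb (fromBlocks A B C D *ᵥ w) = C *ᵥ wa w + D *ᵥ wb w := by
  ext i
  simp only [wa, wb, fromBlocks_mulVec, Function.comp_def]
  rfl

theorem goodM_D (m m' : Matrix (Fin 3) (Fin 3) K4) (h1 : m * m' = 1) (h2 : m' * m = 1) :
    GoodM (matD m m') (gD m m' h1 h2) where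
  aut := gD_aut ..
  op := ⟨opD m', FF_gD m m' h1 h2, fun w hw f => by
    unfold ta matD
    rw [wa_blocks, wb_blocks]
    simp only [zero_mulVec, add_zero, zero_add]
    exact opD_tau m m' h2 _ _ f⟩
  iso := fun w hw => by
    unfold Iso6 matD at *
    rw [wa_blocks, wb_blocks]
    simp only [zero_mulVec, add_zero, zero_add]
    rw [← hp_mulVec, mulVec_mulVec, h2, one_mulVec]
    exact hw
  act := fun x c d hc hd => by
    have e : (matD m m').det = m'.det := by
      rw [matD, det_fromBlocks_zero₂₁, det_conjTranspose]
      have h : m.det * m'.det = 1 := by rw [← det_mul, h1, det_one]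
      generalize m.det = a at *
      generalize m'.det = b at *
      revert a b; decide +kernel
    rw [gD_apply, gD_apply, pmf_th _ hc, pmf_th _ hd, one_mul, e]
  rne := fun c hc => by
    refine mul_ne_zero ?_ hc
    rw [matD, det_fromBlocks_zero₂₁, det_conjTranspose]
    exact mul_ne_zero (det_ne_of_mul h1).1 (star_ne_zero.2 (det_ne_of_mul h1).2)

theorem goodM_T (h : Matrix (Fin 3) (Fin 3) K4) (hh : hᴴ = h) : GoodM (matT h) (gT h) where
  aut := gT_aut h hh
  op := ⟨opT h, FF_gT h, fun w hw f => by
    unfold ta matT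
    rw [wa_blocks, wb_blocks]
    simp only [zero_mulVec, add_zero, one_mulVec]
    rw [add_comm]
    exact opT_tau h hh _ _ f⟩
  iso := fun w hw => by
    unfold Iso6 matT at *
    rw [wa_blocks, wb_blocks]
    simp only [zero_mulVec, add_zero, one_mulVec]
    rw [hp_add_right, star_add, ← hw, hp_star, hp_mulVec, hh]
  act := fun x c d hc hd => by
    have e : (matT h).det = 1 := by simp [matT]
    simp only [gT_apply, sgnT_th, one_mul, e]
  rne := fun c hc => by
    have e : (matT h).det = 1 := by simp [matT]
    simpa [e] using hc

/-- permutation matrix exchanging the first coordinates of `a` and `b` -/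
def matK : Matrix (Fin 3 ⊕ Fin 3) (Fin 3 ⊕ Fin 3) K4 :=
  fromBlocks (diagonal ![0, 1, 1]) (diagonal ![1, 0, 0]) (diagonal ![1, 0, 0]) (diagonal ![0, 1, 1])

theorem matK_det : matK.det = 1 := by
  have h : matK = fromBlocks 1 (diagonal ![1, 0, 0]) 0 1 * fromBlocks 1 0 (diagonal ![1, 0, 0]) 1 *
      fromBlocks 1 (diagonal ![1, 0, 0]) 0 1 := by
    rw [fromBlocks_multiply, fromBlocks_multiply, matK]
    congr 1 <;> ext i j <;> fin_cases i <;> fin_cases j <;> decide +kernel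
  rw [h]
  simp [det_mul]

theorem goodM_K : GoodM matK gK where
  aut := gK_aut
  op := ⟨opK, FF_gK, fun w hw f => by
    unfold ta matK
    rw [wa_blocks, wb_blocks, opK_tau]
    congr 2
    · ext i; fin_cases i <;> simp [mulVec_diagonal]
    · ext i; fin_cases i <;> simp [mulVec_diagonal]⟩
  iso := fun w hw => by
    unfold Iso6 matK at *
    rw [wa_blocks, wb_blocks]
    simp only [hp_three, mulVec_diagonal, Pi.add_apply, cons_val_zero, cons_val_one, cons_val,
      one_mul, zero_mul, zero_add, add_zero, star_add, star_mul, star_star] at hw ⊢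
    generalize wa w 0 = a0 at *
    generalize wa w 1 = a1 at *
    generalize wa w 2 = a2 at *
    generalize wb w 0 = b0 at *
    generalize wb w 1 = b1 at *
    generalize wb w 2 = b2 at *
    have h2 : (2 : K4) = 0 := by decide
    linear_combination hw + (b0 * star a0 - a0 * star b0) * h2
  act := fun x c d hc hd => by
    rw [matK_det]
    have e : ∀ c d : K4, c ≠ 0 → d ≠ 0 → ∀ j, KZ (th c) j - KZ (th d) j =
        2 * ((if j = th c then 1 else 0) - (if j = th d then 1 else 0)) := by decide +kernel
    rw [gK_apply, gK_apply, ← mul_sub, ← Finset.sum_sub_distrib]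
    have e2 : ∀ j, (KZ (th c) j : ℚ) * x j - KZ (th d) j * x j =
        2 * ((if j = th c then x j else 0) - (if j = th d then x j else 0)) := by
      intro j
      have := congrArg (Int.cast : ℤ → ℚ) (e c d hc hd j)
      push_cast at this
      rw [← sub_mul, this]
      split_ifs <;> ring
    simp only [e2, ← Finset.mul_sum, Finset.sum_sub_distrib, Finset.sum_ite_eq', Finset.mem_univ,
      if_true, one_mul]
    ring
  rne := fun c hc => by
    rw [matK_det, one_mul]; exact hc

end

section

open Matrix

/-! ## Generation of the unitary group -/


abbrev M3 : Type := Matrix (Fin 3) (Fin 3) K4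
abbrev M6 : Type := Matrix (Fin 3 ⊕ Fin 3) (Fin 3 ⊕ Fin 3) K4

def JJ : M6 := fromBlocks 0 1 1 0

def UU (N : M6) : Prop := Nᴴ * JJ * N = JJ

theorem UU.mul {X Y : M6} (hX : UU X) (hY : UU Y) : UU (X * Y) := by
  unfold UU at *
  rw [conjTranspose_mul]
  calc Yᴴ * Xᴴ * JJ * (X * Y) = Yᴴ * (Xᴴ * JJ * X) * Y := by simp only [Matrix.mul_assoc]
    _ = JJ := by rw [hX, hY]

theorem UU_blocks (A B C D : M3) : UU (fromBlocks A B C D) ↔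
    (Cᴴ * A + Aᴴ * C = 0 ∧ Cᴴ * B + Aᴴ * D = 1 ∧ Dᴴ * A + Bᴴ * C = 1 ∧ Dᴴ * B + Bᴴ * D = 0) := by
  unfold UU JJ
  rw [fromBlocks_conjTranspose, fromBlocks_multiply, fromBlocks_multiply, fromBlocks_inj]
  simp

theorem m3_two (X : M3) : X + X = 0 := by
  ext i j; exact K4.add_self _

theorem UU_matD {m m' : M3} (h2 : m' * m = 1) (h1 : m * m' = 1) : UU (matD m m') := by
  rw [matD, UU_blocks]
  refine ⟨by simp, ?_, by simpa using h2, by simp⟩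
  rw [← conjTranspose_mul, h2]; simp

theorem UU_matT {h : M3} (hh : hᴴ = h) : UU (matT h) := by
  rw [matT, UU_blocks, hh]
  simp [m3_two]

/-- swap matrices -/
def matS (s : Fin 3 → K4) : M6 :=
  fromBlocks (diagonal fun i => 1 + s i) (diagonal s) (diagonal s) (diagonal fun i => 1 + s i)

theorem UU_matS (s : Fin 3 → K4) (hs : ∀ i, s i = 0 ∨ s i = 1) : UU (matS s) := by
  rw [matS, UU_blocks]
  have h : ∀ a : K4, a = 0 ∨ a = 1 → star a * (1 + a) + (1 + star a) * a = 0 ∧ star a * a + (1 + star a) * (1 + a) = 1 := by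
    decide +kernel
  simp only [diagonal_conjTranspose, diagonal_mul_diagonal, diagonal_add]
  refine ⟨?_, ?_, ?_, ?_⟩
  · rw [diagonal_eq_zero]; funext i; simpa [add_comm] using (h _ (hs i)).1
  · rw [← diagonal_one]; congr 1; funext i; simpa using (h _ (hs i)).2
  · rw [← diagonal_one]; congr 1; funext i; simpa [add_comm] using (h _ (hs i)).2
  · rw [diagonal_eq_zero]; funext i; simpa [add_comm] using (h _ (hs i)).1

def PP (N : M6) : Prop := ∃ g, GoodM N g

theorem PP.mul {X Y : M6} : PP X → PP Y → PP (X * Y) := fun ⟨_, h⟩ ⟨_, h'⟩ => ⟨_, h.mul h'⟩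

theorem PP_D {m m' : M3} (h1 : m * m' = 1) (h2 : m' * m = 1) : PP (matD m m') := ⟨_, goodM_D m m' h1 h2⟩
theorem PP_T {h : M3} (hh : hᴴ = h) : PP (matT h) := ⟨_, goodM_T h hh⟩

theorem matD_mul (m m' n n' : M3) : matD m m' * matD n n' = matD (m * n) (n' * m') := by
  simp [matD, fromBlocks_multiply]

theorem matD_one : matD 1 1 = 1 := by simp [matD]

theorem matS_mul (s t : Fin 3 → K4) (hs : ∀ i, s i = 0 ∨ s i = 1) (ht : ∀ i, t i = 0 ∨ t i = 1) :
    matS s * matS t = matS (s + t) := by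
  have h : ∀ a b : K4, a = 0 ∨ a = 1 → b = 0 ∨ b = 1 →
      (1 + a) * (1 + b) + a * b = 1 + (a + b) ∧ (1 + a) * b + a * (1 + b) = a + b := by decide +kernel
  simp only [matS, fromBlocks_multiply, diagonal_mul_diagonal, diagonal_add]
  rw [fromBlocks_inj]
  refine ⟨?_, ?_, ?_, ?_⟩ <;> congr 1 <;> funext i <;> have := h _ _ (hs i) (ht i) <;>
    simp only [Pi.add_apply]
  · exact this.1
  · exact this.2
  · rw [add_comm]; exact this.2
  · rw [add_comm]; exact this.1

theorem matS_zero : matS 0 = 1 := by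
  simp [matS]

/-- permutation matrix of a transposition with `0` -/
def prm (i : Fin 3) : M3 := fun a b => if Equiv.swap 0 i a = b then 1 else 0

theorem prm_sq : ∀ i, prm i * prm i = 1 := by
  intro i; fin_cases i <;> ext a b <;> fin_cases a <;> fin_cases b <;> decide +kernel

theorem PP_single (i : Fin 3) : PP (matS (Pi.single i 1)) := by
  have e : matS (Pi.single i 1) = matD (prm i) (prm i) * matK * matD (prm i) (prm i) := by
    simp only [matS, matD, matK, fromBlocks_multiply]
    rw [fromBlocks_inj]
    refine ⟨?_, ?_, ?_, ?_⟩ <;> fin_cases i <;> ext a b <;> fin_cases a <;> fin_cases b <;>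
      decide +kernel
  rw [e]
  exact ((PP_D (prm_sq i) (prm_sq i)).mul ⟨_, goodM_K⟩).mul (PP_D (prm_sq i) (prm_sq i))

theorem PP_S (s : Fin 3 → K4) (hs : ∀ i, s i = 0 ∨ s i = 1) : PP (matS s) := by
  have h1 : ∀ i, PP (matS (Pi.single i (s i))) := by
    intro i
    rcases hs i with h | h <;> rw [h]
    · rw [Pi.single_zero, matS_zero, ← matD_one]; exact PP_D (by simp) (by simp)
    · exact PP_single i
  have h01 : ∀ i j, (Pi.single i (s i) : Fin 3 → K4) j = 0 ∨ (Pi.single i (s i) : Fin 3 → K4) j = 1 := by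
    intro i j
    by_cases h : j = i
    · subst h; simpa using hs j
    · left; simp [h]
  have e : s = Pi.single 0 (s 0) + Pi.single 1 (s 1) + Pi.single 2 (s 2) := by
    ext i; fin_cases i <;> simp
  have h012 : ∀ j, (Pi.single 0 (s 0) + Pi.single 1 (s 1) : Fin 3 → K4) j = 0 ∨
      (Pi.single 0 (s 0) + Pi.single 1 (s 1) : Fin 3 → K4) j = 1 := by
    intro j
    fin_cases j
    · simpa using hs 0
    · simpa using hs 1
    · left; simp
  rw [e, ← matS_mul _ _ h012 (h01 2), ← matS_mul _ _ (h01 0) (h01 1)]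
  exact ((h1 0).mul (h1 1)).mul (h1 2)

theorem PP_redS (s : Fin 3 → K4) (hs : ∀ i, s i = 0 ∨ s i = 1) {N : M6} (h : PP (matS s * N)) : PP N := by
  have := (PP_S s hs).mul h
  rwa [← Matrix.mul_assoc, matS_mul s s hs hs, show s + s = 0 from funext fun i => K4.add_self _, matS_zero,
    Matrix.one_mul] at this

theorem PP_redT {h : M3} (hh : hᴴ = h) {N : M6} (hN : PP (matT h * N)) : PP N := by
  have := (PP_T hh).mul hN
  rwa [← Matrix.mul_assoc, show matT h * matT h = 1 by simp [matT, fromBlocks_multiply, m3_two], Matrix.one_mul] at this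

theorem PP_redD {m m' n n' : M3} (h1 : m * m' = 1) (h2 : m' * m = 1) (g1 : n * n' = 1) (g2 : n' * n = 1)
    {N : M6} (hN : PP (matD m m' * N * matD n n')) : PP N := by
  have := ((PP_D h2 h1).mul hN).mul (PP_D g2 g1)
  rw [show matD m' m * (matD m m' * N * matD n n') * matD n' n =
    (matD m' m * matD m m') * N * (matD n n' * matD n' n) by simp only [Matrix.mul_assoc]] at this
  rwa [matD_mul, matD_mul, h2, g1, matD_one, Matrix.one_mul, Matrix.mul_one] at this

/-- lower triangular case -/
theorem PP_lower (A C D : M3) (h : UU (fromBlocks A 0 C D)) : PP (fromBlocks A 0 C D) := by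
  rw [UU_blocks] at h
  obtain ⟨h1, h2, h3, h4⟩ := h
  simp only [Matrix.mul_zero, conjTranspose_zero, Matrix.zero_mul, zero_add, add_zero] at h1 h2 h3
  have h3' : A * Dᴴ = 1 := mul_eq_one_comm.1 h3
  have h2' : D * Aᴴ = 1 := mul_eq_one_comm.1 h2
  have hCA : Cᴴ * A = Aᴴ * C := by
    have := congrArg (· + Aᴴ * C) h1
    simpa [add_assoc, m3_two] using this
  have hh : (C * Dᴴ)ᴴ = C * Dᴴ := by
    rw [conjTranspose_mul, conjTranspose_conjTranspose]
    calc D * Cᴴ = D * Cᴴ * (A * Dᴴ) := by rw [h3', Matrix.mul_one]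
      _ = D * (Cᴴ * A) * Dᴴ := by simp only [Matrix.mul_assoc]
      _ = (D * Aᴴ) * (C * Dᴴ) := by rw [hCA]; simp only [Matrix.mul_assoc]
      _ = C * Dᴴ := by rw [h2', Matrix.one_mul]
  have e : fromBlocks A 0 C D = matT (C * Dᴴ) * matD A Dᴴ := by
    simp [matT, matD, fromBlocks_multiply, Matrix.mul_assoc, h3]
  rw [e]
  exact (PP_T hh).mul (PP_D h3' h3)

theorem PP_diag (A C D : M3) (b : Fin 3 → K4) (h : UU (fromBlocks A (diagonal b) C D)) :
    PP (fromBlocks A (diagonal b) C D) := by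
  have hU := h
  rw [UU_blocks] at h
  obtain ⟨-, -, -, h4⟩ := h
  have hd : ∀ i j, star (D j i) * b j + star (b i) * D i j = 0 := by
    intro i j
    have := congrFun (congrFun h4 i) j
    simpa [diagonal_conjTranspose, mul_diagonal, diagonal_mul, Matrix.add_apply] using this
  have hd' : ∀ i j, b i ≠ 0 → b j = 0 → D i j = 0 := by
    intro i j hi hj
    have := hd i j
    rw [hj, mul_zero, zero_add] at this
    exact (mul_eq_zero.1 this).resolve_left (star_ne_zero.2 hi)
  let hm : M3 := fun i j => if b i ≠ 0 ∧ b j ≠ 0 then D i j * (b j)⁻¹ else 0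
  have hh : hmᴴ = hm := by
    ext i j
    rw [conjTranspose_apply]
    show star (if b j ≠ 0 ∧ b i ≠ 0 then D j i * (b i)⁻¹ else 0) = if b i ≠ 0 ∧ b j ≠ 0 then D i j * (b j)⁻¹ else 0
    by_cases hc : b i ≠ 0 ∧ b j ≠ 0
    · rw [if_pos hc, if_pos hc.symm]
      have := hd i j
      have key : ∀ p q r t : K4, r ≠ 0 → t ≠ 0 → star q * t + star r * p = 0 →
          star (q * r⁻¹) = p * t⁻¹ := by decide +kernel
      exact key _ _ _ _ hc.1 hc.2 this
    · rw [if_neg hc, if_neg (fun h => hc h.symm), star_zero]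
  let s : Fin 3 → K4 := fun i => if b i = 0 then 0 else 1
  have hs : ∀ i, s i = 0 ∨ s i = 1 := by
    intro i; by_cases h : b i = 0 <;> simp [s, h]
  refine PP_redT hh (PP_redS s hs ?_)
  have e : matT hm * fromBlocks A (diagonal b) C D =
      fromBlocks A (diagonal b) (hm * A + C) (hm * diagonal b + D) := by
    simp [matT, fromBlocks_multiply]
  have e2 : matS s * (matT hm * fromBlocks A (diagonal b) C D) =
      fromBlocks ((diagonal fun i => 1 + s i) * A + diagonal s * (hm * A + C)) 0
        (diagonal s * A + (diagonal fun i => 1 + s i) * (hm * A + C))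
        (diagonal s * diagonal b + (diagonal fun i => 1 + s i) * (hm * diagonal b + D)) := by
    rw [e, matS, fromBlocks_multiply]
    congr 1
    ext i j
    simp only [Matrix.add_apply, diagonal_mul, mul_diagonal, Matrix.zero_apply, diagonal_apply]
    by_cases hi : b i = 0
    · have : s i = 0 := by simp [s, hi]
      simp [this]
      rintro rfl; exact hi
    · have : s i = 1 := by simp [s, hi]
      rw [this, K4.add_self, one_mul]
      have z : (if i = j then (0:K4) else 0) * b j = 0 := by simp
      have key : hm i j * b j + D i j = 0 := by
        by_cases hj : b j = 0
        · simp [hd' i j hi hj, hj]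
        · show (if b i ≠ 0 ∧ b j ≠ 0 then D i j * (b j)⁻¹ else 0) * b j + D i j = 0
          rw [if_pos ⟨hi, hj⟩, mul_assoc, inv_mul_cancel₀ hj, mul_one, K4.add_self]
      rw [key, z, add_zero]
  have hU2 := (UU_matS s hs).mul ((UU_matT hh).mul hU)
  rw [e2] at hU2 ⊢
  exact PP_lower _ _ _ hU2

theorem PP_of_UU (N : M6) (h : UU N) : PP N := by
  rw [← fromBlocks_toBlocks N] at h ⊢
  generalize N.toBlocks₁₁ = A at *
  generalize N.toBlocks₁₂ = B at *
  generalize N.toBlocks₂₁ = C at *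
  generalize N.toBlocks₂₂ = D at *
  obtain ⟨L, L', b, hB⟩ := Matrix.Pivot.exists_list_transvec_mul_diagonal_mul_list_transvec B
  have hL : IsUnit (L.map TransvectionStruct.toMatrix).prod.det := by
    rw [TransvectionStruct.det_toMatrix_prod]; exact isUnit_one
  have hL' : IsUnit (L'.map TransvectionStruct.toMatrix).prod.det := by
    rw [TransvectionStruct.det_toMatrix_prod]; exact isUnit_one
  generalize (L.map TransvectionStruct.toMatrix).prod = X at *
  generalize (L'.map TransvectionStruct.toMatrix).prod = Y at *
  have x1 := nonsing_inv_mul X hL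
  have x2 := mul_nonsing_inv X hL
  have y1 := nonsing_inv_mul Y hL'
  have y2 := mul_nonsing_inv Y hL'
  have yy1 : Yᴴ * (Y⁻¹)ᴴ = 1 := by rw [← conjTranspose_mul, y1, conjTranspose_one]
  have yy2 : (Y⁻¹)ᴴ * Yᴴ = 1 := by rw [← conjTranspose_mul, y2, conjTranspose_one]
  refine PP_redD x1 x2 yy1 yy2 ?_
  have hU := ((UU_matD x2 x1).mul h).mul (UU_matD yy2 yy1)
  have e : matD X⁻¹ X * fromBlocks A B C D * matD Yᴴ (Y⁻¹)ᴴ =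
      fromBlocks (X⁻¹ * A * Yᴴ) (diagonal b) (Xᴴ * C * Yᴴ) (Xᴴ * D * Y⁻¹) := by
    simp only [matD, fromBlocks_multiply, conjTranspose_conjTranspose]
    rw [fromBlocks_inj]
    refine ⟨by simp, ?_, by simp, by simp⟩
    simp only [Matrix.zero_mul, add_zero, Matrix.mul_zero, zero_add, hB]
    calc X⁻¹ * (X * diagonal b * Y) * Y⁻¹ = (X⁻¹ * X) * diagonal b * (Y * Y⁻¹) := by
          simp only [Matrix.mul_assoc]
      _ = diagonal b := by rw [x1, y2, Matrix.one_mul, Matrix.mul_one]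
  rw [e] at hU ⊢
  exact PP_diag _ _ _ _ hU

end

section

open Matrix

/-! ## The subspace `W22` and restriction -/


theorem ratInner_comm (x y : V24) : ratInner x y = ratInner y x := by
  simp only [ratInner, mul_comm]
theorem ratInner_add_left (x y z : V24) : ratInner (x + y) z = ratInner x z + ratInner y z := by
  simp only [ratInner, Pi.add_apply, add_mul, Finset.sum_add_distrib, add_div]
theorem ratInner_smul_left (c : ℚ) (x z : V24) : ratInner (c • x) z = c * ratInner x z := by
  simp only [ratInner, Pi.smul_apply, smul_eq_mul, mul_assoc, ← Finset.mul_sum, mul_div_assoc]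
theorem ratInner_add_right (x y z : V24) : ratInner z (x + y) = ratInner z x + ratInner z y := by
  rw [ratInner_comm, ratInner_add_left, ratInner_comm x, ratInner_comm y]
theorem ratInner_smul_right (c : ℚ) (x z : V24) : ratInner z (c • x) = c * ratInner z x := by
  rw [ratInner_comm, ratInner_smul_left, ratInner_comm x]

/-- vector with given first 21 coordinates and the last three equal -/
def mkV (x : Fin 24 → ℚ) (t : ℚ) : V24 := fun i => if i.val < 21 then x i else t

/-- integral vectors -/
def mkZ (x : Fin 24 → ℤ) (t : ℤ) : Fin 24 → ℤ := fun i => if i.val < 21 then x i else t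

theorem toRat_mem {y : Fin 24 → ℤ} (h : leechB y) : toRat y ∈ LeechQ := ⟨y, isLeech_of_leechB h, rfl⟩

def e8 (p : Fin 24) : Fin 24 → ℤ := mkZ (fun i => if i = p then 8 else 0) 0
def t8 : Fin 24 → ℤ := mkZ 0 8

theorem e8_leech : ∀ p, leechB (e8 p) := by decide +kernel
theorem t8_leech : leechB t8 := by decide +kernel

theorem mem_W22 (x : V24) : x ∈ W22 ↔ x 21 = x 22 ∧ x 22 = x 23 := by
  constructor
  · intro h
    unfold W22 at h
    induction h using Submodule.span_induction with
    | mem x hx => exact hx.2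
    | zero => exact ⟨rfl, rfl⟩
    | add x y _ _ hx hy => exact ⟨by simp [hx.1, hy.1], by simp [hx.2, hy.2]⟩
    | smul a x _ hx => exact ⟨by simp [hx.1], by simp [hx.2]⟩
  · rintro ⟨h1, h2⟩
    have e : x = (∑ p : Fin 24, (if p.val < 21 then x p / 8 else 0) • toRat (e8 p)) + (x 21 / 8) • toRat t8 := by
      funext i
      simp only [Pi.add_apply, Finset.sum_apply, Pi.smul_apply, smul_eq_mul, toRat, e8, t8, mkZ]
      by_cases hi : i.val < 21
      · simp [hi]
      · simp [hi]
        obtain h | h | h : i = 21 ∨ i = 22 ∨ i = 23 := by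
          revert hi; revert i; decide
        all_goals subst h
        · ring
        · rw [h1]
        · rw [h1, h2]
    rw [e]
    refine Submodule.add_mem _ (Submodule.sum_mem _ fun p _ => Submodule.smul_mem _ _ (Submodule.subset_span ?_))
      (Submodule.smul_mem _ _ (Submodule.subset_span ?_))
    · exact ⟨toRat_mem (e8_leech p), rfl, rfl⟩
    · exact ⟨toRat_mem t8_leech, rfl, rfl⟩

theorem mem_Lam22 (x : V24) : x ∈ Lam22Q ↔ x ∈ LeechQ ∧ x ∈ W22 := by
  rw [mem_W22]; exact Iff.rfl

theorem mkV_mem (x : V24) (t : ℚ) : mkV x t ∈ W22 := (mem_W22 _).2 ⟨rfl, rfl⟩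

def spAB : Submodule ℚ V24 := Submodule.span ℚ ({toRat vA, toRat vB} : Set V24)

theorem mem_spAB (x : V24) : x ∈ spAB ↔ (∀ i : Fin 24, i.val < 21 → x i = 0) ∧ x 21 + x 22 + x 23 = 0 := by
  unfold spAB
  rw [Submodule.mem_span_pair]
  constructor
  · rintro ⟨a, b, rfl⟩
    constructor
    · intro i hi
      have h1 : i.val ≠ 21 := by omega
      have h2 : i.val ≠ 22 := by omega
      have h3 : i.val ≠ 23 := by omega
      simp [toRat, vA, vB, h1, h2, h3]
    · simp [toRat, vA, vB]; ring
  · rintro ⟨h, hs⟩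
    refine ⟨x 21 / 4, x 22 / 4, ?_⟩
    funext i
    by_cases hi : i.val < 21
    · rw [h i hi]
      have h1 : i.val ≠ 21 := by omega
      have h2 : i.val ≠ 22 := by omega
      have h3 : i.val ≠ 23 := by omega
      simp [toRat, vA, vB, h1, h2, h3]
    · obtain h | h | h : i = 21 ∨ i = 22 ∨ i = 23 := by
          revert hi; revert i; decide
      all_goals subst h
      · simp [toRat, vA, vB]
      · simp [toRat, vA, vB]
      · simp [toRat, vA, vB]; linarith

theorem vA_leech : leechB vA := by decide +kernel
theorem vB_leech : leechB vB := by decide +kernel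

theorem inner_vA (x : V24) : ratInner x (toRat vA) = (x 21 - x 23) / 2 := by
  simp [ratInner, toRat, vA, Fin.sum_univ_succ]; ring
theorem inner_vB (x : V24) : ratInner x (toRat vB) = (x 22 - x 23) / 2 := by
  simp [ratInner, toRat, vB, Fin.sum_univ_succ]; ring

theorem vA_mem : toRat vA ∈ RABQ := ⟨toRat_mem vA_leech, Submodule.subset_span (by simp)⟩
theorem vB_mem : toRat vB ∈ RABQ := ⟨toRat_mem vB_leech, Submodule.subset_span (by simp)⟩

theorem mem_W22_iff (x : V24) : x ∈ W22 ↔ ∀ r ∈ RABQ, ratInner x r = 0 := by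
  rw [mem_W22]
  constructor
  · rintro ⟨h1, h2⟩ r hr
    obtain ⟨a, b, rfl⟩ := Submodule.mem_span_pair.1 hr.2
    rw [ratInner_add_right, ratInner_smul_right, ratInner_smul_right, inner_vA, inner_vB, h1, h2]; ring
  · intro h
    have hA := h _ vA_mem
    have hB := h _ vB_mem
    rw [inner_vA] at hA
    rw [inner_vB] at hB
    constructor <;> linarith

theorem mem_spAB_iff (x : V24) : x ∈ spAB ↔ ∀ w ∈ W22, ratInner x w = 0 := by
  constructor
  · intro h w hw
    obtain ⟨a, b, rfl⟩ := Submodule.mem_span_pair.1 h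
    rw [mem_W22] at hw
    rw [ratInner_comm, ratInner_add_right, ratInner_smul_right, ratInner_smul_right, inner_vA, inner_vB, hw.1, hw.2]; ring
  · intro h
    rw [mem_spAB]
    constructor
    · intro i hi
      have := h (mkV (Pi.single i 1) 0) (mkV_mem _ _)
      have e : mkV (Pi.single i 1) 0 = Pi.single i 1 := by
        funext j
        by_cases hj : j.val < 21
        · simp [mkV, hj]
        · have : j ≠ i := by rintro rfl; exact hj hi
          simp [mkV, hj, this]
      rw [e] at this
      simpa [ratInner, Pi.single_apply] using this
    · have := h (mkV 0 1) (mkV_mem _ _)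
      simp [ratInner, mkV, Fin.sum_univ_succ] at this
      linarith

theorem circ_W22 {k : V24 ≃ₗ[ℚ] V24} (hk : k ∈ circ222) (x : V24) : x ∈ W22 ↔ k x ∈ W22 := by
  rw [mem_W22_iff, mem_W22_iff]
  constructor
  · intro h r hr
    obtain ⟨r', rfl⟩ := k.surjective r
    rw [hk.1.1]
    exact h _ ((hk.2 _).2 hr)
  · intro h r hr
    have := h _ ((hk.2 _).1 hr)
    rwa [hk.1.1] at this

theorem circ_of_W22 {k : V24 ≃ₗ[ℚ] V24} (hk : k ∈ LeechAut) (h : ∀ x ∈ W22, k x ∈ W22) : k ∈ circ222 := by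
  have hm : W22.map k.toLinearMap = W22 := by
    apply Submodule.eq_of_le_of_finrank_eq
    · rintro _ ⟨x, hx, rfl⟩; exact h x hx
    · exact LinearEquiv.finrank_map_eq k W22
  have h2 : ∀ x, x ∈ W22 ↔ k x ∈ W22 := by
    intro x
    refine ⟨h x, fun hx => ?_⟩
    rw [← hm] at hx
    obtain ⟨y, hy, e⟩ := hx
    have : y = x := k.injective e
    rwa [← this]
  refine ⟨hk, fun x => ?_⟩
  have hs : x ∈ spAB ↔ k x ∈ spAB := by
    rw [mem_spAB_iff, mem_spAB_iff]
    constructor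
    · intro hx w hw
      obtain ⟨w', rfl⟩ := k.surjective w
      rw [hk.1]; exact hx _ ((h2 _).2 hw)
    · intro hx w hw
      have := hx _ ((h2 _).1 hw)
      rwa [hk.1] at this
  exact and_congr (hk.2 x) hs

theorem W22_th {x : V24} (h : x ∈ W22) (c d : K4) : x (th c) = x (th d) := by
  rw [mem_W22] at h
  obtain ⟨h1, h2⟩ := h
  cases c <;> cases d <;> simp [th, h1, h2]

theorem Good.circ {k : V24 ≃ₗ[ℚ] V24} {φ r s} (h : Good k φ r s) : k ∈ circ222 := by
  refine circ_of_W22 h.aut fun x hx => ?_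
  rw [mem_W22]
  have h1 := h.act x .i .w (by decide) (by decide)
  have h2 := h.act x .w .z (by decide) (by decide)
  rw [W22_th hx (r .i) (r .w), sub_self, mul_zero] at h1
  rw [W22_th hx (r .w) (r .z), sub_self, mul_zero] at h2
  exact ⟨sub_eq_zero.1 h1, sub_eq_zero.1 h2⟩

/-- restriction of an element of `circ222` to `W22` -/
def resE (k : V24 ≃ₗ[ℚ] V24) (hk : k ∈ circ222) : ↥W22 ≃ₗ[ℚ] ↥W22 :=
  LinearEquiv.ofLinear
    (k.toLinearMap.restrict fun x hx => (circ_W22 hk x).1 hx)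
    (k.symm.toLinearMap.restrict fun x hx => (circ_W22 (circ222.inv_mem hk) x).1 hx)
    (by ext x : 2; exact k.apply_symm_apply _) (by ext x : 2; exact k.symm_apply_apply _)

theorem resE_apply (k : V24 ≃ₗ[ℚ] V24) (hk : k ∈ circ222) (x : ↥W22) : (resE k hk x : V24) = k x := rfl

theorem resE_mem (k : V24 ≃ₗ[ℚ] V24) (hk : k ∈ circ222) : resE k hk ∈ OLam22 := by
  refine ⟨fun x y => hk.1.1 _ _, fun x => ?_⟩
  rw [mem_Lam22, mem_Lam22, resE_apply, hk.1.2, ← circ_W22 hk]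

def res : ↥circ222 →* ↥OLam22 where
  toFun k := ⟨resE k k.2, resE_mem k k.2⟩
  map_one' := by ext x : 3; rfl
  map_mul' a b := by ext x : 3; rfl

theorem res_apply (k : ↥circ222) (x : ↥W22) : ((res k : ↥W22 ≃ₗ[ℚ] ↥W22) x : V24) = (k : V24 ≃ₗ[ℚ] V24) x := rfl

/-! ### `res` is injective -/

def gluA : Fin 24 → ℤ := ![0, -2, 2, 0, 2, 2, 0, 0, 2, 0, 2, 0, 0, 0, 0, 0, 0, 0, 0, 0, 0, 2, 0, -2]
def gluB : Fin 24 → ℤ := ![-2, 0, 2, 0, 0, 2, 2, 0, 2, 2, 0, 0, 0, 0, 0, 0, 0, 0, 0, 0, 0, 0, 2, -2]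
def gluC : Fin 24 → ℤ := fun i => if i.val = 21 ∨ i.val = 22 then 4 else 0

theorem glu_leech : leechB gluA ∧ leechB gluB ∧ leechB gluC := by decide +kernel


theorem small_leech (z : Fin 24 → ℤ) (hz : IsLeech z) (h0 : ∀ i : Fin 24, i.val < 21 → z i = 0) (i : Fin 24) :
    (4 : ℤ) ∣ z i := by
  obtain ⟨m, hm, h2, hc, -⟩ := hz
  have m0 : m = 0 := by
    have := h2 0
    rw [h0 0 (by decide)] at this
    omega
  subst m0
  rw [mem_golay_iff] at hc
  have h4 := hc i
  have hp : ∀ k, (piv k).val < 21 := by decide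
  have e : ∀ k, (if (4:ℤ) ∣ (z (piv k) - 0 - 2) then (1 : ZMod 2) else 0) = 0 := by
    intro k
    rw [h0 _ (hp k)]
    norm_num
  simp only [e, zero_mul, Finset.sum_const_zero] at h4
  have h5 : ¬ (4:ℤ) ∣ (z i - 0 - 2) := by
    intro h
    rw [if_pos h] at h4
    exact absurd h4 (by decide)
  have := h2 i
  omega

/-- the part of `x` orthogonal to `W22` -/
def pR (x : V24) : V24 := fun i => if i.val < 21 then 0 else x i - (x 21 + x 22 + x 23) / 3

theorem sub_pR (x : V24) : x - pR x ∈ W22 := by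
  rw [mem_W22]
  simp [pR]

theorem circ_sp {k : V24 ≃ₗ[ℚ] V24} (hk : k ∈ circ222) {x : V24} (hx : x ∈ spAB) : k x ∈ spAB := by
  rw [mem_spAB_iff] at hx ⊢
  intro w hw
  obtain ⟨w', rfl⟩ := k.surjective w
  rw [hk.1.1]; exact hx _ ((circ_W22 hk _).2 hw)

theorem LeechQ_sub {x y : V24} (hx : x ∈ LeechQ) (hy : y ∈ LeechQ) : x - y ∈ LeechQ := by
  rw [sub_eq_add_neg]; exact LeechQ_add hx (LeechQ_neg hy)

theorem glue_sub {k : V24 ≃ₗ[ℚ] V24} (hk : k ∈ circ222) (h : ∀ x ∈ W22, k x = x) {y : V24} (hy : y ∈ LeechQ) :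
    k (pR y) - pR y ∈ LeechQ := by
  have h1 := h _ (sub_pR y)
  rw [map_sub] at h1
  have h2 : k (pR y) - pR y = k y - y := by linear_combination (norm := abel) -h1
  rw [h2]
  exact LeechQ_sub ((hk.1.2 _).1 hy) hy

/-- lattice points in `spAB` -/
theorem spAB_leech {x : V24} (hx : x ∈ LeechQ) (h : x ∈ spAB) :
    ∃ a b c : ℤ, x 21 = 4 * a ∧ x 22 = 4 * b ∧ x 23 = 4 * c ∧ a + b + c = 0 := by
  obtain ⟨z, hz, rfl⟩ := hx
  rw [mem_spAB] at h
  have h0 : ∀ i : Fin 24, i.val < 21 → z i = 0 := fun i hi => by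
    have := h.1 i hi
    simpa [toRat] using this
  obtain ⟨a, ha⟩ := small_leech z hz h0 21
  obtain ⟨b, hb⟩ := small_leech z hz h0 22
  obtain ⟨c, hc⟩ := small_leech z hz h0 23
  have hs : z 21 + z 22 + z 23 = 0 := by
    have := h.2
    simp only [toRat] at this
    exact_mod_cast this
  refine ⟨a, b, c, ?_, ?_, ?_, by omega⟩
  · simp [toRat, ha]
  · simp [toRat, hb]
  · simp [toRat, hc]

theorem spAB_ext {x y : V24} (hx : x ∈ spAB) (hy : y ∈ spAB) (h1 : x 21 = y 21) (h2 : x 22 = y 22)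
    (h3 : x 23 = y 23) : x = y := by
  rw [mem_spAB] at hx hy
  funext i
  by_cases hi : i.val < 21
  · rw [hx.1 i hi, hy.1 i hi]
  · obtain h | h | h : i = 21 ∨ i = 22 ∨ i = 23 := by
          revert hi; revert i; decide
    all_goals subst h; assumption

theorem vA_sp : toRat vA ∈ spAB := Submodule.subset_span (by simp)
theorem vB_sp : toRat vB ∈ spAB := Submodule.subset_span (by simp)

theorem pR_sp (x : V24) : pR x ∈ spAB := by
  rw [mem_spAB]
  refine ⟨fun i hi => by simp [pR, hi], ?_⟩
  simp [pR]; ring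

theorem toRat_val {z : Fin 24 → ℤ} {i : Fin 24} {n : ℤ} (h : z i = n) : toRat z i = n := by rw [toRat, h]

theorem pR_eq {x y : V24} (hy : y ∈ spAB) {a b c : ℚ} (ha : x 21 = a) (hb : x 22 = b) (hc : x 23 = c)
    (h1 : a - (a + b + c) / 3 = y 21) (h2 : b - (a + b + c) / 3 = y 22) (h3 : c - (a + b + c) / 3 = y 23) :
    pR x = y := by
  subst ha; subst hb; subst hc
  exact spAB_ext (pR_sp x) hy h1 h2 h3

theorem pR_gluA : pR (toRat gluA) = (1/2 : ℚ) • toRat vA := by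
  refine pR_eq (Submodule.smul_mem _ _ vA_sp) (toRat_val (n := 2) rfl) (toRat_val (n := 0) rfl) (toRat_val (n := -2) rfl)
    ?_ ?_ ?_ <;> norm_num [toRat, vA]
theorem pR_gluB : pR (toRat gluB) = (1/2 : ℚ) • toRat vB := by
  refine pR_eq (Submodule.smul_mem _ _ vB_sp) (toRat_val (n := 0) rfl) (toRat_val (n := 2) rfl) (toRat_val (n := -2) rfl)
    ?_ ?_ ?_ <;> norm_num [toRat, vB]
theorem pR_gluC : pR (toRat gluC) = (1/3 : ℚ) • (toRat vA + toRat vB) := by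
  refine pR_eq (Submodule.smul_mem _ _ (Submodule.add_mem _ vA_sp vB_sp)) (toRat_val (n := 4) rfl) (toRat_val (n := 4) rfl)
    (toRat_val (n := 0) rfl) ?_ ?_ ?_ <;> norm_num [toRat, vA, vB]

def p21 (i : Fin 21) : Fin 24 := i.castSucc.castSucc.castSucc
theorem p21_lt (i : Fin 21) : (p21 i).val < 21 := i.isLt

theorem sum24 {M : Type*} [AddCommMonoid M] (f : Fin 24 → M) :
    ∑ i, f i = (∑ i, f (p21 i)) + f 21 + f 22 + f 23 := by
  rw [Fin.sum_univ_castSucc, Fin.sum_univ_castSucc, Fin.sum_univ_castSucc]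
  rfl

theorem sp_norm {x : V24} (hx : x ∈ spAB) : ratInner x x = (x 21 ^ 2 + x 22 ^ 2 + x 23 ^ 2) / 8 := by
  rw [mem_spAB] at hx
  unfold ratInner
  congr 1
  rw [sum24, Finset.sum_eq_zero (fun i _ => by rw [hx.1 (p21 i) (p21_lt i)]; ring)]
  ring

theorem ints_aux {a b c : ℤ} (h : (2 * a + 1) ^ 2 + (2 * b) ^ 2 + (2 * c - 1) ^ 2 = 2) (hs : a + b + c = 0) :
    b = 0 ∧ (a = 0 ∨ a = -1) := by
  have hb : b = 0 := by
    have h1 : 0 < (2 * a + 1) ^ 2 := by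
      have : (2 * a + 1) ≠ 0 := by omega
      positivity
    have h2 : 0 < (2 * c - 1) ^ 2 := by
      have : (2 * c - 1) ≠ 0 := by omega
      positivity
    have h3 : (2 * b) ^ 2 ≤ 0 := by omega
    have h4 : 2 * b = 0 := by
      have := le_antisymm h3 (sq_nonneg _)
      exact pow_eq_zero_iff (two_ne_zero) |>.1 this
    omega
  refine ⟨hb, ?_⟩
  subst hb
  obtain rfl : c = -a := by omega
  have : a * (a + 1) = 0 := by nlinarith
  rcases mul_eq_zero.1 this with h | h <;> omega

theorem circ_trivial {k : V24 ≃ₗ[ℚ] V24} (hk : k ∈ circ222) (h : ∀ x ∈ W22, k x = x) : k = 1 := by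
  have gA := glue_sub hk h (toRat_mem glu_leech.1)
  have gB := glue_sub hk h (toRat_mem glu_leech.2.1)
  have gC := glue_sub hk h (toRat_mem glu_leech.2.2)
  rw [pR_gluA, map_smul, ← smul_sub] at gA
  rw [pR_gluB, map_smul, ← smul_sub] at gB
  rw [pR_gluC, map_smul, ← smul_sub, map_add] at gC
  have kA := circ_sp hk vA_sp
  have kB := circ_sp hk vB_sp
  have nA := hk.1.1 (toRat vA) (toRat vA)
  have nB := hk.1.1 (toRat vB) (toRat vB)
  rw [sp_norm kA, sp_norm vA_sp] at nA
  rw [sp_norm kB, sp_norm vB_sp] at nB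
  obtain ⟨a, b, c, h1, h2, h3, h4⟩ := spAB_leech gA (Submodule.smul_mem _ _ (Submodule.sub_mem _ kA vA_sp))
  obtain ⟨a', b', c', h1', h2', h3', h4'⟩ := spAB_leech gB (Submodule.smul_mem _ _ (Submodule.sub_mem _ kB vB_sp))
  obtain ⟨d, e, f, j1, j2, j3, j4⟩ := spAB_leech gC (Submodule.smul_mem _ _ (Submodule.sub_mem _
    (Submodule.add_mem _ kA kB) (Submodule.add_mem _ vA_sp vB_sp)))
  have vA1 : toRat vA 21 = 4 := by simp [toRat, vA]
  have vA2 : toRat vA 22 = 0 := by simp [toRat, vA]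
  have vA3 : toRat vA 23 = -4 := by simp [toRat, vA]
  have vB1 : toRat vB 21 = 0 := by simp [toRat, vB]
  have vB2 : toRat vB 22 = 4 := by simp [toRat, vB]
  have vB3 : toRat vB 23 = -4 := by simp [toRat, vB]
  simp only [Pi.smul_apply, Pi.sub_apply, Pi.add_apply, smul_eq_mul, vA1, vA2, vA3, vB1, vB2, vB3] at h1 h2 h3 h1' h2' h3' j1 j2 j3 nA nB
  have q1 : k (toRat vA) 21 = 8 * a + 4 := by linarith
  have q2 : k (toRat vA) 22 = 8 * b := by linarith
  have q3 : k (toRat vA) 23 = 8 * c - 4 := by linarith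
  have q1' : k (toRat vB) 21 = 8 * a' := by linarith
  have q2' : k (toRat vB) 22 = 8 * b' + 4 := by linarith
  have q3' : k (toRat vB) 23 = 8 * c' - 4 := by linarith
  rw [q1, q2, q3] at nA
  rw [q1', q2', q3'] at nB
  have nA2 : (2 * a + 1) ^ 2 + (2 * b) ^ 2 + (2 * c - 1) ^ 2 = 2 := by
    have : ((2 * a + 1 : ℚ)) ^ 2 + (2 * b) ^ 2 + (2 * c - 1) ^ 2 = 2 := by linarith
    exact_mod_cast this
  have nB2 : (2 * a') ^ 2 + (2 * b' + 1) ^ 2 + (2 * c' - 1) ^ 2 = 2 := by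
    have : ((2 * a' : ℚ)) ^ 2 + (2 * b' + 1) ^ 2 + (2 * c' - 1) ^ 2 = 2 := by linarith
    exact_mod_cast this
  rw [q1, q1'] at j1
  rw [q2, q2'] at j2
  have i1 : 2 * (a + a') = 3 * d := by
    have : (2 * (a + a') : ℚ) = 3 * d := by linarith
    exact_mod_cast this
  have i2 : 2 * (b + b') = 3 * e := by
    have : (2 * (b + b') : ℚ) = 3 * e := by linarith
    exact_mod_cast this
  obtain ⟨b0, a01⟩ := ints_aux nA2 h4
  obtain ⟨a0', b01⟩ := ints_aux (a := b') (b := a') (c := c') (by linarith) (by omega)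
  have a0 : a = 0 := by omega
  have b0' : b' = 0 := by omega
  have c0 : c = 0 := by omega
  have c0' : c' = 0 := by omega
  have eA : k (toRat vA) = toRat vA := by
    refine spAB_ext kA vA_sp ?_ ?_ ?_
    · rw [q1, vA1, a0]; norm_num
    · rw [q2, vA2, b0]; norm_num
    · rw [q3, vA3, c0]; norm_num
  have eB : k (toRat vB) = toRat vB := by
    refine spAB_ext kB vB_sp ?_ ?_ ?_
    · rw [q1', vB1, a0']; norm_num
    · rw [q2', vB2, b0']; norm_num
    · rw [q3', vB3, c0']; norm_num
  ext1 x
  have hx := pR_sp x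
  have h5 : k (pR x) = pR x := by
    obtain ⟨a, b, e⟩ := Submodule.mem_span_pair.1 hx
    rw [← e, map_add, map_smul, map_smul, eA, eB]
  have h6 := h _ (sub_pR x)
  rw [map_sub, h5] at h6
  exact sub_left_injective h6

theorem res_injective : Function.Injective res := by
  rw [injective_iff_map_eq_one]
  intro k hk
  have : (k : V24 ≃ₗ[ℚ] V24) = 1 := circ_trivial k.2 fun x hx => by
    have := res_apply k ⟨x, hx⟩
    rw [hk] at this
    exact this.symm
  exact Subtype.ext this

end

section

open Matrix

/-! ## Golay words in terms of hermitian forms -/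


def tz : K4 → ZMod 2
  | .o => 0
  | .i => 1
  | .w => 1
  | .z => 0
def trz : K4 → ZMod 2
  | .o => 0
  | .i => 0
  | .w => 1
  | .z => 1

theorem tz_add : ∀ a b, tz (a + b) = tz a + tz b := by decide +kernel
theorem trz_add : ∀ a b, trz (a + b) = trz a + trz b := by decide +kernel

/-- hermitian form with computable evaluation -/
def hf (h : M3) (v : V3) : K4 := v 0 * star (mv3 h v 0) + v 1 * star (mv3 h v 1) + v 2 * star (mv3 h v 2)

theorem hf_eq (h : M3) (v : V3) : hf h v = hp v (h *ᵥ v) := by rw [hf, hp_three, mv3_eq]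

theorem hf_add (h h' : M3) (v : V3) : hf (h + h') v = hf h v + hf h' v := by
  rw [hf_eq, hf_eq, hf_eq, add_mulVec, hp_add_right]

def gpar (l : K4) (h : M3) (e : ZMod 2) : Fin 24 → ZMod 2 := fun i =>
  if i.val < 21 then trz (l * (rep i 0 * rep i 1 * rep i 2)) + tz (hf h (rep i)) + e else trz (l * thi i) + e

theorem gpar_add (l l' : K4) (h h' : M3) (e e' : ZMod 2) :
    gpar (l + l') (h + h') (e + e') = gpar l h e + gpar l' h' e' := by
  funext i
  simp only [gpar, Pi.add_apply]
  split_ifs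
  · rw [add_mul, trz_add, hf_add, tz_add]; ring
  · rw [add_mul, trz_add]; ring

def gtab : Fin 12 → Fin 8 → K4 := ![![.o, .i, .i, .i, .i, .i, .i, .i], ![.o, .i, .i, .i, .z, .w, .i, .i],
  ![.i, .o, .o, .o, .i, .o, .o, .o], ![.z, .o, .o, .o, .z, .o, .o, .o], ![.w, .i, .i, .i, .o, .z, .i, .i],
  ![.z, .o, .o, .o, .w, .o, .o, .o], ![.w, .o, .o, .o, .o, .o, .o, .o], ![.i, .i, .i, .o, .w, .o, .i, .i],
  ![.o, .o, .o, .o, .z, .o, .w, .o], ![.w, .o, .o, .o, .i, .o, .z, .o], ![.i, .o, .i, .o, .w, .o, .i, .o],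
  ![.z, .o, .i, .i, .o, .o, .o, .i]]

def gth (r : Fin 12) : M3 := hmat (gtab r 1) (gtab r 2) (gtab r 3) (gtab r 4) (gtab r 5) (gtab r 6)

theorem gtab_ok : ∀ (j : Fin 24) (r : Fin 12), b2z (gbit r j) = gpar (gtab r 0) (gth r) (tz (gtab r 7)) j := by
  decide +kernel

theorem hmat_herm {a b c : K4} (x y z : K4) (ha : star a = a) (hb : star b = b) (hc : star c = c) :
    (hmat a b c x y z)ᴴ = hmat a b c x y z := by
  ext i j
  fin_cases i <;> fin_cases j <;> simp [hmat, ha, hb, hc]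

theorem gth_herm (r : Fin 12) : (gth r)ᴴ = gth r := by
  have : ∀ r : Fin 12, star (gtab r 1) = gtab r 1 ∧ star (gtab r 2) = gtab r 2 ∧ star (gtab r 3) = gtab r 3 := by
    decide +kernel
  exact hmat_herm _ _ _ (this r).1 (this r).2.1 (this r).2.2

theorem golay_par {w : Fin 24 → ZMod 2} (hw : w ∈ GolayCode) :
    ∃ l h e, hᴴ = h ∧ w = gpar l h e := by
  unfold GolayCode at hw
  have g0 : (0 : Fin 24 → ZMod 2) = gpar 0 0 0 := by
    funext i
    have : hf 0 (rep i) = 0 := by simp [hf_eq, hp]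
    simp only [gpar, this, zero_mul]
    split_ifs <;> rfl
  induction hw using Submodule.span_induction with
  | mem x hx =>
    obtain ⟨r, rfl⟩ := hx
    refine ⟨gtab r 0, gth r, tz (gtab r 7), gth_herm r, ?_⟩
    show golayMatrix r = _
    rw [row_eq]; funext j; exact gtab_ok j r
  | zero => exact ⟨0, 0, 0, by simp, g0⟩
  | add x y _ _ hx hy =>
    obtain ⟨l, h, e, hh, rfl⟩ := hx
    obtain ⟨l', h', e', hh', rfl⟩ := hy
    exact ⟨l + l', h + h', e + e', by rw [conjTranspose_add, hh, hh'], (gpar_add ..).symm⟩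
  | smul a x _ hx =>
    have : a = 0 ∨ a = 1 := by revert a; decide
    rcases this with rfl | rfl
    · rw [zero_smul]; exact ⟨0, 0, 0, by simp, g0⟩
    · rwa [one_smul]

/-- parameters for hermitian forms -/
abbrev HP : Type := (Bool × Bool × Bool) × (K4 × K4 × K4)

def b2k (b : Bool) : K4 := cond b 1 0

def hb (p : HP) : M3 := hmat (b2k p.1.1) (b2k p.1.2.1) (b2k p.1.2.2) p.2.1 p.2.2.1 p.2.2.2

theorem hb_herm (p : HP) : (hb p)ᴴ = hb p := by
  have : ∀ b, star (b2k b) = b2k b := by decide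
  exact hmat_herm _ _ _ (this _) (this _) (this _)

theorem exists_hb {h : M3} (hh : hᴴ = h) : ∃ p, h = hb p := by
  have e : ∀ i j, star (h i j) = h j i := fun i j => by
    conv_rhs => rw [← hh]
    rfl
  have d : ∀ a : K4, star a = a → ∃ b, a = b2k b := by decide +kernel
  obtain ⟨a, ha⟩ := d _ (e 0 0)
  obtain ⟨b, hb'⟩ := d _ (e 1 1)
  obtain ⟨c, hc⟩ := d _ (e 2 2)
  refine ⟨((a, b, c), (h 1 2, h 2 0, h 0 1)), ?_⟩
  ext i j
  fin_cases i <;> fin_cases j <;> simp [hb, hmat, e, ha, hb', hc]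

theorem sgnZ_tz (h : M3) (i : Fin 24) (hi : i.val < 21) : sgnZ h i = if tz (hf h (rep i)) = 0 then 1 else -1 := by
  have : ∀ a, psiZ a = if tz a = 0 then 1 else -1 := by decide +kernel
  rw [sgnZ, if_pos hi, ← this]; rfl

theorem golay_eq {w : Fin 24 → ZMod 2} (hw : w ∈ GolayCode) (h1 : w 21 = w 22) (h2 : w 22 = w 23) :
    ∃ p : HP, ∀ i : Fin 21, w (p21 i) = if sgnZ (hb p) (p21 i) = 1 then w 21 else w 21 + 1 := by
  obtain ⟨l, h, e, hh, rfl⟩ := golay_par hw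
  obtain ⟨p, rfl⟩ := exists_hb hh
  have l0 : l = 0 := by
    have h1' : trz (l * .i) + e = trz (l * .w) + e := h1
    have h2' : trz (l * .w) + e = trz (l * .z) + e := h2
    have : ∀ (l : K4), trz (l * .i) = trz (l * .w) → trz (l * .w) = trz (l * .z) → l = 0 := by decide +kernel
    exact this l (add_right_cancel h1') (add_right_cancel h2')
  subst l0
  refine ⟨p, fun i => ?_⟩
  have e1 : gpar 0 (hb p) e 21 = e := by
    show trz (0 * _) + e = e
    rw [zero_mul]; exact zero_add e
  rw [e1, sgnZ_tz _ _ (p21_lt i), gpar, if_pos (p21_lt i), zero_mul, show trz 0 = 0 from rfl, zero_add]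
  generalize tz (hf (hb p) (rep (p21 i))) = c
  have key : ∀ c e : ZMod 2, c + e = if (if c = 0 then (1:ℤ) else -1) = 1 then e else e + 1 := by decide
  exact key c e

/-! ### weights -/

def lineB (b i : Fin 21) : Bool := decide (rep (p21 i) 0 * star (rep (p21 b) 0) + rep (p21 i) 1 * star (rep (p21 b) 1)
  + rep (p21 i) 2 * star (rep (p21 b) 2) = 0)

theorem lineB_iff (b i : Fin 21) : lineB b i = true ↔ hp (rep (p21 i)) (rep (p21 b)) = 0 := by
  rw [hp_three, lineB, decide_eq_true_iff]

def negB (p : HP) (i : Fin 21) : Bool := decide (sgnZ (hb p) (p21 i) = -1)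

def wtB (p : HP) : ℕ := (List.finRange 21).foldr (fun i a => cond (negB p i) (a + 1) a) 0

theorem wt_check : ∀ p : HP, wtB p = 0 ∨ wtB p = 8 ∨ wtB p = 12 ∨
    (wtB p = 16 ∧ ∃ b : Fin 21, ∀ i : Fin 21, negB p i = !(lineB b i)) := by
  decide +kernel

theorem line_inj : ∀ b b' : Fin 21, (∀ i, lineB b i = lineB b' i) → b = b' := by decide +kernel

theorem line_card : ∀ b : Fin 21, (Finset.univ.filter fun i => lineB b i = true).card = 5 := by decide +kernel

end

section

open Matrix

/-! ## The group generated by the known automorphisms -/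


def cj (N : M6) : M6 := N.map (starRingEnd K4)

theorem cj_mul (X Y : M6) : cj (X * Y) = cj X * cj Y := Matrix.map_mul

theorem cj_det (N : M6) : (cj N).det = star N.det := (RingHom.map_det (starRingEnd K4) N).symm

theorem cj_mulVec (N : M6) (w : W6) : star (N *ᵥ w) = cj N *ᵥ star w := by
  funext i
  simp only [Pi.star_apply, mulVec, dotProduct, star_sum, cj, map_apply, StarMul.star_mul, starRingEnd_apply]
  exact Finset.sum_congr rfl fun j _ => mul_comm _ _

theorem cj_UU {N : M6} (h : UU N) : UU (cj N) := by
  unfold UU at *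
  have hJ : cj JJ = JJ := by
    ext i j
    have : ∀ c : K4, c = 0 ∨ c = 1 → star c = c := by decide +kernel
    apply this
    rcases i with i | i <;> rcases j with j | j <;>
      simp [JJ, Matrix.one_apply] <;> tauto
  have h2 := congrArg cj h
  rw [cj_mul, cj_mul, hJ] at h2
  exact h2

def InG (k : V24 ≃ₗ[ℚ] V24) : Prop :=
  ∃ (N : M6) (s : ℚ), UU N ∧ (s = 1 ∨ s = -1) ∧
    (Good k (fun w => N *ᵥ w) (fun c => N.det * c) s ∨
      Good k (fun w => N *ᵥ star w) (fun c => star (N.det * c)) s)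

theorem InG.mul {k k' : V24 ≃ₗ[ℚ] V24} (h : InG k) (h' : InG k') : InG (k * k') := by
  obtain ⟨N, s, hN, hs, h⟩ := h
  obtain ⟨N', s', hN', hs', h'⟩ := h'
  have hss : s * s' = 1 ∨ s * s' = -1 := by
    rcases hs with rfl | rfl <;> rcases hs' with rfl | rfl <;> norm_num
  rcases h with h | h <;> rcases h' with h' | h'
  · refine ⟨N * N', s * s', hN.mul hN', hss, Or.inl ?_⟩
    convert h.mul h' using 1
    · funext w; simp [mulVec_mulVec]
    · funext c; simp only [det_mul, Function.comp]; ring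
  · refine ⟨N * N', s * s', hN.mul hN', hss, Or.inr ?_⟩
    convert h.mul h' using 1
    · funext w; simp [mulVec_mulVec]
    · funext c; simp only [det_mul, Function.comp]; congr 1; ring
  · refine ⟨N * cj N', s * s', hN.mul (cj_UU hN'), hss, Or.inr ?_⟩
    convert h.mul h' using 1
    · funext w; simp only [Function.comp, cj_mulVec, mulVec_mulVec]
    · funext c; simp only [det_mul, Function.comp, cj_det, StarMul.star_mul, star_star]; ring
  · refine ⟨N * cj N', s * s', hN.mul (cj_UU hN'), hss, Or.inl ?_⟩
    convert h.mul h' using 1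
    · funext w; simp only [Function.comp, cj_mulVec, mulVec_mulVec, star_star]
    · funext c; simp only [det_mul, Function.comp, cj_det, StarMul.star_mul, star_star]; ring

theorem GoodM.inG {N : M6} {k : V24 ≃ₗ[ℚ] V24} (hN : UU N) (h : GoodM N k) : InG k :=
  ⟨N, 1, hN, Or.inl rfl, Or.inl h⟩

theorem UU_one : UU 1 := by simp [UU]

theorem UU_matK : UU matK := by
  have e : matK = matS ![1, 0, 0] := by
    have e1 : (![0, 1, 1] : Fin 3 → K4) = fun i => 1 + ![1, 0, 0] i := by
      funext i; fin_cases i <;> decide +kernel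
    rw [matK, matS, e1]
  rw [e]
  exact UU_matS _ (by decide +kernel)

theorem inG_K : InG gK := GoodM.inG UU_matK goodM_K
theorem inG_one : InG 1 := by
  convert inG_K.mul inG_K using 1
  ext x i
  exact (congrFun (gK_gK x) i).symm
theorem inG_T (h : M3) (hh : hᴴ = h) : InG (gT h) := GoodM.inG (UU_matT hh) (goodM_T h hh)
theorem inG_D (m m' : M3) (h1 : m * m' = 1) (h2 : m' * m = 1) : InG (gD m m' h1 h2) :=
  GoodM.inG (UU_matD h2 h1) (goodM_D m m' h1 h2)
theorem inG_S : InG gS := ⟨1, 1, UU_one, Or.inl rfl, Or.inr (by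
  convert good_S using 1
  · funext w; simp
  · funext c; simp)⟩
theorem inG_neg : InG (LinearEquiv.neg ℚ) := ⟨1, -1, UU_one, Or.inr rfl, Or.inl (by
  convert good_neg using 1
  · funext w; simp
  · funext c; simp)⟩

theorem InG.circ {k : V24 ≃ₗ[ℚ] V24} (h : InG k) : k ∈ circ222 := by
  obtain ⟨N, s, _, _, h | h⟩ := h <;> exact h.circ

/-- automorphisms of `W22` induced by the known group -/
def KK (e : ↥W22 ≃ₗ[ℚ] ↥W22) : Prop := ∃ k, ∃ h : InG k, e = resE k h.circ

theorem KK.mul {e e' : ↥W22 ≃ₗ[ℚ] ↥W22} (h : KK e) (h' : KK e') : KK (e * e') := by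
  obtain ⟨k, hk, rfl⟩ := h
  obtain ⟨k', hk', rfl⟩ := h'
  exact ⟨k * k', hk.mul hk', by ext x : 2; rfl⟩

theorem KK_one : KK 1 := ⟨1, inG_one, by ext x : 2; rfl⟩

theorem KK.mem {e : ↥W22 ≃ₗ[ℚ] ↥W22} (h : KK e) : e ∈ OLam22 := by
  obtain ⟨k, hk, rfl⟩ := h
  exact resE_mem k _

/-! ### vectors -/

def zv (x : Fin 21 → ℤ) (t : ℤ) : Fin 24 → ℤ := fun i => if h : i.val < 21 then x ⟨i.val, h⟩ else t

theorem zv_p21 (x : Fin 21 → ℤ) (t : ℤ) (i : Fin 21) : zv x t (p21 i) = x i := by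
  have : (p21 i).val < 21 := p21_lt i
  rw [zv, dif_pos this]; rfl

theorem zv_last (x : Fin 21 → ℤ) (t : ℤ) {i : Fin 24} (h : 21 ≤ i.val) : zv x t i = t := by
  rw [zv, dif_neg (by omega)]

def wv (x : Fin 21 → ℤ) (t : ℤ) : ↥W22 := ⟨toRat (zv x t), (mem_W22 _).2 ⟨rfl, rfl⟩⟩

theorem wv_coe (x : Fin 21 → ℤ) (t : ℤ) : (wv x t : V24) = toRat (zv x t) := rfl

def inn (x y : ↥W22) : ℚ := ratInner (x : V24) (y : V24)

theorem inn_wv (x y : Fin 21 → ℤ) (s t : ℤ) : inn (wv x s) (wv y t) = ((∑ i, x i * y i + 3 * s * t : ℤ) : ℚ) / 8 := by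
  rw [inn, ratInner, sum24]
  simp only [wv_coe, toRat, zv_p21]
  rw [zv_last x s (i := 21) (by decide), zv_last x s (i := 22) (by decide), zv_last x s (i := 23) (by decide),
    zv_last y t (i := 21) (by decide), zv_last y t (i := 22) (by decide), zv_last y t (i := 23) (by decide)]
  push_cast; ring

theorem wv_inj {x y : Fin 21 → ℤ} {s t : ℤ} (h : wv x s = wv y t) : x = y ∧ s = t := by
  have h' : ∀ i, zv x s i = zv y t i := fun i => by
    have := congrFun (congrArg Subtype.val h) i
    simp only [wv_coe, toRat] at this
    exact_mod_cast this
  refine ⟨funext fun i => ?_, ?_⟩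
  · have := h' (p21 i); rwa [zv_p21, zv_p21] at this
  · have := h' 23; rwa [zv_last _ _ (by decide), zv_last _ _ (by decide)] at this

/-- three times a minimal vector of the 3-part of the dual lattice -/
def IsY (y : ↥W22) : Prop := (y : V24) ∈ Lam22Q ∧
  (∀ v : ↥W22, (v : V24) ∈ Lam22Q → ∃ n : ℤ, inn y v = 3 * n) ∧ inn y y = 24

theorem inn_OL {e : ↥W22 ≃ₗ[ℚ] ↥W22} (he : e ∈ OLam22) (x y : ↥W22) : inn (e x) (e y) = inn x y := he.1 x y

theorem IsY.map {y : ↥W22} (h : IsY y) {e : ↥W22 ≃ₗ[ℚ] ↥W22} (he : e ∈ OLam22) : IsY (e y) := by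
  refine ⟨(he.2 y).1 h.1, fun v hv => ?_, by rw [inn_OL he, h.2.2]⟩
  obtain ⟨n, hn⟩ := h.2.1 (e.symm v) ((he.2 _).2 (by rwa [e.apply_symm_apply]))
  refine ⟨n, ?_⟩
  rw [← hn, ← inn_OL he y, e.apply_symm_apply]

theorem exists_wv {y : ↥W22} (h : (y : V24) ∈ Lam22Q) : ∃ x t, y = wv x t ∧ IsLeech (zv x t) := by
  obtain ⟨⟨z, hz, hy⟩, h1, h2⟩ := h
  have e1 : z 21 = z 22 := by
    have : (z 21 : ℚ) = z 22 := by
      rw [hy] at h1; exact h1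
    exact_mod_cast this
  have e2 : z 22 = z 23 := by
    have : (z 22 : ℚ) = z 23 := by
      rw [hy] at h2; exact h2
    exact_mod_cast this
  have hzv : zv (fun i => z (p21 i)) (z 23) = z := by
    funext i
    by_cases hi : i.val < 21
    · rw [zv, dif_pos hi]; rfl
    · rw [zv_last _ _ (by omega)]
      have : i = 21 ∨ i = 22 ∨ i = 23 := by omega
      rcases this with rfl | rfl | rfl
      · rw [e1, e2]
      · rw [e2]
      · rfl
  refine ⟨fun i => z (p21 i), z 23, Subtype.ext ?_, by rwa [hzv]⟩
  rw [wv_coe, hzv, hy]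

end

section

open Matrix

/-! ## Classification of the 1782 vectors -/


def sg (b : Bool) : ℤ := if b then 1 else -1

def lx (b : Fin 21) (σ : Fin 21 → Bool) : Fin 21 → ℤ := fun i => if lineB b i = true then 6 * sg (σ i) else 0
def lt (x : Fin 21 → ℤ) : ℤ := if (8:ℤ) ∣ (∑ i, x i) - 6 then -2 else 2
def dx (p : HP) : Fin 21 → ℤ := fun i => 3 * sgnZ (hb p) (p21 i)

theorem sum_zv (x : Fin 21 → ℤ) (t : ℤ) : ∑ i, zv x t i = ∑ i, x i + 3 * t := by
  rw [sum24]
  simp only [zv_p21]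
  rw [zv_last x t (i := 21) (by decide), zv_last x t (i := 22) (by decide), zv_last x t (i := 23) (by decide)]
  ring

theorem sgnZ_cases (h : M3) (i : Fin 21) : sgnZ h (p21 i) = 1 ∨ sgnZ h (p21 i) = -1 := by
  rw [sgnZ_tz _ _ (p21_lt i)]; split_ifs <;> simp

theorem leech_zv {x : Fin 21 → ℤ} {t : ℤ} (h : IsLeech (zv x t)) :
    ∃ m : ℤ, (m = 0 ∨ m = 1) ∧ (∀ i, (2:ℤ) ∣ x i - m) ∧ (2:ℤ) ∣ t - m ∧
      (∃ p : HP, ∀ i, (4:ℤ) ∣ x i - m - 2 ↔ (if negB p i = true then ¬ ((4:ℤ) ∣ t - m - 2) else (4:ℤ) ∣ t - m - 2)) ∧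
      (8:ℤ) ∣ (∑ i, x i) + 3 * t - 4 * m := by
  obtain ⟨m, hm, h2, hw, h8⟩ := h
  have l1 : zv x t 21 = t := zv_last _ _ (by decide)
  have l2 : zv x t 22 = t := zv_last _ _ (by decide)
  have l3 : zv x t 23 = t := zv_last _ _ (by decide)
  refine ⟨m, hm, fun i => by simpa [zv_p21] using h2 (p21 i), by simpa [l1] using h2 21, ?_, by rwa [sum_zv] at h8⟩
  obtain ⟨p, hp⟩ := golay_eq hw (by simp only [l1, l2]) (by simp only [l2, l3])
  refine ⟨p, fun i => ?_⟩
  have := hp i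
  simp only [zv_p21, l1] at this
  have hn : negB p i = true ↔ ¬ sgnZ (hb p) (p21 i) = 1 := by
    rw [negB, decide_eq_true_iff]
    rcases sgnZ_cases (hb p) i with h | h <;> rw [h] <;> decide
  have d1 : (1 : ZMod 2) + 1 = 0 := by decide
  by_cases a : (4:ℤ) ∣ x i - m - 2 <;> by_cases b : (4:ℤ) ∣ t - m - 2 <;>
    by_cases c : sgnZ (hb p) (p21 i) = 1 <;> simp [a, b, c, hn, d1] at this ⊢

theorem e44 : ∀ p : Fin 21, leechB (zv (fun i => if i = p then 4 else if i = (if p = 0 then 1 else 0) then 4 else 0) 0) ∧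
    leechB (zv (fun i => if i = p then 4 else if i = (if p = 0 then 1 else 0) then -4 else 0) 0) := by
  decide +kernel

theorem wv_Lam {x : Fin 21 → ℤ} {t : ℤ} (h : leechB (zv x t)) : (wv x t : V24) ∈ Lam22Q :=
  (mem_Lam22 _).2 ⟨toRat_mem h, (wv x t).2⟩

theorem IsY.ex {y : ↥W22} (h : IsY y) : ∃ (u : Fin 21 → ℤ) (t : ℤ), y = wv (fun i => 3 * u i) t ∧ IsLeech (zv (fun i => 3 * u i) t) ∧
    3 * ∑ i, u i ^ 2 + t ^ 2 = 64 := by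
  obtain ⟨x, t, rfl, hl⟩ := exists_wv h.1
  have h3 : ∀ p, ∃ u, x p = 3 * u := by
    intro p
    obtain ⟨a, ha⟩ := h.2.1 _ (wv_Lam (e44 p).1)
    obtain ⟨b, hb⟩ := h.2.1 _ (wv_Lam (e44 p).2)
    rw [inn_wv] at ha hb
    have hq : ∀ c : ℤ, ∑ i, x i * (if i = p then 4 else if i = (if p = 0 then 1 else 0) then c else 0) =
        4 * x p + c * x (if p = 0 then 1 else 0) := by
      intro c
      have hpq : p ≠ (if p = 0 then 1 else 0) := by
        clear ha hb
        revert p; decide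
      generalize (if p = 0 then (1 : Fin 21) else 0) = q at hpq
      have : ∀ i, x i * (if i = p then 4 else if i = q then c else 0) =
          (if i = p then 4 * x i else 0) + (if i = q then c * x i else 0) := by
        intro i
        by_cases h1 : i = p
        · subst h1; simp [hpq, mul_comm]
        · rw [if_neg h1, if_neg h1, zero_add]
          by_cases h2 : i = q
          · rw [if_pos h2, if_pos h2, mul_comm]
          · rw [if_neg h2, if_neg h2, mul_zero]
      simp only [this, Finset.sum_add_distrib, Finset.sum_ite_eq', Finset.mem_univ, if_true]
    rw [hq] at ha hb
    rw [div_eq_iff (by norm_num)] at ha hb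
    have ha' : 4 * x p + 4 * x (if p = 0 then 1 else 0) + 3 * t * 0 = 3 * a * 8 := by exact_mod_cast ha
    have hb' : 4 * x p + (-4) * x (if p = 0 then 1 else 0) + 3 * t * 0 = 3 * b * 8 := by exact_mod_cast hb
    exact ⟨a + b, by omega⟩
  choose u hu using h3
  have hx : x = fun i => 3 * u i := funext hu
  subst hx
  refine ⟨u, t, rfl, hl, ?_⟩
  have := h.2.2
  rw [inn_wv, div_eq_iff (by norm_num)] at this
  have h' : ∑ i, 3 * u i * (3 * u i) + 3 * t * t = 24 * 8 := by exact_mod_cast this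
  have e : ∑ i, 3 * u i * (3 * u i) = 9 * ∑ i, u i ^ 2 := by
    rw [Finset.mul_sum]; exact Finset.sum_congr rfl fun i _ => by ring
  rw [e] at h'
  linarith

theorem wtB_eq (p : HP) : (wtB p : ℤ) = ∑ i, if negB p i = true then 1 else 0 := by
  have : ∀ l : List (Fin 21), ((l.foldr (fun i a => cond (negB p i) (a + 1) a) 0 : ℕ) : ℤ) =
      (l.map (fun i => if negB p i = true then (1:ℤ) else 0)).sum := by
    intro l
    induction l with
    | nil => rfl
    | cons i l ih =>
      rw [List.foldr_cons, List.map_cons, List.sum_cons, ← ih]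
      cases negB p i
      · simp
      · simp; ring
  rw [wtB, this, Fin.sum_univ_def]

theorem sq_pos_of_odd {z : ℤ} (h : ¬ (2:ℤ) ∣ z) : 1 ≤ z ^ 2 := by
  have : z ≠ 0 := by rintro rfl; exact h (dvd_zero _)
  have := sq_pos_of_ne_zero this
  omega

theorem sq_one {z : ℤ} (h : z ^ 2 = 1) : ∃ b, z = sg b := by
  rcases (show z = 1 ∨ z = -1 from by simpa using h) with h | h
  all_goals first | exact ⟨true, h⟩ | exact ⟨false, h⟩

theorem single_of_sum {y : Fin 21 → ℤ} (h : ∑ i, y i ^ 2 = 1) : ∃ p b, y = Pi.single p (sg b) := by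
  have : ∃ p, y p ≠ 0 := by
    by_contra! hc
    simp [hc] at h
  obtain ⟨p, hp⟩ := this
  have h1 : 1 ≤ y p ^ 2 := by have := sq_pos_of_ne_zero hp; omega
  rw [← Finset.add_sum_erase _ _ (Finset.mem_univ p)] at h
  have h0 : 0 ≤ ∑ i ∈ Finset.univ.erase p, y i ^ 2 := Finset.sum_nonneg fun i _ => sq_nonneg _
  have hs : ∑ i ∈ Finset.univ.erase p, y i ^ 2 = 0 := by omega
  obtain ⟨b, hb⟩ := sq_one (z := y p) (by omega)
  refine ⟨p, b, funext fun i => ?_⟩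
  by_cases hi : i = p
  · subst hi; simp [hb]
  · rw [Pi.single_eq_of_ne hi]
    exact pow_eq_zero_iff (two_ne_zero) |>.1 ((Finset.sum_eq_zero_iff_of_nonneg fun i _ => sq_nonneg (y i)).1 hs i (by simp [hi]))

theorem IsY.classify {y : ↥W22} (h : IsY y) :
    (∃ s, y = wv 0 (8 * sg s)) ∨ (∃ p s s', y = wv (Pi.single p (12 * sg s)) (4 * sg s')) ∨
    (∃ b σ, y = wv (lx b σ) (lt (lx b σ))) ∨ (∃ s p, y = wv (fun i => sg s * dx p i) (-sg s)) := by
  obtain ⟨u, t, rfl, hl, hn⟩ := h.ex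
  obtain ⟨m, hm, h2, ht, ⟨p, hp⟩, h8⟩ := leech_zv hl
  have hu0 : 0 ≤ ∑ i, u i ^ 2 := Finset.sum_nonneg fun i _ => sq_nonneg _
  rcases hm with rfl | rfl
  · -- even case
    have hz : ∀ i, ∃ z, u i = 2 * z := fun i => by
      have := h2 i
      exact ⟨u i / 2, by omega⟩
    choose z hz using hz
    obtain rfl : u = fun i => 2 * z i := funext hz
    obtain ⟨τ, rfl⟩ : ∃ τ, t = 2 * τ := ⟨t / 2, by omega⟩
    have e : ∑ i, (2 * z i) ^ 2 = 4 * ∑ i, z i ^ 2 := by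
      rw [Finset.mul_sum]; exact Finset.sum_congr rfl fun i _ => by ring
    rw [e] at hn hu0
    have hn' : 3 * ∑ i, z i ^ 2 + τ ^ 2 = 16 := by linarith
    have hzz : 0 ≤ ∑ i, z i ^ 2 := by linarith
    have hodd : ∀ i, ¬ (2:ℤ) ∣ z i ↔ (if negB p i = true then (2:ℤ) ∣ τ else ¬ (2:ℤ) ∣ τ) := by
      intro i
      have := hp i
      by_cases c : negB p i = true
      · simp only [c, if_true] at this ⊢; omega
      · simp only [c] at this ⊢; simp only [Bool.false_eq_true, if_false] at this ⊢; omega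
    have hτ1 : τ ≤ 4 := by nlinarith
    have hτ2 : -4 ≤ τ := by nlinarith
    have hcase : (τ = 4 ∨ τ = -4) ∧ ∑ i, z i ^ 2 = 0 ∨ (τ = 2 ∨ τ = -2) ∧ ∑ i, z i ^ 2 = 4 ∨
        (τ = 1 ∨ τ = -1) ∧ ∑ i, z i ^ 2 = 5 := by
      generalize ∑ i, z i ^ 2 = S at hn'
      clear hp hodd h8 hl h ht hn h2
      interval_cases τ <;> omega
    rcases hcase with ⟨hτ, hS⟩ | ⟨hτ, hS⟩ | ⟨hτ, hS⟩
    · left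
      have hz0 : ∀ i, z i = 0 := fun i => pow_eq_zero_iff (two_ne_zero) |>.1
        ((Finset.sum_eq_zero_iff_of_nonneg fun i _ => sq_nonneg (z i)).1 hS i (Finset.mem_univ i))
      have e0 : (fun i => 3 * (2 * z i)) = (0 : Fin 21 → ℤ) := by funext i; simp [hz0]
      rw [e0]
      rcases hτ with rfl | rfl
      · exact ⟨true, rfl⟩
      · exact ⟨false, rfl⟩
    · right; left
      have hτ' : (2:ℤ) ∣ τ := by omega
      simp only [hτ', not_true_eq_false] at hodd
      have hle : (wtB p : ℤ) ≤ 4 := by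
        rw [wtB_eq, ← hS]
        refine Finset.sum_le_sum fun i _ => ?_
        by_cases c : negB p i = true
        · rw [if_pos c]; exact sq_pos_of_odd ((hodd i).2 (by simp [c]))
        · rw [if_neg c]; exact sq_nonneg _
      have hw0 : wtB p = 0 := by
        rcases wt_check p with h | h | h | h
        · exact h
        all_goals omega
      have hwz : (wtB p : ℤ) = 0 := by exact_mod_cast hw0
      rw [wtB_eq] at hwz
      have hneg : ∀ i, ¬ negB p i = true := by
        intro i c
        have := (Finset.sum_eq_zero_iff_of_nonneg (fun i _ => by split_ifs <;> norm_num)).1 hwz i (Finset.mem_univ i)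
        rw [if_pos c] at this
        exact one_ne_zero this
      have he : ∀ i, ∃ y, z i = 2 * y := fun i => by
        have := hodd i
        rw [if_neg (hneg i)] at this
        exact ⟨z i / 2, by have h2 : (2:ℤ) ∣ z i := by { by_contra hc; exact (this.1 hc).elim }
                           omega⟩
      choose y hy using he
      obtain rfl : z = fun i => 2 * y i := funext hy
      have e : ∑ i, (2 * y i) ^ 2 = 4 * ∑ i, y i ^ 2 := by
        rw [Finset.mul_sum]; exact Finset.sum_congr rfl fun i _ => by ring
      rw [e] at hS
      obtain ⟨q, b, rfl⟩ := single_of_sum (y := y) (by omega)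
      refine ⟨q, b, decide (τ = 2), ?_⟩
      congr 1
      · funext i
        by_cases hi : i = q
        · subst hi; simp; ring
        · simp [hi]
      · rcases hτ with rfl | rfl <;> rfl
    · right; right; left
      have hτ' : ¬ (2:ℤ) ∣ τ := by omega
      simp only [hτ', not_false_eq_true] at hodd
      have hle : 21 - (wtB p : ℤ) ≤ 5 := by
        rw [wtB_eq, ← hS]
        have : (21:ℤ) = ∑ i : Fin 21, 1 := by simp
        rw [this, ← Finset.sum_sub_distrib]
        refine Finset.sum_le_sum fun i _ => ?_
        by_cases c : negB p i = true
        · rw [if_pos c]; have := sq_nonneg (z i); omega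
        · rw [if_neg c]; have := sq_pos_of_odd ((hodd i).2 (by simp [c])); omega
      obtain ⟨b, hb⟩ : ∃ b : Fin 21, ∀ i : Fin 21, negB p i = !(lineB b i) := by
        rcases wt_check p with h | h | h | h
        · omega
        · omega
        · omega
        · exact h.2
      have hd : ∀ i, 0 ≤ z i ^ 2 - (if lineB b i = true then 1 else 0) := by
        intro i
        by_cases c : lineB b i = true
        · rw [if_pos c]; have := sq_pos_of_odd ((hodd i).2 (by simp [hb, c])); omega
        · rw [if_neg c]; have := sq_nonneg (z i); omega
      have hs0 : ∑ i, (z i ^ 2 - (if lineB b i = true then 1 else 0)) = 0 := by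
        rw [Finset.sum_sub_distrib, hS, Finset.sum_boole, line_card]; rfl
      have hall := fun i => (Finset.sum_eq_zero_iff_of_nonneg (fun i _ => hd i)).1 hs0 i (Finset.mem_univ i)
      have hx : (fun i => 3 * (2 * z i)) = lx b (fun i => decide (z i = 1)) := by
        funext i
        have := hall i
        rw [lx]
        by_cases c : lineB b i = true
        · rw [if_pos c] at this ⊢
          obtain ⟨s, hs⟩ := sq_one (z := z i) (by omega)
          rw [hs]; cases s <;> rfl
        · rw [if_neg c] at this ⊢
          have : z i = 0 := pow_eq_zero_iff (two_ne_zero) |>.1 (by omega)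
          rw [this]; rfl
      refine ⟨b, fun i => decide (z i = 1), ?_⟩
      rw [← hx]
      congr 1
      rw [lt]
      generalize ∑ i, 3 * (2 * z i) = S at h8
      split_ifs <;> omega
  · -- odd case
    right; right; right
    have hodd : ∀ i, 1 ≤ u i ^ 2 := fun i => sq_pos_of_odd (by have := h2 i; omega)
    have h21 : (21:ℤ) ≤ ∑ i, u i ^ 2 := by
      have : (21:ℤ) = ∑ i : Fin 21, 1 := by simp
      rw [this]; exact Finset.sum_le_sum fun i _ => hodd i
    have ht1 : t = 1 ∨ t = -1 := by
      have a1 : t ≤ 1 := by nlinarith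
      have a2 : -1 ≤ t := by nlinarith
      omega
    have hs0 : ∑ i, (u i ^ 2 - 1) = 0 := by
      rw [Finset.sum_sub_distrib]
      have : (21:ℤ) = ∑ i : Fin 21, 1 := by simp
      rw [← this]
      rcases ht1 with rfl | rfl <;> omega
    have hall := fun i => (Finset.sum_eq_zero_iff_of_nonneg (fun i _ => sub_nonneg.2 (hodd i))).1 hs0 i (Finset.mem_univ i)
    refine ⟨decide (t = -1), p, ?_⟩
    congr 1
    · funext i
      obtain ⟨s, hs⟩ := sq_one (z := u i) (by have := hall i; omega)
      have hpi := hp i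
      have hng : negB p i = true ↔ sgnZ (hb p) (p21 i) = -1 := by rw [negB, decide_eq_true_iff]
      rw [hs, dx]
      rw [hs] at hpi
      rcases sgnZ_cases (hb p) i with c | c <;> rcases ht1 with rfl | rfl <;> cases s <;>
        simp [hng, c, sg] at hpi ⊢
    · rcases ht1 with rfl | rfl <;> rfl

end

section

open Matrix

/-! ## Transitivity -/


theorem pmf_lt (m : M3) (i : Fin 21) : (pmf m (p21 i)).val < 21 := by
  rw [pmf, if_pos (p21_lt i)]; exact idx_lt _

def pq (m : M3) (i : Fin 21) : Fin 21 := ⟨(pmf m (p21 i)).val, pmf_lt m i⟩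

theorem p21_pq (m : M3) (i : Fin 21) : p21 (pq m i) = pmf m (p21 i) := rfl

theorem p21_inj {i j : Fin 21} (h : p21 i = p21 j) : i = j := by
  have := congrArg Fin.val h
  exact Fin.ext this

theorem p21_cases (i : Fin 24) : (∃ j, i = p21 j) ∨ 21 ≤ i.val := by
  by_cases h : i.val < 21
  · left; exact ⟨⟨i.val, h⟩, rfl⟩
  · right; omega

theorem toRat_ext {x : V24} {y : Fin 21 → ℤ} {t : ℤ} (h1 : ∀ i, x (p21 i) = y i)
    (h2 : ∀ i : Fin 24, 21 ≤ i.val → x i = t) : x = toRat (zv y t) := by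
  funext i
  rcases p21_cases i with ⟨j, rfl⟩ | h
  · rw [h1, toRat, zv_p21]
  · rw [h2 i h, toRat, zv_last _ _ h]

theorem exD (m : M3) (hm : det3 m ≠ 0) : ∃ k, InG k ∧ Function.Injective (pq m) ∧
    ∀ x t, k (toRat (zv (x ∘ pq m) t)) = toRat (zv x t) := by
  rw [det3_eq] at hm
  have hu : IsUnit m.det := isUnit_iff_ne_zero.2 hm
  have h1 : m * m⁻¹ = 1 := mul_nonsing_inv m hu
  have h2 : m⁻¹ * m = 1 := nonsing_inv_mul m hu
  have hi : ∀ i, pq m (pq m⁻¹ i) = i := fun i => by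
    apply p21_inj
    rw [p21_pq, p21_pq, ← pmf_mul _ _ (det_ne_of_mul h2).1, h1, pmf_one]
  have hi' : ∀ i, pq m⁻¹ (pq m i) = i := fun i => by
    apply p21_inj
    rw [p21_pq, p21_pq, ← pmf_mul _ _ hm, h2, pmf_one]
  refine ⟨gD m m⁻¹ h1 h2, inG_D _ _ _ _, Function.LeftInverse.injective hi', fun x t => ?_⟩
  refine toRat_ext (fun i => ?_) (fun i h => ?_)
  · rw [gD_apply, ← p21_pq, toRat, zv_p21, Function.comp, hi]
  · rw [gD_apply, toRat, zv_last]
    rw [pmf, if_neg (by omega)]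
    exact th_ge _

theorem gT_zv (h : M3) (x : Fin 21 → ℤ) (t : ℤ) :
    gT h (toRat (zv x t)) = toRat (zv (fun i => sgnZ h (p21 i) * x i) t) := by
  refine toRat_ext (fun i => ?_) (fun i hi => ?_)
  · rw [gT_apply, toRat, zv_p21, ← sgnZ_cast]; push_cast; rfl
  · rw [gT_apply, toRat, zv_last _ _ hi, ← sgnZ_cast, sgnZ, if_neg (by omega)]; simp

theorem neg_zv (x : Fin 21 → ℤ) (t : ℤ) :
    (LinearEquiv.neg ℚ : V24 ≃ₗ[ℚ] V24) (toRat (zv x t)) = toRat (zv (fun i => - x i) (-t)) := by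
  refine toRat_ext (fun i => ?_) (fun i hi => ?_)
  · simp [toRat, zv_p21]
  · simp [toRat, zv_last _ _ hi]

theorem gK_zv (y y' : Fin 24 → ℤ) (h : ∀ i, ∑ j, KZ i j * y j = 2 * y' i) : gK (toRat y) = toRat y' := by
  funext i
  rw [gK_apply]
  have : (∑ j, (KZ i j : ℚ) * toRat y j) = 2 * (y' i : ℚ) := by
    have := congrArg (Int.cast : ℤ → ℚ) (h i)
    push_cast at this
    exact this
  rw [this, toRat]; ring

def t8w : ↥W22 := wv 0 8

def Reach (y : ↥W22) : Prop := ∃ e, KK e ∧ e t8w = y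

theorem Reach.step {y y' : ↥W22} (h : Reach y) {k : V24 ≃ₗ[ℚ] V24} (hk : InG k) (h' : k (y : V24) = (y' : V24)) :
    Reach y' := by
  obtain ⟨e, he, rfl⟩ := h
  exact ⟨resE k hk.circ * e, KK.mul ⟨k, hk, rfl⟩ he, Subtype.ext h'⟩

theorem isY_t8 : IsY t8w := by
  have h8 : (t8w : V24) ∈ Lam22Q := wv_Lam (by decide +kernel)
  refine ⟨h8, fun v hv => ?_, ?_⟩
  · obtain ⟨x, t, rfl, -⟩ := exists_wv hv
    exact ⟨t, by rw [t8w, inn_wv]; push_cast; simp; ring⟩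
  · rw [t8w, inn_wv]; norm_num

theorem Reach.isY {y : ↥W22} (h : Reach y) : IsY y := by
  obtain ⟨e, he, rfl⟩ := h
  exact isY_t8.map he.mem

theorem isY_lt {x : Fin 21 → ℤ} {t : ℤ} (h : IsY (wv x t)) (ht : t = 2 ∨ t = -2) : t = lt x := by
  obtain ⟨x', t', he, hl⟩ := exists_wv h.1
  obtain ⟨rfl, rfl⟩ := wv_inj he
  obtain ⟨m, hm, -, h2, -, h8⟩ := leech_zv hl
  rw [lt]
  generalize ∑ i, x i = S at h8
  split_ifs <;> omega

theorem reach_t8 : Reach t8w := ⟨1, KK_one, rfl⟩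

theorem reach_a (s : Bool) : Reach (wv 0 (8 * sg s)) := by
  cases s
  · refine reach_t8.step inG_neg ?_
    rw [t8w, wv_coe, neg_zv, wv_coe]; congr 2
  · exact reach_t8

theorem reach_b0 : Reach (wv (Pi.single 0 12) (-4)) :=
  reach_t8.step inG_K (gK_zv _ _ (by decide +kernel))

theorem reach_b1 (s s' : Bool) : Reach (wv (Pi.single 0 (12 * sg s)) (4 * sg s')) := by
  have h : ∀ s, Reach (wv (Pi.single 0 (12 * sg s)) (-4)) := by
    intro s
    cases s
    · refine reach_b0.step (inG_T (hb ((true, false, false), (0, 0, 0))) (hb_herm _)) ?_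
      rw [wv_coe, gT_zv, wv_coe]; congr 2
      decide +kernel
    · exact reach_b0
  cases s'
  · exact h s
  · refine (h (!s)).step inG_neg ?_
    rw [wv_coe, neg_zv, wv_coe]; congr 2
    cases s <;> decide +kernel

theorem single_pq {m : M3} (hm : Function.Injective (pq m)) (p : Fin 21) (c : ℤ) :
    (Pi.single (pq m p) c : Fin 21 → ℤ) ∘ pq m = Pi.single p c := by
  funext i
  by_cases h : i = p
  · subst h; simp
  · have : pq m i ≠ pq m p := fun h' => h (hm h')
    simp [h, this]

def cols (a b c : V3) : M3 := fun i j => if j = 0 then a i else if j = 1 then b i else c i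

def r21 (i : Fin 21) : V3 := rep (p21 i)

theorem pt_check : ∀ q : Fin 21, ∃ a b, det3 (cols (r21 q) (r21 a) (r21 b)) ≠ 0 ∧
    pq (cols (r21 q) (r21 a) (r21 b)) 0 = q := by decide +kernel

theorem reach_b (p : Fin 21) (s s' : Bool) : Reach (wv (Pi.single p (12 * sg s)) (4 * sg s')) := by
  obtain ⟨a, b, h1, h2⟩ := pt_check p
  obtain ⟨k, hk, hi, hx⟩ := exD _ h1
  refine (reach_b1 s s').step hk ?_
  have := hx (Pi.single p (12 * sg s)) (4 * sg s')
  nth_rewrite 1 [← h2] at this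
  rwa [single_pq hi] at this

theorem sg_check : ∀ a0 a1 a2 a3 a4 : Bool, ∃ s x y : Bool, ∃ z : K4,
    sg s * sgnZ (hb ((x, y, false), (0, 0, z))) (p21 0) = sg a0 ∧
    sg s * sgnZ (hb ((x, y, false), (0, 0, z))) (p21 1) = sg a1 ∧
    sg s * sgnZ (hb ((x, y, false), (0, 0, z))) (p21 2) = sg a2 ∧
    sg s * sgnZ (hb ((x, y, false), (0, 0, z))) (p21 3) = sg a3 ∧
    sg s * sgnZ (hb ((x, y, false), (0, 0, z))) (p21 20) = sg a4 := by decide +kernel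

theorem line4 : ∀ i, lineB 4 i = true → i = 0 ∨ i = 1 ∨ i = 2 ∨ i = 3 ∨ i = 20 := by decide +kernel

theorem reach_c0 : Reach (wv (fun i => if lineB 4 i = true then 6 else 0) (-2)) := by
  have h : Reach (wv (fun i => if lineB 4 i = true then -6 else 0) 2) :=
    (reach_b 1 true false).step inG_K (gK_zv _ _ (by decide +kernel))
  refine h.step inG_neg ?_
  rw [wv_coe, neg_zv, wv_coe]; congr 2
  funext i; split_ifs <;> rfl

theorem reach_neg {x : Fin 21 → ℤ} {t : ℤ} (h : Reach (wv x t)) (s : Bool) : Reach (wv (fun i => sg s * x i) (sg s * t)) := by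
  cases s
  · refine h.step inG_neg ?_
    rw [wv_coe, neg_zv, wv_coe]; simp [sg]
  · simpa [sg] using h

theorem reach_c1 (σ : Fin 21 → Bool) : ∃ t, (t = 2 ∨ t = -2) ∧ Reach (wv (lx 4 σ) t) := by
  obtain ⟨s, x, y, z, h0, h1, h2, h3, h4⟩ := sg_check (σ 0) (σ 1) (σ 2) (σ 3) (σ 20)
  refine ⟨sg s * (-2), by cases s <;> simp [sg], ?_⟩
  have h : Reach (wv (fun i => sgnZ (hb ((x, y, false), (0, 0, z))) (p21 i) * if lineB 4 i = true then 6 else 0) (-2)) :=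
    reach_c0.step (inG_T (hb ((x, y, false), (0, 0, z))) (hb_herm _)) (by rw [wv_coe, gT_zv, wv_coe])
  have := reach_neg h s
  convert this using 2
  funext i
  rw [lx]
  by_cases c : lineB 4 i = true
  · rw [if_pos c, if_pos c, ← mul_assoc, mul_comm]
    congr 1
    rcases line4 i c with rfl | rfl | rfl | rfl | rfl
    · exact h0.symm
    · exact h1.symm
    · exact h2.symm
    · exact h3.symm
    · exact h4.symm
  · rw [if_neg c, if_neg c]; simp

theorem line_check : ∀ q : Fin 21, ∃ a b : Fin 21, lineB q a = true ∧ lineB q b = true ∧ a ≠ b ∧ ∃ c,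
    det3 (cols (r21 a) (r21 b) (r21 c)) ≠ 0 ∧
    ∀ i, lineB q (pq (cols (r21 a) (r21 b) (r21 c)) i) = lineB 4 i := by decide +kernel

theorem reach_c (b : Fin 21) (σ : Fin 21 → Bool) : Reach (wv (lx b σ) (lt (lx b σ))) := by
  obtain ⟨a1, a2, -, -, -, a3, h1, h2⟩ := line_check b
  obtain ⟨k, hk, hi, hx⟩ := exD _ h1
  obtain ⟨t, ht, hr⟩ := reach_c1 (σ ∘ pq (cols (r21 a1) (r21 a2) (r21 a3)))
  have : Reach (wv (lx b σ) t) := by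
    refine hr.step hk ?_
    have e : lx b σ ∘ pq (cols (r21 a1) (r21 a2) (r21 a3)) =
        lx 4 (σ ∘ pq (cols (r21 a1) (r21 a2) (r21 a3))) := by
      funext i
      simp only [lx, h2, Function.comp]
    have := hx (lx b σ) t
    rw [e] at this
    exact this
  rwa [← isY_lt this.isY ht]

theorem reach_d0 : Reach (wv (fun _ => 3) (-1)) := by
  have e : lt (lx 0 fun _ => true) = -2 := by decide +kernel
  have h : Reach (wv (fun i => -3) 1) := by
    refine (reach_c 0 (fun _ => true)).step inG_K ?_
    rw [e]
    exact gK_zv _ _ (by decide +kernel)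
  exact reach_neg h false

theorem reach_d (s : Bool) (p : HP) : Reach (wv (fun i => sg s * dx p i) (-sg s)) := by
  have h : Reach (wv (dx p) (-1)) :=
    reach_d0.step (inG_T (hb p) (hb_herm _)) (by
      rw [wv_coe, gT_zv, wv_coe]; congr 2; funext i; rw [dx, mul_comm])
  have := reach_neg h s
  rwa [mul_neg_one] at this

end

section

open Matrix

/-! ## The order of the automorphism group -/


abbrev EW := ↥W22 ≃ₗ[ℚ] ↥W22

def stb (H : Subgroup EW) (x : ↥W22) : Subgroup EW := H ⊓ MulAction.stabilizer EW x

theorem mem_stb {H : Subgroup EW} {x : ↥W22} {g : EW} : g ∈ stb H x ↔ g ∈ H ∧ g x = x := Iff.rfl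

theorem chain (H : Subgroup EW) (x : ↥W22) {ι : Type} [Fintype ι] (f : ι → ↥W22) (hf : Function.Injective f)
    (h1 : ∀ g ∈ H, ∃ i, g x = f i) (h2 : ∀ i, ∃ g, g ∈ H ∧ KK g ∧ g x = f i) :
    Nat.card H = Fintype.card ι * Nat.card (stb H x) ∧ ((∀ g ∈ stb H x, KK g) → ∀ g ∈ H, KK g) := by
  choose k hkH hkK hkx using h2
  have key : ∀ g ∈ H, ∃ i, (k i)⁻¹ * g ∈ stb H x := by
    intro g hg
    obtain ⟨i, hi⟩ := h1 g hg
    refine ⟨i, mem_stb.2 ⟨H.mul_mem (H.inv_mem (hkH i)) hg, ?_⟩⟩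
    show (k i).symm (g x) = x
    rw [hi, ← hkx, LinearEquiv.symm_apply_apply]
  constructor
  · rw [← Nat.card_eq_fintype_card, ← Nat.card_prod]
    symm
    refine Nat.card_congr (Equiv.ofBijective
      (fun p : ι × stb H x => (⟨k p.1 * p.2.1, H.mul_mem (hkH _) (mem_stb.1 p.2.2).1⟩ : H)) ⟨?_, ?_⟩)
    · rintro ⟨i, s, hs⟩ ⟨j, s', hs'⟩ h
      have h' : k i * s = k j * s' := congrArg Subtype.val h
      have hx := congrArg (fun e : EW => e x) h'
      have e1 : (k i * s) x = f i := by
        show k i (s x) = _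
        rw [(mem_stb.1 hs).2, hkx]
      have e2 : (k j * s') x = f j := by
        show k j (s' x) = _
        rw [(mem_stb.1 hs').2, hkx]
      have : i = j := hf (by rw [← e1, ← e2]; exact hx)
      subst this
      have := mul_left_cancel h'
      subst this
      rfl
    · rintro ⟨g, hg⟩
      obtain ⟨i, hi⟩ := key g hg
      exact ⟨⟨i, _, hi⟩, Subtype.ext (by simp)⟩
  · intro hs g hg
    obtain ⟨i, hi⟩ := key g hg
    have := (hkK i).mul (hs _ hi)
    rwa [mul_inv_cancel_left] at this

/-! ### stage 0 -/

abbrev QQ := Bool ⊕ (Fin 21 × Bool × Bool) ⊕ (Σ b : Fin 21, ({i // lineB b i = true} → Bool)) ⊕ (Bool × HP)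

theorem card_K4x : Fintype.card K4 = 4 := by decide

theorem card_QQ : Fintype.card QQ = 1782 := by
  have : ∀ b : Fin 21, Fintype.card ({i // lineB b i = true} → Bool) = 32 := by
    intro b
    rw [Fintype.card_fun, Fintype.card_subtype, line_card]; rfl
  rw [Fintype.card_sum, Fintype.card_sum, Fintype.card_sum, Fintype.card_sigma]
  simp only [this]
  simp [card_K4x]

def exs (b : Fin 21) (σ : {i // lineB b i = true} → Bool) (i : Fin 21) : Bool :=
  if h : lineB b i = true then σ ⟨i, h⟩ else true

def fQ : QQ → ↥W22
  | .inl s => wv 0 (8 * sg s)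
  | .inr (.inl (p, s, s')) => wv (Pi.single p (12 * sg s)) (4 * sg s')
  | .inr (.inr (.inl ⟨b, σ⟩)) => wv (lx b (exs b σ)) (lt (lx b (exs b σ)))
  | .inr (.inr (.inr (s, p))) => wv (fun i => sg s * dx p i) (-sg s)

theorem sg_inj {s s' : Bool} (h : sg s = sg s') : s = s' := by
  cases s <;> cases s' <;> simp_all [sg]
theorem sg_abs (s : Bool) : sg s = 1 ∨ sg s = -1 := by cases s <;> simp [sg]
theorem ltx_abs (x : Fin 21 → ℤ) : lt x = 2 ∨ lt x = -2 := by rw [lt]; split_ifs <;> simp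

theorem negB_zero : ∀ p : HP, (∀ i, negB p i = false) → p = ((false, false, false), (0, 0, 0)) := by decide +kernel

def addHP (p q : HP) : HP := ((xor p.1.1 q.1.1, xor p.1.2.1 q.1.2.1, xor p.1.2.2 q.1.2.2), (p.2.1 + q.2.1, p.2.2.1 + q.2.2.1, p.2.2.2 + q.2.2.2))

theorem b2k_xor : ∀ a b, b2k (xor a b) = b2k a + b2k b := by decide

theorem hb_add (p q : HP) : hb (addHP p q) = hb p + hb q := by
  ext i j
  simp only [hb, addHP, b2k_xor, hmat]
  fin_cases i <;> fin_cases j <;> simp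

theorem dx_inj {p q : HP} (h : ∀ i, dx p i = dx q i) : p = q := by
  have h0 : ∀ i, negB (addHP p q) i = false := by
    intro i
    have hi : sgnZ (hb p) (p21 i) = sgnZ (hb q) (p21 i) := by
      have := h i
      simp only [dx] at this
      omega
    rw [negB, decide_eq_false_iff_not, hb_add]
    rw [sgnZ_tz _ _ (p21_lt i)] at hi ⊢
    rw [sgnZ_tz _ _ (p21_lt i)] at hi
    rw [hf_add, tz_add]
    have z2 : ∀ a b : ZMod 2, ((if a = 0 then (1:ℤ) else -1) = if b = 0 then 1 else -1) → a + b = 0 := by decide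
    rw [z2 _ _ hi]; simp
  have := negB_zero _ h0
  obtain ⟨⟨a, b, c⟩, x, y, z⟩ := p
  obtain ⟨⟨a', b', c'⟩, x', y', z'⟩ := q
  simp only [addHP, Prod.mk.injEq] at this
  have hb2 : ∀ a b : Bool, xor a b = false → a = b := by decide
  have hk : ∀ a b : K4, a + b = 0 → a = b := by decide
  obtain ⟨⟨h1, h2, h3⟩, h4, h5, h6⟩ := this
  rw [hb2 _ _ h1, hb2 _ _ h2, hb2 _ _ h3, hk _ _ h4, hk _ _ h5, hk _ _ h6]

theorem single_inj' {p q : Fin 21} {a b : ℤ} (ha : a ≠ 0) (h : (Pi.single p a : Fin 21 → ℤ) = Pi.single q b) : p = q ∧ a = b := by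
  have h1 := congrFun h p
  rw [Pi.single_eq_same] at h1
  by_cases e : p = q
  · subst e; rw [Pi.single_eq_same] at h1; exact ⟨rfl, h1⟩
  · rw [Pi.single_eq_of_ne e] at h1; exact absurd h1 ha

theorem lx_line {b b' : Fin 21} {σ σ' : Fin 21 → Bool} (h : lx b σ = lx b' σ') : b = b' := by
  apply line_inj
  intro i
  have := congrFun h i
  simp only [lx] at this
  have s1 := sg_abs (σ i)
  have s2 := sg_abs (σ' i)
  cases e1 : lineB b i <;> cases e2 : lineB b' i <;> simp [e1, e2] at this <;> first | rfl | omega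

theorem fQ_inj : Function.Injective fQ := by
  rintro (s | ⟨p, s, s'⟩ | ⟨b, σ⟩ | ⟨s, p⟩) (t | ⟨q, t, t'⟩ | ⟨c, τ⟩ | ⟨t, q⟩) h <;>
    simp only [fQ] at h <;> obtain ⟨h1, h2⟩ := wv_inj h
  · rw [sg_inj (s := s) (s' := t) (by omega)]
  · exfalso; have := sg_abs s; have := sg_abs t'; omega
  · exfalso; have := sg_abs s; have := ltx_abs (lx c (exs c τ)); omega
  · exfalso; have := sg_abs s; have := sg_abs t; omega
  · exfalso; have := sg_abs s'; have := sg_abs t; omega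
  · have e1 := sg_inj (s := s') (s' := t') (by omega)
    obtain ⟨e2, e3⟩ := single_inj' (by have := sg_abs s; omega) h1
    have e4 := sg_inj (s := s) (s' := t) (by omega)
    rw [e1, e2, e4]
  · exfalso; have := sg_abs s'; have := ltx_abs (lx c (exs c τ)); omega
  · exfalso; have := sg_abs s'; have := sg_abs t; omega
  · exfalso; have := sg_abs t; have := ltx_abs (lx b (exs b σ)); omega
  · exfalso; have := sg_abs t'; have := ltx_abs (lx b (exs b σ)); omega
  · have := lx_line h1
    subst this
    have : σ = τ := by
      funext ⟨i, hi⟩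
      have := congrFun h1 i
      simp only [lx, hi, if_true, exs, dif_pos] at this
      exact sg_inj (by omega)
    rw [this]
  · exfalso; have := sg_abs t; have := ltx_abs (lx b (exs b σ)); omega
  · exfalso; have := sg_abs s; have := sg_abs t; omega
  · exfalso; have := sg_abs s; have := sg_abs t'; omega
  · exfalso; have := sg_abs s; have := ltx_abs (lx c (exs c τ)); omega
  · have := sg_inj (s := s) (s' := t) (by omega)
    subst this
    rw [dx_inj (p := p) (q := q) (fun i => by
      have := congrFun h1 i
      have h3 := sg_abs s
      rcases h3 with h3 | h3 <;> simp only [h3] at this <;> omega)]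

theorem lx_exs (b : Fin 21) (σ : Fin 21 → Bool) : lx b (exs b (fun i => σ i.1)) = lx b σ := by
  funext i
  simp only [lx, exs]
  split_ifs <;> rfl

theorem fQ_ex {y : ↥W22} (h : IsY y) : ∃ q, y = fQ q := by
  rcases h.classify with ⟨s, rfl⟩ | ⟨p, s, s', rfl⟩ | ⟨b, σ, rfl⟩ | ⟨s, p, rfl⟩
  · exact ⟨.inl s, rfl⟩
  · exact ⟨.inr (.inl (p, s, s')), rfl⟩
  · exact ⟨.inr (.inr (.inl ⟨b, fun i => σ i.1⟩)), by simp only [fQ, lx_exs]⟩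
  · exact ⟨.inr (.inr (.inr (s, p))), rfl⟩

theorem fQ_reach (q : QQ) : Reach (fQ q) := by
  rcases q with s | ⟨p, s, s'⟩ | ⟨b, σ⟩ | ⟨s, p⟩
  · exact reach_a s
  · exact reach_b p s s'
  · exact reach_c _ _
  · exact reach_d s p

def HA : Subgroup EW := stb OLam22 t8w

theorem stage0 : Nat.card OLam22 = 1782 * Nat.card HA ∧ ((∀ g ∈ HA, KK g) → ∀ g ∈ OLam22, KK g) := by
  have := chain OLam22 t8w fQ fQ_inj (fun g hg => fQ_ex (isY_t8.map hg)) (fun i => by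
    obtain ⟨e, he, h⟩ := fQ_reach i
    exact ⟨e, he.mem, he, h⟩)
  rwa [card_QQ] at this

/-! ### stage 1 -/

def u0 : ↥W22 := wv (fun _ => 3) (-1)

theorem inn_t8 (x : Fin 21 → ℤ) (t : ℤ) : inn (wv x t) t8w = 3 * t := by
  rw [t8w, inn_wv]; push_cast; simp

theorem inn_u0 (x : Fin 21 → ℤ) (t : ℤ) : inn (wv x t) u0 = ((3 * (∑ i, x i) - 3 * t : ℤ) : ℚ) / 8 := by
  rw [u0, inn_wv]
  congr 2
  rw [← Finset.sum_mul]; ring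

theorem HA_inn {g : EW} (hg : g ∈ HA) (y : ↥W22) : inn (g y) t8w = inn y t8w := by
  obtain ⟨h1, h2⟩ := mem_stb.1 hg
  conv_lhs => rw [← h2]
  exact inn_OL h1 _ _

theorem HA_t {g : EW} (hg : g ∈ HA) {x x' : Fin 21 → ℤ} {t t' : ℤ} (h : g (wv x t) = wv x' t') : t' = t := by
  have := HA_inn hg (wv x t)
  rw [h, inn_t8, inn_t8] at this
  have : (t' : ℚ) = t := by linarith
  exact_mod_cast this

def HB : Subgroup EW := stb HA u0

theorem card_HP : Fintype.card HP = 512 := by simp [card_K4x]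

theorem isY_u0 : IsY u0 := (reach_d0).isY

theorem KK_of {k : V24 ≃ₗ[ℚ] V24} (hk : InG k) : KK (resE k hk.circ) := ⟨k, hk, rfl⟩

theorem stage1 : Nat.card HA = 512 * Nat.card HB ∧ ((∀ g ∈ HB, KK g) → ∀ g ∈ HA, KK g) := by
  have := chain HA u0 (fun p : HP => wv (dx p) (-1)) (fun p q h => dx_inj (fun i => congrFun (wv_inj h).1 i))
    (fun g hg => by
      rcases (isY_u0.map (mem_stb.1 hg).1).classify with ⟨s, h⟩ | ⟨p, s, s', h⟩ | ⟨b, σ, h⟩ | ⟨s, p, h⟩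
      · exfalso; have := HA_t hg h; have := sg_abs s; omega
      · exfalso; have := HA_t hg h; have := sg_abs s'; omega
      · exfalso; have := HA_t hg h; have := ltx_abs (lx b σ); omega
      · have := HA_t hg h
        have e : sg s = 1 := by omega
        refine ⟨p, ?_⟩
        rw [h, e]; simp)
    (fun p => by
      have hk := inG_T (hb p) (hb_herm _)
      refine ⟨_, mem_stb.2 ⟨(KK_of hk).mem, Subtype.ext ?_⟩, KK_of hk, Subtype.ext ?_⟩
      · rw [resE_apply, t8w, wv_coe, gT_zv]; congr 2; funext i; simp
      · rw [resE_apply, u0, wv_coe, gT_zv, wv_coe]; congr 2; funext i; simp [dx, mul_comm])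
  rwa [card_HP] at this

end

section

open Matrix

/-! ## The stabilizer chain on the projective plane -/


def dp (p : Fin 21) : ↥W22 := wv (Pi.single p 12) (-4)
def lb (b : Fin 21) : ↥W22 := wv (lx b (fun _ => true)) (-2)

theorem lb_sum : ∀ b, lt (lx b (fun _ => true)) = -2 ∧ ∑ i, lx b (fun _ => true) i = 30 := by decide +kernel

theorem dp_inj : Function.Injective dp := fun p q h => (single_inj' (by norm_num) (wv_inj h).1).1

theorem isY_dp (p : Fin 21) : IsY (dp p) := (reach_b p true false).isY

theorem isY_lb (b : Fin 21) : IsY (lb b) := by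
  have := (reach_c b (fun _ => true)).isY
  rwa [(lb_sum b).1] at this

theorem HB_inn {g : EW} (hg : g ∈ HB) (y : ↥W22) : inn (g y) u0 = inn y u0 := by
  obtain ⟨h1, h2⟩ := mem_stb.1 hg
  conv_lhs => rw [← h2]
  exact inn_OL (mem_stb.1 h1).1 _ _

theorem HB_s {g : EW} (hg : g ∈ HB) {x x' : Fin 21 → ℤ} {t t' : ℤ} (h : g (wv x t) = wv x' t') :
    ∑ i, x' i = ∑ i, x i := by
  have h1 := HA_t (mem_stb.1 hg).1 h
  have := HB_inn hg (wv x t)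
  rw [h, inn_u0, inn_u0, h1] at this
  have h2 : ((3 * (∑ i, x' i) - 3 * t : ℤ) : ℚ) = (3 * (∑ i, x i) - 3 * t : ℤ) := by linarith
  have h3 : 3 * (∑ i, x' i) - 3 * t = 3 * (∑ i, x i) - 3 * t := by exact_mod_cast h2
  omega

theorem HB_dp {g : EW} (hg : g ∈ HB) (p : Fin 21) : ∃ q, g (dp p) = dp q := by
  have hA := (mem_stb.1 hg).1
  rcases ((isY_dp p).map (mem_stb.1 hA).1).classify with ⟨s, h⟩ | ⟨q, s, s', h⟩ | ⟨b, σ, h⟩ | ⟨s, p, h⟩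
  · exfalso; have := HA_t hA h; have := sg_abs s; omega
  · refine ⟨q, ?_⟩
    have h1 := HA_t hA h
    have h2 := HB_s hg h
    simp only [Finset.sum_pi_single', Finset.mem_univ, if_true] at h2
    rw [h, dp, h1, h2]
  · exfalso; have := HA_t hA h; have := ltx_abs (lx b σ); omega
  · exfalso; have := HA_t hA h; have := sg_abs s; omega

theorem HB_lb {g : EW} (hg : g ∈ HB) (b : Fin 21) : ∃ c, g (lb b) = lb c := by
  have hA := (mem_stb.1 hg).1
  rcases ((isY_lb b).map (mem_stb.1 hA).1).classify with ⟨s, h⟩ | ⟨q, s, s', h⟩ | ⟨c, σ, h⟩ | ⟨s, p, h⟩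
  · exfalso; have := HA_t hA h; have := sg_abs s; omega
  · exfalso; have := HA_t hA h; have := sg_abs s'; omega
  · refine ⟨c, ?_⟩
    have h1 := HA_t hA h
    have h2 := HB_s hg h
    rw [(lb_sum b).2, ← (lb_sum c).2] at h2
    have h3 : ∀ i ∈ Finset.univ, lx c σ i ≤ lx c (fun _ => true) i := fun i _ => by
      have := sg_abs (σ i)
      simp only [lx, sg, if_true] at *
      split_ifs at * <;> omega
    have h4 := (Finset.sum_eq_sum_iff_of_le h3).1 h2
    rw [h, h1, lb]
    congr 1
    funext i
    exact h4 i (Finset.mem_univ _)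
  · exfalso; have := HA_t hA h; have := sg_abs s; omega

theorem inn_lb_dp (b p : Fin 21) : inn (lb b) (dp p) = if lineB b p = true then 12 else 3 := by
  rw [lb, dp, inn_wv]
  have : ∑ i, lx b (fun _ => true) i * (Pi.single p 12 : Fin 21 → ℤ) i = lx b (fun _ => true) p * 12 := by
    rw [Finset.sum_eq_single p]
    · rw [Pi.single_eq_same]
    · intro i _ h; rw [Pi.single_eq_of_ne h]; ring
    · simp
  rw [this, lx]
  split_ifs <;> norm_num [sg]

theorem HB_line {g : EW} (hg : g ∈ HB) {b p c q : Fin 21} (h1 : g (lb b) = lb c) (h2 : g (dp p) = dp q) :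
    lineB b p = lineB c q := by
  have := inn_OL (mem_stb.1 (mem_stb.1 hg).1).1 (lb b) (dp p)
  rw [h1, h2, inn_lb_dp, inn_lb_dp] at this
  cases e1 : lineB b p <;> cases e2 : lineB c q <;> simp [e1, e2] at this <;> first | rfl | norm_num at this

theorem HB_pi {g : EW} (hg : g ∈ HB) : ∃ (π l : Fin 21 → Fin 21), Function.Injective π ∧ (∀ p, g (dp p) = dp (π p)) ∧
    ∀ b p, lineB b p = lineB (l b) (π p) := by
  choose π hπ using HB_dp hg
  choose l hl using HB_lb hg
  refine ⟨π, l, fun p q h => ?_, hπ, fun b p => HB_line hg (hl b) (hπ p)⟩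
  apply dp_inj
  apply g.injective
  rw [hπ, hπ, h]

def chl (a b x : Fin 21) : Prop := lineB x a = true ∧ lineB x b = true ∧
  ∀ L, lineB L a = true → lineB L b = true → L = x
instance (a b x) : Decidable (chl a b x) := by unfold chl; infer_instance

theorem fixl {π l : Fin 21 → Fin 21} (h : ∀ b p, lineB b p = lineB (l b) (π p)) {a b x : Fin 21} (hc : chl a b x)
    (ha : π a = a) (hb : π b = b) : l x = x := by
  apply hc.2.2
  · rw [← hc.1, h x a, ha]
  · rw [← hc.2.1, h x b, hb]

theorem meet {π l : Fin 21 → Fin 21} (h : ∀ b p, lineB b p = lineB (l b) (π p)) {a b c d : Fin 21} (x y q : Fin 21)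
    (hc : chl a b x ∧ chl c d y ∧ lineB x q = true ∧ lineB y q = true ∧
      ∀ p, lineB x p = true → lineB y p = true → p = q)
    (ha : π a = a) (hb : π b = b) (hc' : π c = c) (hd : π d = d) : π q = q := by
  apply hc.2.2.2.2
  · rw [← hc.2.2.1, h x q, fixl h hc.1 ha hb]
  · rw [← hc.2.2.2.1, h y q, fixl h hc.2.1 hc' hd]

theorem exK (m : M3) (hm : det3 m ≠ 0) : ∃ e, KK e ∧ e ∈ HB ∧ ∀ p, e (dp p) = dp (pq m p) := by
  obtain ⟨k, hk, hi, hx⟩ := exD m hm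
  refine ⟨_, KK_of hk, mem_stb.2 ⟨mem_stb.2 ⟨(KK_of hk).mem, Subtype.ext ?_⟩, Subtype.ext ?_⟩, fun p => Subtype.ext ?_⟩
  · rw [resE_apply]; exact hx 0 8
  · rw [resE_apply]; exact hx (fun _ => 3) (-1)
  · rw [resE_apply, dp, dp, wv_coe, wv_coe, ← hx (Pi.single (pq m p) 12), single_pq hi]

def HC := stb HB (dp 0)
def HD := stb HC (dp 1)
def HE := stb HD (dp 4)
def HF := stb HE (dp 5)
def HG := stb HF (dp 3)

theorem stage2 : Nat.card HB = 21 * Nat.card HC ∧ ((∀ g ∈ HC, KK g) → ∀ g ∈ HB, KK g) := by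
  have := chain HB (dp 0) dp dp_inj (fun g hg => HB_dp hg 0) (fun p => by
    obtain ⟨a, b, h1, h2⟩ := pt_check p
    obtain ⟨e, h3, h4, h5⟩ := exK _ h1
    exact ⟨e, h4, h3, by rw [h5, h2]⟩)
  rwa [Fintype.card_fin] at this

theorem sub_inj {P : Fin 21 → Prop} : Function.Injective (fun q : {q // P q} => dp q.1) :=
  fun _ _ h => Subtype.ext (dp_inj h)

theorem ck3 : ∀ q : Fin 21, q ≠ 0 → ∃ b, det3 (cols (r21 0) (r21 q) (r21 b)) ≠ 0 ∧
    pq (cols (r21 0) (r21 q) (r21 b)) 0 = 0 ∧ pq (cols (r21 0) (r21 q) (r21 b)) 1 = q := by decide +kernel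

theorem stage3 : Nat.card HC = 20 * Nat.card HD ∧ ((∀ g ∈ HD, KK g) → ∀ g ∈ HC, KK g) := by
  have := chain HC (dp 1) (fun q : {q : Fin 21 // q ≠ 0} => dp q.1) sub_inj (fun g hg => by
      obtain ⟨π, l, hi, h1, h2⟩ := HB_pi (mem_stb.1 hg).1
      have e0 : π 0 = 0 := dp_inj (by rw [← h1]; exact (mem_stb.1 hg).2)
      exact ⟨⟨π 1, fun h => absurd (hi (h.trans e0.symm)) (by decide)⟩, h1 1⟩)
    (fun ⟨q, hq⟩ => by
      obtain ⟨b, h1, h2, h2'⟩ := ck3 q hq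
      obtain ⟨e, h3, h4, h5⟩ := exK _ h1
      exact ⟨e, mem_stb.2 ⟨h4, by rw [h5, h2]⟩, h3, by rw [h5, h2']⟩)
  have c : Fintype.card {q : Fin 21 // q ≠ 0} = 20 := by decide +kernel
  rwa [c] at this

theorem ck4 : ∀ q : Fin 21, lineB 4 q = false → det3 (cols (r21 0) (r21 1) (r21 q)) ≠ 0 ∧
    pq (cols (r21 0) (r21 1) (r21 q)) 0 = 0 ∧ pq (cols (r21 0) (r21 1) (r21 q)) 1 = 1 ∧
    pq (cols (r21 0) (r21 1) (r21 q)) 4 = q := by decide +kernel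

theorem stage4 : Nat.card HD = 16 * Nat.card HE ∧ ((∀ g ∈ HE, KK g) → ∀ g ∈ HD, KK g) := by
  have := chain HD (dp 4) (fun q : {q : Fin 21 // lineB 4 q = false} => dp q.1) sub_inj (fun g hg => by
      obtain ⟨hC, f1⟩ := mem_stb.1 hg
      obtain ⟨hB, f0⟩ := mem_stb.1 hC
      obtain ⟨π, l, hi, h1, h2⟩ := HB_pi hB
      have e0 : π 0 = 0 := dp_inj (by rw [← h1]; exact f0)
      have e1 : π 1 = 1 := dp_inj (by rw [← h1]; exact f1)
      refine ⟨⟨π 4, ?_⟩, h1 4⟩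
      have e4 := fixl h2 (x := 4) (by decide +kernel) e0 e1
      have := h2 4 4
      rw [e4] at this
      rw [← this]; decide +kernel)
    (fun ⟨q, hq⟩ => by
      obtain ⟨h1, h2, h2', h2''⟩ := ck4 q hq
      obtain ⟨e, h3, h4, h5⟩ := exK _ h1
      exact ⟨e, mem_stb.2 ⟨mem_stb.2 ⟨h4, by rw [h5, h2]⟩, by rw [h5, h2']⟩, h3, by rw [h5, h2'']⟩)
  have c : Fintype.card {q : Fin 21 // lineB 4 q = false} = 16 := by decide +kernel
  rwa [c] at this

def dgm (v : V3) : M3 := fun i j => if i = j then v i else 0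

abbrev off3 (q : Fin 21) : Prop := lineB 4 q = false ∧ lineB 1 q = false ∧ lineB 0 q = false

theorem ck5 : ∀ q : Fin 21, off3 q → det3 (dgm (r21 q)) ≠ 0 ∧
    pq (dgm (r21 q)) 0 = 0 ∧ pq (dgm (r21 q)) 1 = 1 ∧
    pq (dgm (r21 q)) 4 = 4 ∧ pq (dgm (r21 q)) 5 = q := by decide +kernel

theorem stage5 : Nat.card HE = 9 * Nat.card HF ∧ ((∀ g ∈ HF, KK g) → ∀ g ∈ HE, KK g) := by
  have := chain HE (dp 5) (fun q : {q : Fin 21 // off3 q} => dp q.1) sub_inj (fun g hg => by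
      obtain ⟨hD, f4⟩ := mem_stb.1 hg
      obtain ⟨hC, f1⟩ := mem_stb.1 hD
      obtain ⟨hB, f0⟩ := mem_stb.1 hC
      obtain ⟨π, l, hi, h1, h2⟩ := HB_pi hB
      have e0 : π 0 = 0 := dp_inj (by rw [← h1]; exact f0)
      have e1 : π 1 = 1 := dp_inj (by rw [← h1]; exact f1)
      have e4 : π 4 = 4 := dp_inj (by rw [← h1]; exact f4)
      refine ⟨⟨π 5, ?_⟩, h1 5⟩
      have l4 := fixl h2 (x := 4) (by decide +kernel) e0 e1
      have l1 := fixl h2 (x := 1) (by decide +kernel) e0 e4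
      have l0 := fixl h2 (x := 0) (by decide +kernel) e1 e4
      have a4 := h2 4 5
      have a1 := h2 1 5
      have a0 := h2 0 5
      rw [l4] at a4; rw [l1] at a1; rw [l0] at a0
      rw [off3, ← a4, ← a1, ← a0]; decide +kernel)
    (fun ⟨q, hq⟩ => by
      obtain ⟨h1, h20, h21, h24, h25⟩ := ck5 q hq
      obtain ⟨e, h3, h4, h5⟩ := exK _ h1
      exact ⟨e, mem_stb.2 ⟨mem_stb.2 ⟨mem_stb.2 ⟨h4, by rw [h5, h20]⟩, by rw [h5, h21]⟩, by rw [h5, h24]⟩, h3, by rw [h5, h25]⟩)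
  have c : Fintype.card {q : Fin 21 // off3 q} = 9 := by decide +kernel
  rwa [c] at this

theorem gS_zv (y y' : Fin 24 → ℤ) (h : ∀ i, y (frf i) = y' i) : gS (toRat y) = toRat y' := by
  funext i
  rw [gS_apply, toRat, h]; rfl

theorem exS : ∃ e, KK e ∧ e ∈ HF ∧ e (dp 3) = dp 2 := by
  refine ⟨_, KK_of inG_S, ?_, ?_⟩
  · refine mem_stb.2 ⟨mem_stb.2 ⟨mem_stb.2 ⟨mem_stb.2 ⟨mem_stb.2 ⟨mem_stb.2 ⟨(KK_of inG_S).mem, ?_⟩, ?_⟩, ?_⟩, ?_⟩, ?_⟩, ?_⟩ <;>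
    exact Subtype.ext (gS_zv _ _ (by decide +kernel))
  · exact Subtype.ext (gS_zv _ _ (by decide +kernel))

theorem stage6 : Nat.card HF = 2 * Nat.card HG ∧ ((∀ g ∈ HG, KK g) → ∀ g ∈ HF, KK g) := by
  have := chain HF (dp 3) (fun b : Bool => if b then dp 3 else dp 2)
    (fun a b h => by
      cases a <;> cases b <;> first | rfl | (exfalso; simp at h; exact absurd (dp_inj h) (by decide)))
    (fun g hg => by
      obtain ⟨hE, f5⟩ := mem_stb.1 hg
      obtain ⟨hD, f4⟩ := mem_stb.1 hE
      obtain ⟨hC, f1⟩ := mem_stb.1 hD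
      obtain ⟨hB, f0⟩ := mem_stb.1 hC
      obtain ⟨π, l, hi, h1, h2⟩ := HB_pi hB
      have e0 : π 0 = 0 := dp_inj (by rw [← h1]; exact f0)
      have e1 : π 1 = 1 := dp_inj (by rw [← h1]; exact f1)
      have e4 : π 4 = 4 := dp_inj (by rw [← h1]; exact f4)
      have e5 : π 5 = 5 := dp_inj (by rw [← h1]; exact f5)
      have e20 : π 20 = 20 := meet h2 4 20 20 (by decide +kernel) e0 e1 e4 e5
      have l4 := fixl h2 (x := 4) (by decide +kernel) e0 e1
      have a3 := h2 4 3
      rw [l4] at a3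
      rw [h1]
      rcases line4 (π 3) (by rw [← a3]; decide +kernel) with h | h | h | h | h
      · exact absurd (hi (h.trans e0.symm)) (by decide)
      · exact absurd (hi (h.trans e1.symm)) (by decide)
      · exact ⟨false, by rw [h]; rfl⟩
      · exact ⟨true, by rw [h]; rfl⟩
      · exact absurd (hi (h.trans e20.symm)) (by decide))
    (fun b => by
      cases b
      · obtain ⟨e, h1, h2, h3⟩ := exS
        exact ⟨e, h2, h1, h3⟩
      · exact ⟨1, HF.one_mem, KK_one, rfl⟩)
  rwa [Fintype.card_bool] at this

theorem eq_one_of {g : EW} (hg : g ∈ HB) (h : ∀ p, g (dp p) = dp p) : g = 1 := by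
  have hA := (mem_stb.1 hg).1
  have hO := (mem_stb.1 hA).1
  have key : ∀ w x : ↥W22, (∀ p, inn w (dp p) = inn x (dp p)) → inn w t8w = inn x t8w → w = x := by
    have f1 : ∀ (w : ↥W22) y t, inn w (wv y t) = ((∑ i, (w : V24) (p21 i) * y i) + 3 * (w : V24) 23 * t) / 8 := by
      intro w y t
      obtain ⟨a, b⟩ := (mem_W22 _).1 w.2
      rw [inn, ratInner, sum24]
      simp only [wv_coe, toRat, zv_p21]
      rw [zv_last y t (i := 21) (by decide), zv_last y t (i := 22) (by decide), zv_last y t (i := 23) (by decide)]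
      rw [a, b]; ring
    intro w x h1 h2
    rw [t8w, f1, f1] at h2
    have e3 : (w : V24) 23 = (x : V24) 23 := by
      simp at h2; linarith
    have e : ∀ p, (w : V24) (p21 p) = (x : V24) (p21 p) := fun p => by
      have := h1 p
      rw [dp, f1, f1, e3] at this
      have f2 : ∀ (w : ↥W22), (∑ i, (w : V24) (p21 i) * ((Pi.single p 12 : Fin 21 → ℤ) i : ℚ)) = (w : V24) (p21 p) * 12 := by
        intro w
        rw [Finset.sum_eq_single p]
        · rw [Pi.single_eq_same]; norm_num
        · intro i _ h; rw [Pi.single_eq_of_ne h]; simp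
        · simp
      rw [f2, f2] at this
      linarith
    obtain ⟨a, b⟩ := (mem_W22 _).1 w.2
    obtain ⟨a', b'⟩ := (mem_W22 _).1 x.2
    apply Subtype.ext
    funext i
    rcases p21_cases i with ⟨j, rfl⟩ | hi
    · exact e j
    · have : i = 21 ∨ i = 22 ∨ i = 23 := by omega
      rcases this with rfl | rfl | rfl
      · rw [a, a', b, b', e3]
      · rw [b, b', e3]
      · exact e3
  ext w : 1
  refine key _ _ (fun p => ?_) (HA_inn hA w)
  conv_lhs => rw [← h p]
  exact inn_OL hO _ _

theorem HG_triv {g : EW} (hg : g ∈ HG) : g = 1 := by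
  obtain ⟨hF, f3⟩ := mem_stb.1 hg
  obtain ⟨hE, f5⟩ := mem_stb.1 hF
  obtain ⟨hD, f4⟩ := mem_stb.1 hE
  obtain ⟨hC, f1⟩ := mem_stb.1 hD
  obtain ⟨hB, f0⟩ := mem_stb.1 hC
  obtain ⟨π, l, hi, h1, h2⟩ := HB_pi hB
  have e0 : π 0 = 0 := dp_inj (by rw [← h1]; exact f0)
  have e1 : π 1 = 1 := dp_inj (by rw [← h1]; exact f1)
  have e4 : π 4 = 4 := dp_inj (by rw [← h1]; exact f4)
  have e5 : π 5 = 5 := dp_inj (by rw [← h1]; exact f5)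
  have e3 : π 3 = 3 := dp_inj (by rw [← h1]; exact f3)
  have e20 : π 20 = 20 := meet h2 4 20 20 (by decide +kernel) e0 e1 e4 e5
  have e16 : π 16 = 16 := meet h2 1 16 16 (by decide +kernel) e0 e4 e1 e5
  have e8 : π 8 = 8 := meet h2 1 19 8 (by decide +kernel) e0 e4 e3 e5
  have e17 : π 17 = 17 := meet h2 0 17 17 (by decide +kernel) e1 e4 e0 e5
  have e2 : π 2 = 2 := meet h2 4 15 2 (by decide +kernel) e0 e1 e8 e17
  have e12 : π 12 = 12 := meet h2 1 10 12 (by decide +kernel) e0 e4 e3 e17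
  have e14 : π 14 = 14 := meet h2 0 19 14 (by decide +kernel) e1 e4 e5 e8
  have e9 : π 9 = 9 := meet h2 14 16 9 (by decide +kernel) e0 e14 e1 e5
  have e7 : π 7 = 7 := meet h2 14 20 7 (by decide +kernel) e0 e14 e4 e5
  have e19 : π 19 = 19 := meet h2 14 18 19 (by decide +kernel) e0 e14 e5 e12
  have e11 : π 11 = 11 := meet h2 0 18 11 (by decide +kernel) e1 e4 e5 e12
  have e13 : π 13 = 13 := meet h2 11 16 13 (by decide +kernel) e0 e11 e1 e5
  have e18 : π 18 = 18 := meet h2 11 12 18 (by decide +kernel) e0 e11 e1 e12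
  have e6 : π 6 = 6 := meet h2 11 20 6 (by decide +kernel) e0 e11 e4 e5
  have e15 : π 15 = 15 := meet h2 8 17 15 (by decide +kernel) e1 e8 e0 e5
  have e10 : π 10 = 10 := meet h2 12 17 10 (by decide +kernel) e1 e12 e0 e5
  refine eq_one_of hB fun p => ?_
  rw [h1]
  congr 1
  fin_cases p <;> assumption

theorem card_OLam22 : Nat.card OLam22 = 2 * 6 * 9196830720 := by
  have h7 : Nat.card HG = 1 := by
    have : HG = ⊥ := (Subgroup.eq_bot_iff_forall _).2 fun g hg => HG_triv hg
    rw [this, Subgroup.card_bot]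
  rw [stage0.1, stage1.1, stage2.1, stage3.1, stage4.1, stage5.1, stage6.1, h7]

theorem KK_all {e : EW} (he : e ∈ OLam22) : KK e :=
  stage0.2 (stage1.2 (stage2.2 (stage3.2 (stage4.2 (stage5.2 (stage6.2 fun g hg => by
    rw [HG_triv hg]; exact KK_one)))))) e he

theorem res_surjective : Function.Surjective res := by
  rintro ⟨e, he⟩
  obtain ⟨k, hk, rfl⟩ := KK_all he
  exact ⟨⟨k, hk.circ⟩, rfl⟩

theorem inG_of_circ {k : V24 ≃ₗ[ℚ] V24} (hk : k ∈ circ222) : InG k := by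
  obtain ⟨k', hk', h⟩ := KK_all (resE_mem k hk)
  have : (⟨k, hk⟩ : circ222) = ⟨k', hk'.circ⟩ := res_injective (Subtype.ext h)
  have h2 : k = k' := congrArg Subtype.val this
  rw [h2]
  exact hk'

end

section

open Matrix

/-! ## Faithfulness of the operators `ta` -/


theorem FF_surj {f : Fun64} (hf : ∀ (c : K4) v, c ≠ 0 → f (c • v) = f v) : ∃ y ∈ W22, FF y = f := by
  refine ⟨fun i => if i.val < 21 then f (rep i) else -(f 0) / 3, ?_, ?_⟩
  · rw [mem_W22]; exact ⟨rfl, rfl⟩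
  · funext v
    by_cases hv : v = 0
    · rw [hv, FF_zero]
      show -((-(f 0) / 3) + (-(f 0) / 3) + (-(f 0) / 3)) = f 0
      ring
    · rw [FF_ne _ hv, if_pos (idx_lt v)]
      obtain ⟨c, hc, e⟩ := exists_smul_rep v hv
      conv_rhs => rw [e]
      rw [hf _ _ hc]

theorem FF_inv (x : V24) (c : K4) (v : V3) (hc : c ≠ 0) : FF x (c • v) = FF x v := by
  by_cases hv : v = 0
  · rw [hv, smul_zero]
  · rw [FF_ne _ hv, FF_ne _ (smul_ne_zero hc hv), idx_smul c hc]

theorem star_mul_self_K4 : ∀ c : K4, c ≠ 0 → star c * c = 1 := by decide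

theorem tau_inv {f : Fun64} (hf : ∀ (c : K4) v, c ≠ 0 → f (c • v) = f v) (a b : V3) (c : K4) (v : V3) (hc : c ≠ 0) :
    tau a b f (c • v) = tau a b f v := by
  have e := star_mul_self_K4 c hc
  have h := opD_tau (star c • (1 : Matrix (Fin 3) (Fin 3) K4)) (c • 1) (by
    rw [smul_mul_smul_comm, one_mul, mul_comm, e, one_smul]) a b f
  have h1 : opD (c • (1 : Matrix (Fin 3) (Fin 3) K4)) f = f := by
    funext v
    show f ((c • (1 : Matrix (Fin 3) (Fin 3) K4)) *ᵥ v) = f v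
    rw [smul_mulVec, one_mulVec, hf _ _ hc]
  have h2 := congrFun h v
  rw [h1] at h2
  have h3 : opD (c • (1 : Matrix (Fin 3) (Fin 3) K4)) (tau a b f) v = tau a b f (c • v) := by
    show tau a b f ((c • (1 : Matrix (Fin 3) (Fin 3) K4)) *ᵥ v) = _
    rw [smul_mulVec, one_mulVec]
  rw [← h3, h2, conjTranspose_smul, conjTranspose_one, smul_mulVec, smul_mulVec, one_mulVec, one_mulVec,
    tau_smul _ (by simpa using hc)]

theorem ta_FF (w : W6) (x : V24) : ∃ y ∈ W22, FF y = ta w (FF x) :=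
  FF_surj fun c v hc => tau_inv (fun c v hc => FF_inv x c v hc) _ _ c v hc

theorem tau_val (a b : V3) (f : Fun64) (v : V3) : tau a b f v = 1/2 * (K4.psi (hp a b) *
    (K4.chi (hp v b) * f (v + a) + K4.chi (hp v (K4.w • b)) * f (v + K4.w • a) + K4.chi (hp v (K4.z • b)) * f (v + K4.z • a))
      - f v) := by
  rw [tau_apply]
  have e1 : hp (K4.w • a) (K4.w • b) = hp a b := by
    rw [hp_smul_left, hp_smul_right, ← mul_assoc]
    have : K4.w * star K4.w = 1 := by decide
    rw [this, one_mul]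
  have e2 : hp (K4.z • a) (K4.z • b) = hp a b := by
    rw [hp_smul_left, hp_smul_right, ← mul_assoc]
    have : K4.z * star K4.z = 1 := by decide
    rw [this, one_mul]
  simp only [Pi.smul_apply, Pi.sub_apply, Pi.add_apply, smul_eq_mul, Ep_apply, e1, e2]
  ring

/-- basis functions -/
def ind (u v : V3) : ℚ := if ∃ c : K4, c ≠ 0 ∧ v = c • u then 1 else 0

theorem ind_inv (u : V3) (c : K4) (v : V3) (hc : c ≠ 0) : ind u (c • v) = ind u v := by
  unfold ind
  congr 1
  apply propext
  constructor
  · rintro ⟨d, hd, h⟩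
    refine ⟨c⁻¹ * d, mul_ne_zero (inv_ne_zero hc) hd, ?_⟩
    rw [mul_smul, ← h, smul_smul, inv_mul_cancel₀ hc, one_smul]
  · rintro ⟨d, hd, h⟩
    exact ⟨c * d, mul_ne_zero hc hd, by rw [h, smul_smul]⟩

theorem tau_zero (b : V3) (f : Fun64) (v : V3) : tau 0 b f v = if hp v b = 0 then f v else - f v := by
  rw [tau_val]
  have h0 : hp 0 b = 0 := by simp [hp]
  simp only [smul_zero, add_zero, h0, K4.psi_zero, hp_smul_right]
  have h : ∀ t : K4, K4.chi t + K4.chi (star K4.w * t) + K4.chi (star K4.z * t) = if t = 0 then 3 else -1 := by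
    intro t; cases t
    · show (1:ℚ) + 1 + 1 = _
      rw [if_pos (by decide)]; norm_num
    · show (1:ℚ) + (-1) + (-1) = _
      rw [if_neg (by decide)]; norm_num
    · show (-1:ℚ) + 1 + (-1) = _
      rw [if_neg (by decide)]; norm_num
    · show (-1:ℚ) + (-1) + 1 = _
      rw [if_neg (by decide)]; norm_num
  have := h (hp v b)
  split_ifs with c
  · rw [if_pos c] at this; linear_combination (1/2 * f v) * this
  · rw [if_neg c] at this; linear_combination (1/2 * f v) * this

def Inv4 (f : Fun64) : Prop := ∀ (c : K4) v, c ≠ 0 → f (c • v) = f v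

theorem ind_zero (v : V3) : ind 0 v = if v = 0 then 1 else 0 := by
  unfold ind
  congr 1
  apply propext
  constructor
  · rintro ⟨c, -, h⟩; rw [h, smul_zero]
  · rintro rfl; exact ⟨1, one_ne_zero, by rw [smul_zero]⟩

theorem ind_self (u : V3) : ind u u = 1 := if_pos ⟨1, one_ne_zero, by rw [one_smul]⟩

theorem add_self_V3 (a : V3) : a + a = 0 := by funext i; exact K4.add_self _

theorem add_w_V3 (a : V3) : a + K4.w • a = K4.z • a := by
  have : (1 : K4) + K4.w = K4.z := rfl
  rw [← this, add_smul, one_smul]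

theorem add_z_V3 (a : V3) : a + K4.z • a = K4.w • a := by
  have : (1 : K4) + K4.z = K4.w := rfl
  rw [← this, add_smul, one_smul]

theorem ind_add {a u : V3} (h : ∀ c : K4, u ≠ c • a) (c : K4) (hc : c ≠ 0) (ha : a ≠ 0) : ind u (u + c • a) = 0 := by
  apply if_neg
  rintro ⟨d, hd, e⟩
  have e1 : (d - 1) • u = c • a := by
    rw [sub_smul, one_smul, ← e, add_sub_cancel_left]
  by_cases h1 : d - 1 = 0
  · rw [h1, zero_smul] at e1
    exact smul_ne_zero hc ha e1.symm
  · apply h ((d-1)⁻¹ * c)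
    rw [mul_smul, ← e1, smul_smul, inv_mul_cancel₀ h1, one_smul]

theorem w_ne : K4.w ≠ 0 := by decide
theorem z_ne : K4.z ≠ 0 := by decide

theorem iso_cases : ∀ t : K4, t = star t → t = 0 ∨ t = 1 := by decide

theorem chi_iso (t : K4) (h : t = star t) : K4.chi t = 1 := by
  rcases iso_cases t h with rfl | rfl <;> rfl

theorem psi_inj_iso (t t' : K4) (h : t = star t) (h' : t' = star t') (e : K4.psi t = K4.psi t') : t = t' := by
  have h1 : K4.psi 1 = -1 := rfl
  have h0 : K4.psi 0 = 1 := rfl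
  rcases iso_cases t h with rfl | rfl <;> rcases iso_cases t' h' with rfl | rfl
  · rfl
  · rw [h1, h0] at e; norm_num at e
  · rw [h1, h0] at e; norm_num at e
  · rfl

theorem tau_d0 (a b : V3) (ha : a ≠ 0) (h : hp a b = star (hp a b)) (v : V3) (hv : v ≠ 0) :
    tau a b (ind 0) v = if ∃ c : K4, c ≠ 0 ∧ v = c • a then 1/2 * K4.psi (hp a b) else 0 := by
  have inv : Inv4 (ind 0) := fun c v hc => ind_inv 0 c v hc
  split_ifs with hc
  · obtain ⟨c, hc, rfl⟩ := hc
    rw [tau_inv inv _ _ _ _ hc, tau_val, add_self_V3, add_w_V3, add_z_V3, ind_zero, ind_zero, ind_zero, ind_zero, if_pos rfl,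
      if_neg (smul_ne_zero w_ne ha), if_neg (smul_ne_zero z_ne ha), if_neg ha, chi_iso _ h]
    ring
  · have key : ∀ c : K4, c ≠ 0 → v + c • a ≠ 0 := by
      intro c h0 e
      apply hc
      refine ⟨c, h0, ?_⟩
      calc v = v + (c • a + c • a) := by rw [add_self_V3, add_zero]
        _ = c • a := by rw [← add_assoc, e, zero_add]
    have k1 := key 1 one_ne_zero
    rw [one_smul] at k1
    rw [tau_val, ind_zero, ind_zero, ind_zero, ind_zero, if_neg k1, if_neg (key _ w_ne), if_neg (key _ z_ne), if_neg hv]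
    ring

theorem tau_d00 (a b : V3) (ha : a ≠ 0) : tau a b (ind 0) 0 = -1/2 := by
  rw [tau_val, zero_add, zero_add, zero_add, ind_zero, ind_zero, ind_zero, ind_zero, if_pos rfl,
      if_neg (smul_ne_zero w_ne ha), if_neg (smul_ne_zero z_ne ha), if_neg ha]
  ring

theorem tau_iu (a b u : V3) (ha : a ≠ 0) (h : hp a b = star (hp a b)) (hu : ∀ c : K4, u ≠ c • a) :
    tau a b (ind u) (u + a) = 1/2 * K4.psi (hp a b) * K4.chi (hp u b) := by
  have k1 := ind_add hu 1 one_ne_zero ha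
  rw [one_smul] at k1
  rw [tau_val, add_assoc u, add_assoc u, add_assoc u, add_self_V3, add_w_V3, add_z_V3, add_zero, ind_self,
    ind_add hu _ w_ne ha, ind_add hu _ z_ne ha, k1, hp_add_left, K4.chi_add, chi_iso _ h]
  ring

theorem chi_hp_eq (b b' : V3) (h : ∀ u, K4.chi (hp u b) = K4.chi (hp u b')) : b = b' := by
  have key : ∀ t t' : K4, (∀ c : K4, K4.chi (c * t) = K4.chi (c * t')) → t = t' := by
    have h1 : K4.chi K4.i ≠ K4.chi K4.w := by show (1:ℚ) ≠ -1; norm_num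
    intro t t' hh
    have a1 := hh 1; have a2 := hh K4.w
    cases t <;> cases t' <;> first | rfl | exact absurd a1 h1 | exact absurd a2 h1 | exact absurd a1.symm h1 | exact absurd a2.symm h1
  have : ∀ i, star (b i) = star (b' i) := by
    intro i
    apply key
    intro c
    have := h (Pi.single i c)
    simpa [hp] using this
  funext i
  exact star_injective (this i)

theorem tau_inj_same (a b b' : V3) (ha : a ≠ 0) (h : hp a b = star (hp a b)) (h' : hp a b' = star (hp a b'))
    (H : ∀ f, Inv4 f → tau a b f = tau a b' f) : b = b' := by
  have e0 : hp a b = hp a b' := by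
    apply psi_inj_iso _ _ h h'
    have := congrFun (H (ind 0) (fun c v hc => ind_inv 0 c v hc)) a
    rw [tau_d0 a b ha h _ ha, tau_d0 a b' ha h' _ ha, if_pos ⟨1, one_ne_zero, by rw [one_smul]⟩,
      if_pos ⟨1, one_ne_zero, by rw [one_smul]⟩] at this
    linarith
  apply chi_hp_eq
  intro u
  by_cases hu : ∃ c : K4, u = c • a
  · obtain ⟨c, rfl⟩ := hu
    rw [hp_smul_left, hp_smul_left, e0]
  · push Not at hu
    have := congrFun (H (ind u) (fun c v hc => ind_inv u c v hc)) (u + a)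
    rw [tau_iu a b u ha h hu, tau_iu a b' u ha h' hu, e0] at this
    have h2 := K4.psi_sq (hp a b')
    have h3 : K4.psi (hp a b') ≠ 0 := by
      intro h; rw [h] at h2; norm_num at h2
    have h4 : (1/2 * K4.psi (hp a b')) ≠ 0 := mul_ne_zero (by norm_num) h3
    exact mul_left_cancel₀ h4 this

theorem tau_inj_zero (b b' : V3) (hb : b ≠ 0) (hb' : b' ≠ 0)
    (H : ∀ f, Inv4 f → tau 0 b f = tau 0 b' f) : ∃ c : K4, c ≠ 0 ∧ b' = c • b := by
  have k : ∀ u, hp u b = 0 ↔ hp u b' = 0 := by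
    intro u
    have := congrFun (H (ind u) (fun c v hc => ind_inv u c v hc)) u
    rw [tau_zero, tau_zero, ind_self] at this
    split_ifs at this with h1 h2 h2
    · exact ⟨fun _ => h2, fun _ => h1⟩
    · norm_num at this
    · norm_num at this
    · exact ⟨fun h => absurd h h1, fun h => absurd h h2⟩
  obtain ⟨c, hc, e⟩ := exists_smul_rep b hb
  obtain ⟨c', hc', e'⟩ := exists_smul_rep b' hb'
  have hi : (⟨idx b, idx_lt b⟩ : Fin 21) = ⟨idx b', idx_lt b'⟩ := by
    apply line_inj
    intro i
    rw [Bool.eq_iff_iff, lineB_iff, lineB_iff]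
    have := k (rep (p21 i))
    rw [e, e', hp_smul_right, hp_smul_right, mul_eq_zero, mul_eq_zero] at this
    have h1 : star c ≠ 0 := star_ne_zero.mpr hc
    have h2 : star c' ≠ 0 := star_ne_zero.mpr hc'
    rw [or_iff_right h1, or_iff_right h2] at this
    exact this
  have hj : idx b = idx b' := by
    have := congrArg Fin.val hi
    exact Fin.ext this
  refine ⟨c' * c⁻¹, mul_ne_zero hc' (inv_ne_zero hc), ?_⟩
  conv_rhs => rw [e]
  rw [smul_smul, mul_assoc, inv_mul_cancel₀ hc, mul_one, hj]
  exact e'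

theorem W6_ext {w w' : W6} (h1 : wa w = wa w') (h2 : wb w = wb w') : w = w' := by
  funext i
  rcases i with i | i
  · exact congrFun h1 i
  · exact congrFun h2 i

theorem ta_inj_aux (w w' : W6) (hw : w ≠ 0) (hw' : w' ≠ 0) (h : Iso6 w) (h' : Iso6 w')
    (H : ∀ f, Inv4 f → ta w f = ta w' f) : ∃ c : K4, c ≠ 0 ∧ w' = c • w := by
  have inv : Inv4 (ind 0) := fun c v hc => ind_inv 0 c v hc
  have z0 : ∀ b, tau 0 b (ind 0) 0 = 1 := by
    intro b
    have : hp 0 b = 0 := by simp [hp]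
    rw [tau_zero, if_pos this, ind_self]
  have H0 : tau (wa w) (wb w) (ind 0) = tau (wa w') (wb w') (ind 0) := H _ inv
  by_cases ha : wa w = 0
  · have ha' : wa w' = 0 := by
      by_contra hn
      have := congrFun H0 0
      rw [ha, z0, tau_d00 _ _ hn] at this
      norm_num at this
    have hb : wb w ≠ 0 := fun hb => hw (W6_ext ha hb)
    have hb' : wb w' ≠ 0 := fun hb => hw' (W6_ext ha' hb)
    obtain ⟨c, hc, e⟩ := tau_inj_zero (wb w) (wb w') hb hb' (by
      intro f hf
      have := H f hf
      unfold ta at this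
      rwa [ha, ha'] at this)
    refine ⟨c, hc, W6_ext ?_ e⟩
    have : wa (c • w) = c • wa w := rfl
    rw [this, ha, ha', smul_zero]
  · have ha' : wa w' ≠ 0 := by
      intro hn
      have := congrFun H0 0
      rw [hn, z0, tau_d00 _ _ ha] at this
      norm_num at this
    have := congrFun H0 (wa w')
    rw [tau_d0 _ _ ha h _ ha', tau_d0 _ _ ha' h' _ ha', if_pos (⟨1, one_ne_zero, by rw [one_smul]⟩ : ∃ c : K4, c ≠ 0 ∧ wa w' = c • wa w')] at this
    split_ifs at this with hc
    · obtain ⟨c, hc, e⟩ := hc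
      refine ⟨c, hc, W6_ext e ?_⟩
      have hh : hp (wa w') (c • wb w) = hp (wa w) (wb w) := by
        rw [e, hp_smul_left, hp_smul_right, ← mul_assoc, mul_comm c, star_mul_self_K4 c hc, one_mul]
      symm
      apply tau_inj_same (wa w') (c • wb w) (wb w') ha' (by rw [hh]; exact h) h'
      intro f hf
      have e2 : tau (wa w') (c • wb w) = ta w := by
        rw [e, tau_smul c hc]; rfl
      rw [e2]
      exact H f hf
    · exfalso
      have h2 := K4.psi_sq (hp (wa w') (wb w'))
      have h3 : K4.psi (hp (wa w') (wb w')) = 0 := by linarith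
      rw [h3] at h2; norm_num at h2

theorem ta_inj (w w' : W6) (hw : w ≠ 0) (hw' : w' ≠ 0) (h : Iso6 w) (h' : Iso6 w')
    (H : ∀ x ∈ W22, ta w (FF x) = ta w' (FF x)) : ∃ c : K4, c ≠ 0 ∧ w' = c • w := by
  apply ta_inj_aux w w' hw hw' h h'
  intro f hf
  obtain ⟨y, hy, e⟩ := FF_surj hf
  rw [← e]
  exact H y hy

end

section

open Matrix

/-! ## Isometries commuting with all the operators `ta` are scalars -/


theorem FF_W22_inj {x y : ↥W22} (h : FF (x : V24) = FF (y : V24)) : x = y := by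
  apply Subtype.ext
  have hx := (mem_W22 _).1 x.2
  have hy := (mem_W22 _).1 y.2
  have h0 := congrFun h 0
  rw [FF_zero, FF_zero] at h0
  funext i
  rcases p21_cases i with ⟨j, rfl⟩ | hi
  · have := congrFun h (rep (p21 j))
    rw [FF_ne _ (rep_ne _ (p21_lt j)), FF_ne _ (rep_ne _ (p21_lt j)), idx_rep _ (p21_lt j)] at this
    exact this
  · have hi' : i = 21 ∨ i = 22 ∨ i = 23 := by
      have := i.isLt
      rcases (by omega : i.val = 21 ∨ i.val = 22 ∨ i.val = 23) with h | h | h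
      · left; exact Fin.ext h
      · right; left; exact Fin.ext h
      · right; right; exact Fin.ext h
    obtain ⟨x1, x2⟩ := hx
    obtain ⟨y1, y2⟩ := hy
    rcases hi' with rfl | rfl | rfl <;> linarith

theorem FF_surj' (f : Fun64) (hf : Inv4 f) : ∃ y : ↥W22, FF (y : V24) = f := by
  obtain ⟨y, hy, e⟩ := FF_surj hf
  exact ⟨⟨y, hy⟩, e⟩

def mkW (a b : V3) : W6 := Sum.elim a b

theorem tau_a0 (a : V3) (ha : a ≠ 0) : tau a 0 (ind 0) = (1/2 : ℚ) • (ind a - ind 0) := by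
  funext v
  have h0 : ∀ u : V3, hp u 0 = 0 := fun u => by simp [hp]
  have iso : hp a 0 = star (hp a 0) := by rw [h0, star_zero]
  show _ = 1/2 * (ind a v - ind 0 v)
  by_cases hv : v = 0
  · subst hv
    have : ind a 0 = 0 := by
      apply if_neg
      rintro ⟨c, hc, e⟩
      exact smul_ne_zero hc ha e.symm
    rw [tau_d00 _ _ ha, ind_self, this]; norm_num
  · rw [tau_d0 _ _ ha iso _ hv, ind_zero, if_neg hv, h0, K4.psi_zero]
    unfold ind
    split_ifs <;> ring

theorem ind_rep (j : Fin 21) (v : V3) (hv : v ≠ 0) : ind (rep (p21 j)) v = if idx v = p21 j then 1 else 0 := by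
  unfold ind
  congr 1
  apply propext
  constructor
  · rintro ⟨c, hc, e⟩
    rw [e, idx_smul c hc, idx_rep _ (p21_lt j)]
  · intro h
    obtain ⟨c, hc, e⟩ := exists_smul_rep v hv
    rw [h] at e
    exact ⟨c, hc, e⟩

theorem scalar_of_comm (e : EW)
    (H : ∀ w, Iso6 w → ∀ x y : ↥W22, FF (y : V24) = ta w (FF (x : V24)) →
      FF (e y : V24) = ta w (FF (e x : V24))) : ∃ s : ℚ, ∀ x : ↥W22, e x = s • x := by
  obtain ⟨x0, h0⟩ := FF_surj' (ind 0) (fun c v hc => ind_inv 0 c v hc)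
  have hz : ∀ u : V3, hp 0 u = 0 := fun u => by simp [hp]
  have hz' : ∀ u : V3, hp u 0 = 0 := fun u => by simp [hp]
  have k1 : FF (e x0 : V24) = (FF (e x0 : V24) 0) • ind 0 := by
    funext v
    show _ = _ * ind 0 v
    rw [ind_zero]
    by_cases hv : v = 0
    · rw [if_pos hv, hv, mul_one]
    · rw [if_neg hv, mul_zero]
      obtain ⟨i, hi⟩ := Function.ne_iff.1 hv
      have hb : hp v (Pi.single i 1) ≠ 0 := by
        have e2 : star (Pi.single i (1:K4)) = (Pi.single i 1 : V3) := by
          rw [← Pi.single_star, star_one]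
        unfold hp
        rw [e2, dotProduct_single, mul_one]
        exact hi
      have e3 : FF (x0 : V24) = ta (mkW 0 (Pi.single i 1)) (FF (x0 : V24)) := by
        funext u
        show _ = tau 0 (Pi.single i 1) (FF (x0:V24)) u
        rw [tau_zero]
        split_ifs with c
        · rfl
        · rw [h0, ind_zero, if_neg, neg_zero]
          rintro rfl
          exact c (hz _)
      have e4 := congrFun (H (mkW 0 (Pi.single i 1)) (by
        show hp 0 _ = star (hp 0 _)
        rw [hz, star_zero]) x0 x0 e3) v
      have e5 : ta (mkW 0 (Pi.single i 1)) (FF (e x0 : V24)) v = tau 0 (Pi.single i 1) (FF (e x0 : V24)) v := rfl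
      rw [e5, tau_zero, if_neg hb] at e4
      linarith
  obtain ⟨s, hs⟩ : ∃ s, s = FF (e x0 : V24) 0 := ⟨_, rfl⟩
  rw [← hs] at k1
  refine ⟨s, ?_⟩
  have k2 : e x0 = s • x0 := by
    apply FF_W22_inj
    rw [k1, ← h0]
    exact (FF.map_smul s (x0 : V24)).symm
  have k3 : ∀ a : V3, a ≠ 0 → ∀ x : ↥W22, FF (x : V24) = ind a → e x = s • x := by
    intro a ha x hx
    have := H (mkW a 0) (by
      show hp a 0 = star (hp a 0)
      rw [hz', star_zero]) x0 ((1/2 : ℚ) • (x - x0)) (by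
      have e1 : FF (((1/2 : ℚ) • (x - x0) : ↥W22) : V24) = (1/2 : ℚ) • (FF (x : V24) - FF (x0 : V24)) := by
        rw [← FF.map_sub, ← FF.map_smul]; rfl
      rw [e1, hx, h0]
      exact (tau_a0 a ha).symm)
    have e2 : ta (mkW a 0) (FF (e x0 : V24)) = FF ((s • ((1/2 : ℚ) • (x - x0)) : ↥W22) : V24) := by
      show tau a 0 _ = _
      rw [k1, LinearMap.map_smul, tau_a0 a ha, ← hx, ← h0, ← FF.map_sub, ← FF.map_smul, ← FF.map_smul]; rfl
    rw [e2] at this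
    have e3 := FF_W22_inj this
    rw [map_smul, map_sub, k2, smul_comm, smul_sub s] at e3
    have e4 := smul_right_injective _ (by norm_num : (1/2 : ℚ) ≠ 0) e3
    exact sub_left_injective e4
  have hc : ∀ j : Fin 21, ∃ y : ↥W22, FF (y : V24) = ind (rep (p21 j)) := fun j =>
    FF_surj' _ (fun c v hc => ind_inv _ c v hc)
  choose X hX using hc
  intro x
  have hx : x = (FF (x : V24) 0) • x0 + ∑ j, ((x : V24) (p21 j)) • X j := by
    apply FF_W22_inj
    have e1 : FF (((FF (x : V24) 0) • x0 + ∑ j, ((x : V24) (p21 j)) • X j : ↥W22) : V24)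
        = (FF (x : V24) 0) • ind 0 + ∑ j, ((x : V24) (p21 j)) • ind (rep (p21 j)) := by
      simp only [Submodule.coe_add, Submodule.coe_smul, Submodule.coe_sum, map_add, map_smul, map_sum, h0, hX]
    rw [e1]
    funext v
    rw [Pi.add_apply, Finset.sum_apply]
    simp only [Pi.smul_apply, smul_eq_mul]
    by_cases hv : v = 0
    · subst hv
      rw [ind_self, mul_one, Finset.sum_eq_zero, add_zero]
      intro j _
      have : ind (rep (p21 j)) 0 = 0 := by
        apply if_neg
        rintro ⟨c, hc, e⟩
        exact smul_ne_zero hc (rep_ne _ (p21_lt j)) e.symm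
      rw [this, mul_zero]
    · rw [ind_zero, if_neg hv, mul_zero, zero_add, FF_ne _ hv]
      obtain ⟨j, hj⟩ : ∃ j, idx v = p21 j := ⟨⟨(idx v).val, idx_lt v⟩, rfl⟩
      rw [Finset.sum_eq_single j]
      · rw [ind_rep j v hv, if_pos hj, mul_one, hj]
      · intro b _ hb
        rw [ind_rep b v hv, if_neg, mul_zero]
        intro h
        exact hb (p21_inj (h.symm.trans hj))
      · intro h; exact absurd (Finset.mem_univ _) h
  rw [hx, map_add, map_smul, map_sum, k2, smul_add, Finset.smul_sum, smul_comm]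
  congr 1
  refine Finset.sum_congr rfl fun j _ => ?_
  rw [map_smul, k3 _ (rep_ne _ (p21_lt j)) _ (hX j), smul_comm]

theorem pm_of_scalar {e : EW} (he : e ∈ OLam22) (s : ℚ) (h : ∀ x : ↥W22, e x = s • x) :
    (∀ x : ↥W22, e x = x) ∨ (∀ x : ↥W22, e x = -x) := by
  obtain ⟨x0, h0⟩ := FF_surj' (ind 0) (fun c v hc => ind_inv 0 c v hc)
  have hn : ratInner (x0 : V24) (x0 : V24) ≠ 0 := by
    unfold ratInner
    intro hh
    have h1 : ∑ i, (x0 : V24) i * (x0 : V24) i = 0 := by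
      rcases div_eq_zero_iff.1 hh with h | h
      · exact h
      · norm_num at h
    have h2 := (Finset.sum_eq_zero_iff_of_nonneg (fun i _ => mul_self_nonneg _)).1 h1
    have h3 : (x0 : V24) = 0 := by
      funext i; exact mul_self_eq_zero.1 (h2 i (Finset.mem_univ i))
    have h4 := congrFun h0 0
    rw [h3, map_zero, ind_self] at h4
    exact zero_ne_one h4
  have h1 := he.1 x0 x0
  rw [h] at h1
  have h2 : ratInner ((s • x0 : ↥W22) : V24) ((s • x0 : ↥W22) : V24) = s * s * ratInner (x0 : V24) (x0 : V24) := by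
    unfold ratInner
    rw [mul_div_assoc', Finset.mul_sum]
    congr 1
    refine Finset.sum_congr rfl fun i _ => ?_
    show (s * _) * (s * _) = _
    ring
  rw [h2] at h1
  have h3 : s * s = 1 := mul_right_cancel₀ hn (by rw [h1, one_mul])
  rcases mul_self_eq_one_iff.1 h3 with rfl | rfl
  · left; intro x; rw [h, one_smul]
  · right; intro x; rw [h]; exact neg_one_smul ℚ x

end

section

open Matrix

/-! ## The bridge between the two hermitian forms -/


theorem card_F4 : Fintype.card F4 = 4 := by
  rw [← Nat.card_eq_fintype_card, GaloisField.card 2 2 (by norm_num)]; norm_num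

noncomputable def io : F4 ≃+* K4 := FiniteField.ringEquivOfCardEq (card_F4.trans K4.card_K4.symm)

theorem star_F4 (x : F4) : star x = x ^ 2 := rfl

theorem io_star (x : F4) : io (star x) = star (io x) := by
  rw [star_F4, K4.star_eq_sq, map_pow]

theorem io_symm_star (x : K4) : io.symm (star x) = star (io.symm x) := by
  rw [star_F4, K4.star_eq_sq, map_pow]

abbrev V6 : Type := Fin 6 → F4
abbrev G6 : Type := Matrix (Fin 6) (Fin 6) F4
abbrev G6K : Type := Matrix (Fin 6) (Fin 6) K4

def Pm : Matrix (Fin 6) (Fin 3 ⊕ Fin 3) K4 := fun i => Sum.elim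
  (fun j => if i.val / 2 = j.val then K4.i else K4.o)
  (fun j => if i.val / 2 = j.val then (if i.val % 2 = 0 then K4.w else K4.z) else K4.o)

def Pn : Matrix (Fin 3 ⊕ Fin 3) (Fin 6) K4 := JJ * Pmᴴ

theorem JJ_sq : JJ * JJ = 1 := by
  unfold JJ; rw [fromBlocks_multiply]; simp

theorem Pm_apply (w : W6) : Pm *ᵥ w = ![wa w 0 + K4.w * wb w 0, wa w 0 + K4.z * wb w 0,
    wa w 1 + K4.w * wb w 1, wa w 1 + K4.z * wb w 1, wa w 2 + K4.w * wb w 2, wa w 2 + K4.z * wb w 2] := by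
  funext i
  have : ∀ i, (Pm *ᵥ w) i = ∑ j, Pm i (Sum.inl j) * wa w j + ∑ j, Pm i (Sum.inr j) * wb w j := by
    intro i
    show ∑ k, Pm i k * w k = _
    rw [Fintype.sum_sum_type]; rfl
  have o : ∀ t : K4, K4.o * t = 0 := fun t => zero_mul t
  have l : ∀ t : K4, K4.i * t = t := fun t => one_mul t
  rw [this, Fin.sum_univ_three, Fin.sum_univ_three]
  fin_cases i <;> simp [Pm, o, l]

theorem Pm_gram : Pmᴴ * Pm = JJ := by
  have : ∀ i j, (∑ k, star (Pm k i) * Pm k j) = if i = j.swap then K4.i else K4.o := by decide +kernel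
  ext i j
  have h := this i j
  rw [mul_apply]
  simp only [conjTranspose_apply]
  rw [h]
  have hi : K4.i = 1 := rfl
  have ho : K4.o = 0 := rfl
  rcases i with i | i <;> rcases j with j | j <;> simp [JJ, one_apply, hi, ho]

theorem Pn_Pm : Pn * Pm = 1 := by
  rw [Pn, Matrix.mul_assoc, Pm_gram, JJ_sq]

theorem Pm_Pn : Pm * Pn = 1 := (mul_eq_one_comm_of_equiv (finSumFinEquiv : Fin 3 ⊕ Fin 3 ≃ Fin 6)).1 Pn_Pm

noncomputable def Th (w : W6) : V6 := fun i => io.symm ((Pm *ᵥ w) i)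
noncomputable def Ti (x : V6) : W6 := Pn *ᵥ (fun i => io (x i))

theorem Th_Ti (x : V6) : Th (Ti x) = x := by
  funext i
  unfold Th Ti
  rw [mulVec_mulVec, Pm_Pn, one_mulVec, RingEquiv.symm_apply_apply]

theorem Ti_Th (w : W6) : Ti (Th w) = w := by
  unfold Th Ti
  simp only [RingEquiv.apply_symm_apply]
  rw [mulVec_mulVec, Pn_Pm, one_mulVec]

theorem Th_smul (c : K4) (w : W6) : Th (c • w) = io.symm c • Th w := by
  funext i
  unfold Th
  rw [mulVec_smul]
  exact map_mul io.symm _ _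

theorem Ti_smul (c : F4) (x : V6) : Ti (c • x) = io c • Ti x := by
  unfold Ti
  rw [← mulVec_smul]
  congr 1
  funext i
  exact map_mul io _ _

theorem Th_zero : Th 0 = 0 := by
  funext i; unfold Th; rw [mulVec_zero]; exact map_zero io.symm
theorem Ti_zero : Ti 0 = 0 := by rw [← Th_zero, Ti_Th]
theorem Th_inj {w w' : W6} (h : Th w = Th w') : w = w' := by rw [← Ti_Th w, h, Ti_Th]

theorem cube_K4 : ∀ a b : K4, (a + K4.w * b) ^ 3 + (a + K4.z * b) ^ 3 = a * star b + star (a * star b) := by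
  decide +kernel

theorem Iso6_iff (w : W6) : Iso6 w ↔ ∑ i, Th w i ^ 3 = 0 := by
  have h1 : ∑ i, Th w i ^ 3 = io.symm (hp (wa w) (wb w) + star (hp (wa w) (wb w))) := by
    have : ∑ i, Th w i ^ 3 = io.symm (∑ i, (Pm *ᵥ w) i ^ 3) := by
      rw [map_sum]; simp only [map_pow]; rfl
    rw [this, Pm_apply]
    congr 1
    have e : hp (wa w) (wb w) + star (hp (wa w) (wb w)) =
      (wa w 0 * star (wb w 0) + star (wa w 0 * star (wb w 0))) + (wa w 1 * star (wb w 1) + star (wa w 1 * star (wb w 1)))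
       + (wa w 2 * star (wb w 2) + star (wa w 2 * star (wb w 2))) := by
      rw [hp_three, star_add, star_add]; ring
    rw [e, ← cube_K4, ← cube_K4, ← cube_K4]
    simp only [Fin.sum_univ_six, cons_val]
    ring
  rw [h1, map_eq_zero_iff _ io.symm.injective, Iso6]
  constructor
  · intro h; rw [← h, K4.add_self]
  · intro h; rw [← sub_eq_zero, K4.sub_eq]; exact h

/-! ### matrices -/

noncomputable def toN (g : G6) : M6 := Pn * (g.map io) * Pm
noncomputable def toG (N : M6) : G6 := (Pm * N * Pn).map io.symm

theorem map_io_map (M : G6K) : (M.map io.symm).map io = M := by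
  ext i j; simp

theorem Pm_toN (g : G6) : Pm * toN g = g.map io * Pm := by
  rw [toN, ← Matrix.mul_assoc, ← Matrix.mul_assoc, Pm_Pn, Matrix.one_mul]

theorem Th_toN (g : G6) (w : W6) : Th (toN g *ᵥ w) = g *ᵥ Th w := by
  funext i
  unfold Th
  rw [mulVec_mulVec, Pm_toN, ← mulVec_mulVec]
  simp only [mulVec, dotProduct, map_sum, map_mul, map_apply, RingEquiv.symm_apply_apply]

theorem toN_toG (N : M6) : toN (toG N) = N := by
  rw [toN, toG, map_io_map, ← Matrix.mul_assoc, ← Matrix.mul_assoc, Pn_Pm, Matrix.one_mul, Matrix.mul_assoc, Pn_Pm, Matrix.mul_one]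

theorem map_io_ct (g : G6) : (gᴴ).map io = (g.map io)ᴴ := by
  ext i j; simp [io_star]

theorem UU_toN {g : G6} (hg : gᴴ * g = 1) : UU (toN g) := by
  unfold UU
  have h : (g.map io)ᴴ * (g.map io) = 1 := by
    rw [← map_io_ct, ← Matrix.map_mul, hg, Matrix.map_one _ (map_zero io) (map_one io)]
  rw [← Pm_gram, ← Matrix.mul_assoc, ← conjTranspose_mul, Matrix.mul_assoc, Pm_toN, conjTranspose_mul,
    Matrix.mul_assoc, ← Matrix.mul_assoc (g.map io)ᴴ, h, Matrix.one_mul]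

theorem toG_unitary {N : M6} (h : UU N) : (toG N)ᴴ * toG N = 1 := by
  have h1 : ((toG N).map io)ᴴ * (toG N).map io = 1 := by
    rw [toG, map_io_map, conjTranspose_mul, conjTranspose_mul]
    unfold UU at h
    have e : Pnᴴ * (Nᴴ * Pmᴴ) * (Pm * N * Pn) = Pnᴴ * (Nᴴ * (Pmᴴ * Pm) * N) * Pn := by
      simp only [Matrix.mul_assoc]
    rw [e, Pm_gram, h, ← Pm_gram, ← Matrix.mul_assoc, Matrix.mul_assoc, Pm_Pn, Matrix.mul_one, ← conjTranspose_mul, Pm_Pn,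
      conjTranspose_one]
  rw [← map_io_ct, ← Matrix.map_mul] at h1
  ext i j
  have h2 := congrFun (congrFun h1 i) j
  apply io.injective
  rw [map_apply] at h2
  rw [h2, one_apply, one_apply]
  split_ifs
  · exact (map_one io).symm
  · exact (map_zero io).symm

theorem det_toN (g : G6) : (toN g).det = io g.det := by
  have h : (g.map io).det = io g.det := (RingHom.map_det io.toRingHom g).symm
  rw [toN, ← h]
  exact det_conj_of_mul_eq_one Pn_Pm Pm_Pn

/-! ### Frobenius -/

def matC : M6 := fromBlocks 1 1 0 1

theorem UU_matC : UU matC := by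
  rw [matC, UU_blocks]
  simp
  ext i j
  exact K4.add_self _

theorem matC_sq : matC * matC = 1 := by
  have h : (1 + 1 : M3) = 0 := by ext i j; exact K4.add_self _
  rw [matC, fromBlocks_multiply]
  simp [h]

theorem frob_K4 : ∀ a b : K4, (a + K4.w * b) ^ 2 = (star a + star b) + K4.w * star b ∧
    (a + K4.z * b) ^ 2 = (star a + star b) + K4.z * star b := by decide +kernel

theorem Th_frob (w : W6) : Th (matC *ᵥ star w) = fun i => Th w i ^ 2 := by
  funext i
  unfold Th
  rw [← map_pow]
  congr 1
  have ha : wa (matC *ᵥ star w) = star (wa w) + star (wb w) := by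
    funext j
    show (matC *ᵥ star w) (Sum.inl j) = _
    rw [matC, fromBlocks_mulVec]
    simp; rfl
  have hb : wb (matC *ᵥ star w) = star (wb w) := by
    funext j
    show (matC *ᵥ star w) (Sum.inr j) = _
    rw [matC, fromBlocks_mulVec]
    simp; rfl
  rw [Pm_apply, Pm_apply, ha, hb]
  fin_cases i
  · exact (frob_K4 _ _).1.symm
  · exact (frob_K4 _ _).2.symm
  · exact (frob_K4 _ _).1.symm
  · exact (frob_K4 _ _).2.symm
  · exact (frob_K4 _ _).1.symm
  · exact (frob_K4 _ _).2.symm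

end

section

open Matrix

/-! ## The map from `O(Λ₂₂)` to permutations of the Fermat points -/


def on (p : FermatPoint) (w : W6) : Prop := w ≠ 0 ∧ Th w ∈ p.val

theorem on_iso {p : FermatPoint} {w : W6} (h : on p w) : Iso6 w := (Iso6_iff w).2 (p.2.2 _ h.2)

theorem on_smul {p : FermatPoint} {w : W6} (h : on p w) (c : K4) (hc : c ≠ 0) : on p (c • w) :=
  ⟨smul_ne_zero hc h.1, by rw [Th_smul]; exact p.val.smul_mem _ h.2⟩

theorem Th_ne {w : W6} (h : w ≠ 0) : Th w ≠ 0 := fun e => h (Th_inj (e.trans Th_zero.symm))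

/-- everything on the point is a multiple -/
theorem on_mem {p : FermatPoint} {w : W6} (h : on p w) {x : V6} (hx : x ∈ p.val) : ∃ c : K4, x = Th (c • w) := by
  have h1 := (finrank_eq_one_iff_of_nonzero' (⟨Th w, h.2⟩ : p.val) (by
    intro e; exact Th_ne h.1 (congrArg Subtype.val e))).1 p.2.1 ⟨x, hx⟩
  obtain ⟨c, hc⟩ := h1
  refine ⟨io c, ?_⟩
  rw [Th_smul, RingEquiv.symm_apply_apply]
  exact (congrArg Subtype.val hc).symm

theorem on_on {p : FermatPoint} {w w' : W6} (h : on p w) (h' : on p w') : ∃ c : K4, c ≠ 0 ∧ w' = c • w := by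
  obtain ⟨c, hc⟩ := on_mem h h'.2
  have e := Th_inj hc
  refine ⟨c, ?_, e⟩
  rintro rfl
  exact h'.1 (by rw [e, zero_smul])

theorem on_exists (p : FermatPoint) : ∃ w, on p w := by
  obtain ⟨v, hv, -⟩ := finrank_eq_one_iff'.1 p.2.1
  refine ⟨Ti v.val, ?_, ?_⟩
  · intro e
    apply hv
    apply Subtype.ext
    have := Th_Ti v.val
    rw [e, Th_zero] at this
    exact this.symm
  · rw [Th_Ti]; exact v.2

theorem on_eq {p q : FermatPoint} {w : W6} (h : on p w) (h' : on q w) : p = q := by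
  apply Subtype.ext
  apply le_antisymm
  · intro x hx
    obtain ⟨c, rfl⟩ := on_mem h hx
    rw [Th_smul]; exact q.val.smul_mem _ h'.2
  · intro x hx
    obtain ⟨c, rfl⟩ := on_mem h' hx
    rw [Th_smul]; exact p.val.smul_mem _ h.2

theorem pt_exists (w : W6) (hw : w ≠ 0) (h : Iso6 w) : ∃ p, on p w := by
  refine ⟨⟨F4 ∙ (Th w), finrank_span_singleton (Th_ne hw), ?_⟩, hw, Submodule.mem_span_singleton_self _⟩
  intro x hx
  obtain ⟨c, rfl⟩ := Submodule.mem_span_singleton.1 hx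
  simp only [Pi.smul_apply, smul_eq_mul, mul_pow]
  rw [← Finset.mul_sum, (Iso6_iff w).1 h, mul_zero]

instance : Finite FermatPoint := Subtype.finite

def IndP (φ : W6 → W6) (π : Equiv.Perm FermatPoint) : Prop := ∀ p w, on p w → on (π p) (φ w)

theorem IndP.mul {φ φ' : W6 → W6} {π π' : Equiv.Perm FermatPoint} (h : IndP φ π) (h' : IndP φ' π') :
    IndP (φ ∘ φ') (π * π') := fun p w hw => h _ _ (h' p w hw)

theorem perm_exists (φ : W6 → W6) (inj : Function.Injective φ) (h0 : φ 0 = 0) (iso : ∀ w, Iso6 w → Iso6 (φ w))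
    (l1 : ∀ (c : K4) w, ∃ c' : K4, φ (c • w) = c' • φ w) (l2 : ∀ (c : K4) w, ∃ c' : K4, c • φ w = φ (c' • w)) :
    ∃ π, IndP φ π := by
  choose r hr using on_exists
  have hne : ∀ w, w ≠ 0 → φ w ≠ 0 := fun w hw e => hw (inj (e.trans h0.symm))
  choose t ht using fun p => pt_exists (φ (r p)) (hne _ (hr p).1) (iso _ (on_iso (hr p)))
  have ti : Function.Injective t := by
    intro p q e
    have h1 := ht p
    have h2 := ht q
    rw [e] at h1
    obtain ⟨c, hc, e2⟩ := on_on h1 h2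
    obtain ⟨c', e3⟩ := l2 c (r p)
    have e4 := inj (e2.trans e3)
    have hc' : c' ≠ 0 := by
      rintro rfl
      exact (hr q).1 (by rw [e4, zero_smul])
    have := on_smul (hr p) c' hc'
    rw [← e4] at this
    exact on_eq this (hr q)
  refine ⟨Equiv.ofBijective t (Finite.injective_iff_bijective.1 ti), ?_⟩
  intro p w hw
  obtain ⟨c, hc, e⟩ := on_on (hr p) hw
  obtain ⟨c', e2⟩ := l1 c (r p)
  refine ⟨hne _ hw.1, ?_⟩
  show Th (φ w) ∈ (t p).val
  rw [e, e2, Th_smul]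
  exact (t p).val.smul_mem _ (ht p).2

theorem IndP.image {φ : W6 → W6} {π : Equiv.Perm FermatPoint} (h : IndP φ π) (h0 : φ 0 = 0)
    (l2 : ∀ (c : K4) w, ∃ c' : K4, c • φ w = φ (c' • w)) (T : V6 → V6) (hT : ∀ w, Th (φ w) = T (Th w)) (p : FermatPoint) :
    ((π p).val : Set V6) = T '' (p.val : Set V6) := by
  obtain ⟨w, hw⟩ := on_exists p
  ext x
  constructor
  · intro hx
    obtain ⟨c, rfl⟩ := on_mem (h p w hw) hx
    obtain ⟨c', e⟩ := l2 c w
    refine ⟨Th (c' • w), ?_, by rw [e, hT]⟩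
    rw [Th_smul]; exact p.val.smul_mem _ hw.2
  · rintro ⟨y, hy, rfl⟩
    rw [← Th_Ti y, ← hT]
    by_cases hz : Ti y = 0
    · rw [hz, h0, Th_zero]; exact (π p).val.zero_mem
    · exact (h p (Ti y) ⟨hz, by rw [Th_Ti]; exact hy⟩).2

theorem IndP.of_image {φ : W6 → W6} {π : Equiv.Perm FermatPoint} (hne : ∀ w, w ≠ 0 → φ w ≠ 0)
    (T : V6 → V6) (hT : ∀ w, Th (φ w) = T (Th w)) (h : ∀ p : FermatPoint,
    ((π p).val : Set V6) = T '' (p.val : Set V6)) : IndP φ π := by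
  intro p w hw
  refine ⟨hne w hw.1, ?_⟩
  have : Th (φ w) ∈ ((π p).val : Set V6) := by
    rw [h p, hT]; exact ⟨_, hw.2, rfl⟩
  exact this

/-! ### concrete maps -/

theorem UU_inj {N : M6} (h : UU N) : Function.Injective (fun w : W6 => N *ᵥ w) := by
  intro w w' e
  have h1 : (JJ * Nᴴ * JJ) * N = 1 := by
    unfold UU at h
    rw [Matrix.mul_assoc, Matrix.mul_assoc, ← Matrix.mul_assoc Nᴴ, h, JJ_sq]
  have e : N *ᵥ w = N *ᵥ w' := e
  rw [← one_mulVec w, ← one_mulVec w', ← h1, ← mulVec_mulVec w, e, mulVec_mulVec]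

theorem UU_iso {N : M6} (h : UU N) (w : W6) (hw : Iso6 w) : Iso6 (N *ᵥ w) := by
  obtain ⟨k, hk⟩ := PP_of_UU N h
  exact hk.iso w hw

theorem perm_N {N : M6} (h : UU N) : ∃ π ∈ PGammaU, IndP (fun w => N *ᵥ w) π := by
  have l2 : ∀ (c : K4) w, ∃ c' : K4, c • (N *ᵥ w) = N *ᵥ (c' • w) := fun c w => ⟨c, (mulVec_smul ..).symm⟩
  obtain ⟨π, hπ⟩ := perm_exists _ (UU_inj h) (mulVec_zero _) (UU_iso h) (fun c w => ⟨c, mulVec_smul ..⟩) l2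
  refine ⟨π, Subgroup.subset_closure (Or.inl ⟨toG N, ?_, ?_⟩), hπ⟩
  · rw [mem_unitaryGroup_iff']; exact toG_unitary h
  · apply hπ.image (mulVec_zero _) l2
    intro w
    conv_lhs => rw [← toN_toG N]
    exact Th_toN _ _

theorem C_star_iso (w : W6) (hw : Iso6 w) : Iso6 (matC *ᵥ star w) := UU_iso UU_matC _ (good_S.iso w hw)

theorem perm_F : ∃ π ∈ PGammaU, IndP (fun w => matC *ᵥ star w) π := by
  have l1 : ∀ (c : K4) (w : W6), matC *ᵥ star (c • w) = star c • (matC *ᵥ star w) := by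
    intro c w
    rw [star_smul, mulVec_smul]
  have l2 : ∀ (c : K4) (w : W6), ∃ c' : K4, c • (matC *ᵥ star w) = matC *ᵥ star (c' • w) := fun c w =>
    ⟨star c, by rw [l1, star_star]⟩
  have h0 : matC *ᵥ star (0 : W6) = 0 := by rw [star_zero, mulVec_zero]
  obtain ⟨π, hπ⟩ := perm_exists (fun w => matC *ᵥ star w) (fun w w' e => star_injective (UU_inj UU_matC e)) h0
    C_star_iso (fun c w => ⟨_, l1 c w⟩) l2
  exact ⟨π, Subgroup.subset_closure (Or.inr (hπ.image h0 l2 _ Th_frob)), hπ⟩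

/-! ### compatibility -/

def CV (e : EW) (φ : W6 → W6) : Prop := ∀ w, Iso6 w → ∀ x y : ↥W22, FF (y : V24) = ta w (FF (x : V24)) →
  FF (e y : V24) = ta (φ w) (FF (e x : V24))

def Compat (e : EW) (π : Equiv.Perm FermatPoint) : Prop := ∀ p w w', on p w → on (π p) w' →
  ∀ x y : ↥W22, FF (y : V24) = ta w (FF (x : V24)) → FF (e y : V24) = ta w' (FF (e x : V24))

theorem ta_smul (c : K4) (hc : c ≠ 0) (w : W6) : ta (c • w) = ta w := tau_smul c hc _ _

theorem CV.compat {e : EW} {φ : W6 → W6} {π : Equiv.Perm FermatPoint} (h : CV e φ) (hi : IndP φ π) : Compat e π := by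
  intro p w w' hw hw' x y hxy
  obtain ⟨c, hc, e⟩ := on_on (hi p w hw) hw'
  rw [e, ta_smul c hc]
  exact h w (on_iso hw) x y hxy

theorem Good.cv {k : V24 ≃ₗ[ℚ] V24} {φ : W6 → W6} {r : K4 → K4} {s : ℚ} (h : Good k φ r s) (hk : k ∈ circ222) :
    CV (resE k hk) φ := by
  intro w hw x y hxy
  obtain ⟨G, h1, h2⟩ := h.op
  rw [resE_apply, resE_apply, h1, h1, hxy, h2 w hw]

theorem Compat.mul {e e' : EW} {π π' : Equiv.Perm FermatPoint} (h : Compat e π) (h' : Compat e' π') :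
    Compat (e * e') (π * π') := by
  intro p w w' hw hw' x y hxy
  obtain ⟨u, hu⟩ := on_exists (π' p)
  exact h (π' p) u w' hu hw' (e' x) (e' y) (h' p w u hw hu x y hxy)

theorem Compat.unique {e : EW} {π π' : Equiv.Perm FermatPoint} (h : Compat e π) (h' : Compat e π') : π = π' := by
  ext1 p
  obtain ⟨w, hw⟩ := on_exists p
  obtain ⟨u, hu⟩ := on_exists (π p)
  obtain ⟨u', hu'⟩ := on_exists (π' p)
  obtain ⟨c, hc, e2⟩ := ta_inj u u' hu.1 hu'.1 (on_iso hu) (on_iso hu') (by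
    intro x hx
    obtain ⟨y, hy, hxy⟩ := ta_FF w (e.symm ⟨x, hx⟩ : ↥W22)
    have a1 := h p w u hw hu (e.symm ⟨x, hx⟩) ⟨y, hy⟩ hxy
    have a2 := h' p w u' hw hu' (e.symm ⟨x, hx⟩) ⟨y, hy⟩ hxy
    rw [a1, e.apply_symm_apply] at a2
    exact a2)
  rw [e2] at hu'
  exact on_eq (on_smul hu c hc) hu'

theorem inG_ind {k : V24 ≃ₗ[ℚ] V24} (hk : InG k) : ∃ π ∈ PGammaU, Compat (resE k hk.circ) π := by
  obtain ⟨N, s, hN, hs, h | h⟩ := id hk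
  · obtain ⟨π, h1, h2⟩ := perm_N hN
    exact ⟨π, h1, (h.cv hk.circ).compat h2⟩
  · obtain ⟨π, h1, h2⟩ := perm_N (hN.mul UU_matC)
    obtain ⟨π', h1', h2'⟩ := perm_F
    refine ⟨π * π', PGammaU.mul_mem h1 h1', (h.cv hk.circ).compat ?_⟩
    have := h2.mul h2'
    have e : (fun w : W6 => N *ᵥ star w) = (fun w => (N * matC) *ᵥ w) ∘ (fun w => matC *ᵥ star w) := by
      funext w
      show _ = (N * matC) *ᵥ (matC *ᵥ star w)
      rw [mulVec_mulVec, Matrix.mul_assoc, matC_sq, Matrix.mul_one]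
    rw [e]; exact this

theorem compat_exists (e : ↥OLam22) : ∃ π : ↥PGammaU, Compat e.val π.val := by
  obtain ⟨k, hk, he⟩ := KK_all e.2
  obtain ⟨π, h1, h2⟩ := inG_ind hk
  exact ⟨⟨π, h1⟩, by rw [he]; exact h2⟩

noncomputable def fO (e : ↥OLam22) : ↥PGammaU := (compat_exists e).choose

theorem fO_spec (e : ↥OLam22) : Compat e.val (fO e).val := (compat_exists e).choose_spec

theorem fO_eq {e : ↥OLam22} {π : ↥PGammaU} (h : Compat e.val π.val) : fO e = π :=
  Subtype.ext ((fO_spec e).unique h)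

noncomputable def fOm : ↥OLam22 →* ↥PGammaU := MonoidHom.mk' fO fun a b => fO_eq ((fO_spec a).mul (fO_spec b))

theorem compat_one_of {e : EW} (s : ℚ) (h : ∀ x : ↥W22, e x = s • x) : Compat e 1 := by
  intro p w w' hw hw' x y hxy
  obtain ⟨c, hc, e⟩ := on_on hw hw'
  rw [e, ta_smul c hc, h, h, Submodule.coe_smul, Submodule.coe_smul, map_smul, map_smul, map_smul, hxy]

theorem fOm_ker (e : ↥OLam22) : fOm e = 1 ↔
    ((∀ w : ↥W22, (e : EW) w = w) ∨ (∀ w : ↥W22, (e : EW) w = -w)) := by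
  constructor
  · intro h
    have hc : Compat e.val 1 := by
      have h1 := fO_spec e
      have h2 : fO e = 1 := h
      rw [h2] at h1
      exact h1
    obtain ⟨s, hs⟩ := scalar_of_comm e.val (by
      intro w hw x y hxy
      by_cases hz : w = 0
      · have key : ∀ f : Fun64, ta w f = f := by
          intro f; funext v
          rw [hz]
          show tau 0 0 f v = _
          rw [tau_zero, if_pos (by simp [hp])]
        rw [key] at hxy ⊢
        rw [FF_W22_inj hxy]
      · obtain ⟨p, hp⟩ := pt_exists w hz hw
        exact hc p w w hp hp x y hxy)
    exact pm_of_scalar e.2 s hs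
  · rintro (h | h)
    · exact fO_eq (compat_one_of 1 fun x => by rw [h, one_smul])
    · exact fO_eq (compat_one_of (-1) fun x => by rw [h]; exact (neg_one_smul ℚ x).symm)

theorem compat_range {k : V24 ≃ₗ[ℚ] V24} {φ : W6 → W6} {r : K4 → K4} {s : ℚ} (hk : InG k) (h : Good k φ r s)
    {π : ↥PGammaU} (hi : IndP φ π.val) : fOm ⟨resE k hk.circ, resE_mem k _⟩ = π :=
  fO_eq ((h.cv hk.circ).compat hi)

theorem gen_range (σ : Equiv.Perm FermatPoint) (hσ : σ ∈ PGammaU)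
    (h : (∃ g ∈ Matrix.unitaryGroup (Fin 6) F4,
            ∀ p : FermatPoint, ((σ p).val : Set (Fin 6 → F4))
              = (fun x => g.mulVec x) '' (p.val : Set (Fin 6 → F4))) ∨
         (∀ p : FermatPoint, ((σ p).val : Set (Fin 6 → F4))
              = (fun x i => x i ^ 2) '' (p.val : Set (Fin 6 → F4)))) : ∃ e, fOm e = ⟨σ, hσ⟩ := by
  rcases h with ⟨g, hg, h⟩ | h
  · rw [mem_unitaryGroup_iff'] at hg
    have hN := UU_toN hg
    obtain ⟨k, hk⟩ := PP_of_UU _ hN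
    refine ⟨_, compat_range (hk.inG hN) hk (π := ⟨σ, hσ⟩) (IndP.of_image ?_ _ (Th_toN g) h)⟩
    intro w hw e
    exact hw (UU_inj hN (e.trans (mulVec_zero _).symm))
  · obtain ⟨k, hk⟩ := PP_of_UU _ UU_matC
    have hk2 : Good (k * gS) (fun w => matC *ᵥ star w) _ _ := Good.mul hk good_S
    have hi : IndP (fun w => matC *ᵥ star w) σ := by
      refine IndP.of_image ?_ (fun x i => x i ^ 2) Th_frob h
      intro w hw e
      apply hw
      apply star_injective
      apply UU_inj UU_matC
      show matC *ᵥ star w = matC *ᵥ star 0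
      rw [star_zero, mulVec_zero]; exact e
    exact ⟨_, compat_range ((hk.inG UU_matC).mul inG_S) hk2 (π := ⟨σ, hσ⟩) hi⟩

theorem fOm_surjective : Function.Surjective fOm := by
  rintro ⟨σ, hσ⟩
  have key : PGammaU ≤ Subgroup.map PGammaU.subtype fOm.range := by
    unfold PGammaU
    rw [Subgroup.closure_le]
    intro τ hτ
    have h1 : τ ∈ PGammaU := Subgroup.subset_closure hτ
    obtain ⟨e, he⟩ := gen_range τ h1 hτ
    exact ⟨⟨τ, h1⟩, ⟨e, he⟩, rfl⟩
  obtain ⟨τ, ⟨e, he⟩, h⟩ := key hσ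
  exact ⟨e, he.trans (Subtype.ext h)⟩

end

section

open Matrix

/-! ## The pointwise stabilizer of `A`, `B` -/


def rr (c : K4) (b : Bool) (t : K4) : K4 := if b then star (c * t) else c * t
def sgz (s : Bool) : ℤ := if s then 1 else -1

theorem data_inj : ∀ (c c' : K4) (b b' s s' : Bool), c ≠ 0 → c' ≠ 0 →
    (∀ e f : K4, e ≠ 0 → f ≠ 0 → sgz s * (vA (th (rr c b e)) - vA (th (rr c b f))) =
      sgz s' * (vA (th (rr c' b' e)) - vA (th (rr c' b' f)))) →
    (∀ e f : K4, e ≠ 0 → f ≠ 0 → sgz s * (vB (th (rr c b e)) - vB (th (rr c b f))) =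
      sgz s' * (vB (th (rr c' b' e)) - vB (th (rr c' b' f)))) → c = c' ∧ b = b' ∧ s = s' := by
  decide +kernel

/-- `k` acts on the plane with data `(c, b, s)` -/
def Act (k : V24 ≃ₗ[ℚ] V24) (c : K4) (b s : Bool) : Prop := ∀ x : V24, ∀ e f : K4, e ≠ 0 → f ≠ 0 →
  k x (th e) - k x (th f) = (sgz s : ℚ) * (x (th (rr c b e)) - x (th (rr c b f)))

theorem Act.eq_of {k k' : V24 ≃ₗ[ℚ] V24} {c : K4} {b s : Bool} (h : Act k c b s) (h' : Act k' c b s)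
    (hk : k ∈ circ222) (hk' : k' ∈ circ222) {x : V24} (hx : x ∈ spAB) : k x = k' x := by
  have m1 := circ_sp hk hx
  have m2 := circ_sp hk' hx
  have a1 := ((mem_spAB _).1 m1).2
  have a2 := ((mem_spAB _).1 m2).2
  have b1 := (h x .i .w (by decide) (by decide)).trans (h' x .i .w (by decide) (by decide)).symm
  have b2 := (h x .i .z (by decide) (by decide)).trans (h' x .i .z (by decide) (by decide)).symm
  change k x 21 - k x 22 = k' x 21 - k' x 22 at b1
  change k x 21 - k x 23 = k' x 21 - k' x 23 at b2
  apply spAB_ext m1 m2 <;> linarith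

theorem Act.data {k k' : V24 ≃ₗ[ℚ] V24} {c c' : K4} {b b' s s' : Bool} (h : Act k c b s) (h' : Act k' c' b' s')
    (hc : c ≠ 0) (hc' : c' ≠ 0) (hA : k (toRat vA) = k' (toRat vA)) (hB : k (toRat vB) = k' (toRat vB)) :
    c = c' ∧ b = b' ∧ s = s' := by
  apply data_inj c c' b b' s s' hc hc'
  · intro e f he hf
    have h1 := h (toRat vA) e f he hf
    rw [hA, h' _ e f he hf] at h1
    unfold toRat at h1
    exact_mod_cast h1.symm
  · intro e f he hf
    have h1 := h (toRat vB) e f he hf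
    rw [hB, h' _ e f he hf] at h1
    unfold toRat at h1
    exact_mod_cast h1.symm

theorem act_one : Act 1 1 false true := by
  intro x e f he hf
  have : ∀ t, rr 1 false t = t := by decide
  rw [this, this]
  show x (th e) - x (th f) = ((1 : ℤ) : ℚ) * _
  push_cast; ring

theorem Good.act' {k : V24 ≃ₗ[ℚ] V24} {φ : W6 → W6} {r : K4 → K4} {sq : ℚ} (h : Good k φ r sq) {c : K4} {b s : Bool}
    (hr : ∀ t, r t = rr c b t) (hs : sq = (sgz s : ℚ)) : Act k c b s := by
  intro x e f he hf
  rw [h.act x e f he hf, hr, hr, hs]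

theorem UU_det_ne {N : M6} (h : UU N) : N.det ≠ 0 := by
  intro h0
  have h1 : (JJ * Nᴴ * JJ) * N = 1 := by
    unfold UU at h
    rw [Matrix.mul_assoc, Matrix.mul_assoc, ← Matrix.mul_assoc Nᴴ, h, JJ_sq]
  have h2 := congrArg det h1
  rw [det_mul, h0, mul_zero, det_one] at h2
  exact zero_ne_one h2

/-- unfold membership -/
theorem circ_data {k : V24 ≃ₗ[ℚ] V24} (hk : k ∈ circ222) : ∃ (N : M6) (b s : Bool), UU N ∧ Act k N.det b s ∧
    (b = false → Good k (fun w => N *ᵥ w) (fun c => N.det * c) (sgz s : ℚ)) := by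
  obtain ⟨N, s, hN, hs, h⟩ := inG_of_circ hk
  obtain ⟨s', hs'⟩ : ∃ s' : Bool, s = (sgz s' : ℚ) := by
    rcases hs with rfl | rfl
    · exact ⟨true, by simp [sgz]⟩
    · exact ⟨false, by simp [sgz]⟩
  rcases h with h | h
  · exact ⟨N, false, s', hN, h.act' (fun t => rfl) hs', fun _ => by rw [← hs']; exact h⟩
  · exact ⟨N, true, s', hN, h.act' (fun t => rfl) hs', fun h => by cases h⟩

theorem dot_le_circ {k : V24 ≃ₗ[ℚ] V24} (hk : k ∈ dot222) : k ∈ circ222 := by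
  obtain ⟨h1, hA, hB⟩ := hk
  have fx : ∀ x ∈ spAB, k x = x := by
    intro x hx
    obtain ⟨a, b, rfl⟩ := Submodule.mem_span_pair.1 hx
    rw [map_add, map_smul, map_smul, hA, hB]
  refine ⟨h1, fun x => ?_⟩
  show (x ∈ LeechQ ∧ x ∈ spAB) ↔ (k x ∈ LeechQ ∧ k x ∈ spAB)
  rw [← h1.2]
  refine and_congr_right fun _ => ⟨fun h => by rw [fx x h]; exact h, fun h => ?_⟩
  have := k.injective (fx _ h)
  rw [← this]; exact h

theorem det_matD3 (c : K4) (hc : c ≠ 0) : ∃ N : M6, UU N ∧ N.det = c := by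
  have e := star_mul_self_K4 c hc
  have h1 : (diagonal ![star c, 1, 1] : M3) * diagonal ![c, 1, 1] = 1 := by
    rw [diagonal_mul_diagonal, ← diagonal_one]
    congr 1
    funext i
    fin_cases i
    · exact e
    · exact one_mul 1
    · exact one_mul 1
  have h2 : (diagonal ![c, 1, 1] : M3) * diagonal ![star c, 1, 1] = 1 := by
    rw [mul_eq_one_comm]; exact h1
  refine ⟨matD _ _, UU_matD h2 h1, ?_⟩
  rw [matD, det_fromBlocks_zero₂₁, det_conjTranspose, det_diagonal, det_diagonal, Fin.prod_univ_three, Fin.prod_univ_three]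
  simp only [cons_val_zero, cons_val_one, cons_val, mul_one]
  revert c; decide

theorem coset_rep (c : K4) (hc : c ≠ 0) (b s : Bool) : ∃ k ∈ circ222, Act k c b s := by
  obtain ⟨N, hN, rfl⟩ := det_matD3 c hc
  obtain ⟨k, hk⟩ := PP_of_UU N hN
  have h2 := Good.mul hk good_S
  have h3 := Good.mul hk good_neg
  have h4 := Good.mul (Good.mul hk good_S) good_neg
  cases b <;> cases s
  · exact ⟨_, h3.circ, h3.act' (fun t => rfl) (by simp [sgz])⟩
  · exact ⟨_, hk.circ, hk.act' (fun t => rfl) (by simp [sgz])⟩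
  · exact ⟨_, h4.circ, h4.act' (fun t => rfl) (by simp [sgz])⟩
  · exact ⟨_, h2.circ, h2.act' (fun t => rfl) (by simp [sgz])⟩

theorem dot_of_act {k : V24 ≃ₗ[ℚ] V24} (hk : k ∈ circ222) (h : Act k 1 false true) : k ∈ dot222 :=
  ⟨hk.1, h.eq_of act_one hk circ222.one_mem vA_sp, h.eq_of act_one hk circ222.one_mem vB_sp⟩

theorem card_circ : Nat.card circ222 = 12 * Nat.card dot222 := by
  have hD : Nat.card ({c : K4 // c ≠ 0} × Bool × Bool) = 12 := by
    rw [Nat.card_eq_fintype_card]; decide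
  rw [← hD, ← Nat.card_prod]
  symm
  have hr : ∀ d : {c : K4 // c ≠ 0} × Bool × Bool, ∃ k, k ∈ circ222 ∧ Act k d.1.1 d.2.1 d.2.2 := fun d =>
    coset_rep d.1.1 d.1.2 d.2.1 d.2.2
  choose R hR hA using hr
  refine Nat.card_eq_of_bijective (fun x : ({c : K4 // c ≠ 0} × Bool × Bool) × dot222 =>
    (⟨R x.1 * x.2.1, circ222.mul_mem (hR _) (dot_le_circ x.2.2)⟩ : circ222)) ⟨?_, ?_⟩
  · rintro ⟨d, k, hk⟩ ⟨d', k', hk'⟩ h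
    have h1 : R d * k = R d' * k' := congrArg Subtype.val h
    have eA : R d (toRat vA) = R d' (toRat vA) := by
      have := LinearEquiv.congr_fun h1 (toRat vA)
      change R d (k (toRat vA)) = R d' (k' (toRat vA)) at this
      rwa [hk.2.1, hk'.2.1] at this
    have eB : R d (toRat vB) = R d' (toRat vB) := by
      have := LinearEquiv.congr_fun h1 (toRat vB)
      change R d (k (toRat vB)) = R d' (k' (toRat vB)) at this
      rwa [hk.2.2, hk'.2.2] at this
    obtain ⟨e1, e2, e3⟩ := (hA d).data (hA d') d.1.2 d'.1.2 eA eB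
    have hd : d = d' := Prod.ext (Subtype.ext e1) (Prod.ext e2 e3)
    subst hd
    have h2 := mul_left_cancel h1
    subst h2
    rfl
  · rintro ⟨k, hk⟩
    obtain ⟨N, b, s, hN, h, -⟩ := circ_data hk
    let d : {c : K4 // c ≠ 0} × Bool × Bool := (⟨N.det, UU_det_ne hN⟩, b, s)
    have key : ∀ x ∈ spAB, ((R d)⁻¹ * k) x = x := by
      intro x hx
      show (R d).symm (k x) = x
      rw [h.eq_of (hA d) hk (hR d) hx, LinearEquiv.symm_apply_apply]
    refine ⟨(d, ⟨(R d)⁻¹ * k, LeechAut.mul_mem (LeechAut.inv_mem (hR d).1) hk.1, key _ vA_sp, key _ vB_sp⟩), ?_⟩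
    apply Subtype.ext
    show R d * ((R d)⁻¹ * k) = k
    rw [mul_inv_cancel_left]

theorem card_dot : Nat.card dot222 = 9196830720 := by
  have h := card_circ
  have h2 : Nat.card circ222 = Nat.card OLam22 := Nat.card_eq_of_bijective res ⟨res_injective, res_surjective⟩
  rw [h2, card_OLam22] at h
  omega

/-! ### the homomorphisms -/

def dotIncl : dot222 →* circ222 := Subgroup.inclusion fun _ => dot_le_circ

noncomputable def bet : dot222 →* Equiv.Perm FermatPoint := PGammaU.subtype.comp (fOm.comp (res.comp dotIncl))

theorem bet_injective : Function.Injective bet := by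
  rw [injective_iff_map_eq_one]
  rintro ⟨k, hk⟩ h
  have h1 : fOm (res ⟨k, dot_le_circ hk⟩) = 1 := Subtype.ext h
  rw [fOm_ker] at h1
  apply Subtype.ext
  show k = 1
  rcases h1 with h1 | h1
  · exact circ_trivial (dot_le_circ hk) fun x hx => congrArg Subtype.val (h1 ⟨x, hx⟩)
  · exfalso
    have h2 : (LinearEquiv.neg ℚ * k : V24 ≃ₗ[ℚ] V24) = 1 := by
      apply circ_trivial (circ222.mul_mem inG_neg.circ (dot_le_circ hk))
      intro x hx
      have : k x = -x := congrArg Subtype.val (h1 ⟨x, hx⟩)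
      show -(k x) = x
      rw [this, neg_neg]
    have h3 := congrFun (LinearEquiv.congr_fun h2 (toRat vA)) 21
    change (-(k (toRat vA))) 21 = toRat vA 21 at h3
    rw [hk.2.1, Pi.neg_apply] at h3
    have h4 : toRat vA 21 = 4 := by
      show ((vA 21 : ℤ) : ℚ) = 4
      have : vA 21 = 4 := by decide
      rw [this]; norm_num
    rw [h4] at h3; norm_num at h3

theorem bet_eq {k : V24 ≃ₗ[ℚ] V24} (hk : k ∈ dot222) {φ r s} (h : Good k φ r s) {π : Equiv.Perm FermatPoint}
    (hπ : π ∈ PGammaU) (hi : IndP φ π) : bet ⟨k, hk⟩ = π := by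
  have := compat_range (inG_of_circ (dot_le_circ hk)) h (π := ⟨π, hπ⟩) hi
  exact congrArg Subtype.val this

theorem IndP.unique {φ : W6 → W6} {π π' : Equiv.Perm FermatPoint} (h : IndP φ π) (h' : IndP φ π') : π = π' := by
  ext1 p
  obtain ⟨w, hw⟩ := on_exists p
  exact on_eq (h p w hw) (h' p w hw)

theorem su_unitary (g : SU6) : (g.1.1)ᴴ * g.1.1 = 1 := mem_unitaryGroup_iff'.1 g.1.2

noncomputable def gaF (g : SU6) : Equiv.Perm FermatPoint := (perm_N (UU_toN (su_unitary g))).choose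

theorem gaF_mem (g : SU6) : gaF g ∈ PGammaU := (perm_N (UU_toN (su_unitary g))).choose_spec.1
theorem gaF_spec (g : SU6) : IndP (fun w => toN g.1.1 *ᵥ w) (gaF g) := (perm_N (UU_toN (su_unitary g))).choose_spec.2

theorem toN_mul (g h : G6) : toN (g * h) = toN g * toN h := by
  rw [toN, toN, toN, Matrix.map_mul]
  have : Pn * g.map io * Pm * (Pn * h.map io * Pm) = Pn * g.map io * (Pm * Pn) * h.map io * Pm := by
    simp only [Matrix.mul_assoc]
  rw [this, Pm_Pn, Matrix.mul_one]
  simp only [Matrix.mul_assoc]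

noncomputable def ga : SU6 →* Equiv.Perm FermatPoint := MonoidHom.mk' gaF fun a b => by
  apply (gaF_spec (a * b)).unique
  have h := (gaF_spec a).mul (gaF_spec b)
  have e : (fun w : W6 => toN (a * b).1.1 *ᵥ w) = (fun w => toN a.1.1 *ᵥ w) ∘ (fun w => toN b.1.1 *ᵥ w) := by
    funext w
    show toN (a.1.1 * b.1.1) *ᵥ w = toN a.1.1 *ᵥ (toN b.1.1 *ᵥ w)
    rw [toN_mul, mulVec_mulVec]
  rw [e]; exact h

theorem range_eq : ga.range = bet.range := by
  ext π
  constructor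
  · rintro ⟨g, rfl⟩
    have hN := UU_toN (su_unitary g)
    obtain ⟨k, hk⟩ := PP_of_UU _ hN
    have hd : (toN g.1.1).det = 1 := by
      rw [det_toN]
      have : (g.1.1).det = 1 := g.2
      rw [this, map_one]
    have hk2 : k ∈ dot222 := by
      apply dot_of_act hk.circ
      apply hk.act'
      · intro t; rw [hd]; rfl
      · simp [sgz]
    exact ⟨⟨k, hk2⟩, bet_eq hk2 hk (gaF_mem g) (gaF_spec g)⟩
  · rintro ⟨⟨k, hk⟩, rfl⟩
    obtain ⟨N, b, s, hN, h, hg⟩ := circ_data (dot_le_circ hk)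
    obtain ⟨e1, e2, e3⟩ := h.data act_one (UU_det_ne hN) one_ne_zero hk.2.1 hk.2.2
    have hg2 := hg e2
    have hdet : (toG N).det = 1 := by
      apply io.injective
      rw [← det_toN, toN_toG, e1, map_one]
    let g : SU6 := ⟨⟨toG N, mem_unitaryGroup_iff'.2 (toG_unitary hN)⟩, hdet⟩
    refine ⟨g, ?_⟩
    symm
    apply bet_eq hk hg2 (gaF_mem g)
    have := gaF_spec g
    have e : toN g.1.1 = N := toN_toG N
    rw [e] at this
    exact this

end

section

open Matrix

/-! ## The center of `SU(6,4)` -/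


def FixLines (M : G6) : Prop := ∀ x : V6, ∑ i, x i ^ 3 = 0 → ∃ c : F4, M *ᵥ x = c • x

theorem ga_one_iff (g : SU6) : ga g = 1 ↔ FixLines g.1.1 := by
  constructor
  · intro h x hx
    by_cases h0 : x = 0
    · exact ⟨0, by rw [h0, mulVec_zero, smul_zero]⟩
    · have hi := gaF_spec g
      have h : gaF g = 1 := h
      rw [h] at hi
      have hz : Ti x ≠ 0 := fun e => h0 (by rw [← Th_Ti x, e, Th_zero])
      obtain ⟨p, hp⟩ := pt_exists (Ti x) hz (by rw [Iso6_iff, Th_Ti]; exact hx)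
      obtain ⟨c, hc, e⟩ := on_on hp (hi p _ hp)
      refine ⟨io.symm c, ?_⟩
      have e2 := congrArg Th e
      rw [Th_toN, Th_smul, Th_Ti] at e2
      exact e2
  · intro h
    apply (gaF_spec g).unique
    intro p w hw
    refine ⟨((gaF_spec g) p w hw).1, ?_⟩
    show Th (toN g.1.1 *ᵥ w) ∈ p.val
    obtain ⟨c, hc⟩ := h (Th w) (p.2.2 _ hw.2)
    rw [Th_toN, hc]
    exact p.val.smul_mem _ hw.2

theorem cube_F4 (x : F4) (hx : x ≠ 0) : x ^ 3 = 1 := by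
  have := FiniteField.pow_card_sub_one_eq_one x hx
  rwa [card_F4] at this

theorem add_self_F4 (x : F4) : x + x = 0 := CharTwo.add_self_eq_zero x

theorem exists_zeta : ∃ z : F4, z ≠ 0 ∧ z ≠ 1 := ⟨io.symm K4.w, by
  intro h
  have := congrArg io h
  rw [RingEquiv.apply_symm_apply, map_zero] at this
  exact absurd this (by decide), by
  intro h
  have := congrArg io h
  rw [RingEquiv.apply_symm_apply, map_one] at this
  exact absurd this (by decide)⟩

theorem two_iso (i j : Fin 6) (hij : i ≠ j) (z : F4) (hz : z ≠ 0) :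
    ∑ k, ((Pi.single i 1 + Pi.single j z : V6) k) ^ 3 = 0 := by
  rw [← Finset.add_sum_erase _ _ (Finset.mem_univ i), ← Finset.add_sum_erase _ _ (Finset.mem_erase.2 ⟨hij.symm, Finset.mem_univ j⟩),
    Finset.sum_eq_zero]
  · simp [hij, hij.symm, cube_F4 z hz, add_self_F4]
  · intro k hk
    simp only [Finset.mem_erase, Finset.mem_univ, and_true] at hk
    simp [hk.1, hk.2]

theorem fix_entry {M : G6} (h : FixLines M) (i j : Fin 6) (hij : i ≠ j) (z : F4) (hz : z ≠ 0) :
    ∃ c : F4, ∀ k, M k i + M k j * z = c * ((Pi.single i 1 + Pi.single j z : V6) k) := by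
  obtain ⟨c, hc⟩ := h _ (two_iso i j hij z hz)
  refine ⟨c, fun k => ?_⟩
  have := congrFun hc k
  rw [mulVec_add] at this
  rw [mul_comm (M k j)]
  simpa using this

theorem fix_off {M : G6} (h : FixLines M) (k j : Fin 6) (hkj : k ≠ j) : M k j = 0 := by
  obtain ⟨i, hi⟩ : ∃ i : Fin 6, i ≠ k ∧ i ≠ j := by
    revert k j; decide
  obtain ⟨z, hz0, hz1⟩ := exists_zeta
  obtain ⟨c, hc⟩ := fix_entry h i j hi.2 1 one_ne_zero
  obtain ⟨d, hd⟩ := fix_entry h i j hi.2 z hz0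
  have h1 := hc k
  have h2 := hd k
  simp only [Pi.add_apply, Pi.single_apply, if_neg hi.1.symm, if_neg hkj, add_zero, mul_zero, mul_one] at h1 h2
  have h3 : M k j * (z - 1) = 0 := by linear_combination h2 - h1
  rcases mul_eq_zero.1 h3 with h | h
  · exact h
  · exact absurd (sub_eq_zero.1 h) hz1

theorem fix_scalar {M : G6} (h : FixLines M) : M = (M 0 0) • (1 : G6) := by
  have hd : ∀ j, M j j = M 0 0 := by
    intro j
    by_cases hj : j = 0
    · rw [hj]
    · obtain ⟨c, hc⟩ := fix_entry h 0 j (Ne.symm hj) 1 one_ne_zero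
      have h1 := hc 0
      have h2 := hc j
      rw [fix_off h 0 j (Ne.symm hj)] at h1
      rw [fix_off h j 0 hj] at h2
      simp [hj, Ne.symm hj] at h1 h2
      rw [h1, h2]
  ext i j
  rw [Matrix.smul_apply, Matrix.one_apply]
  by_cases hij : i = j
  · rw [hij, hd, if_pos rfl, smul_eq_mul, mul_one]
  · rw [fix_off h i j hij, if_neg hij, smul_zero]

noncomputable def tv (x : V6) : G6 := 1 + vecMulVec x (star x)

theorem star_dot (x : V6) : star x ⬝ᵥ x = ∑ i, x i ^ 3 := by
  unfold dotProduct
  refine Finset.sum_congr rfl fun i _ => ?_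
  rw [Pi.star_apply, star_F4]; ring

theorem tv_ct (x : V6) : (tv x)ᴴ = tv x := by
  unfold tv
  rw [conjTranspose_add, conjTranspose_one]
  congr 1
  ext i j
  rw [conjTranspose_apply, vecMulVec_apply, vecMulVec_apply, star_mul, Pi.star_apply, Pi.star_apply, star_star]

theorem tv_unitary (x : V6) (hx : ∑ i, x i ^ 3 = 0) : (tv x)ᴴ * tv x = 1 := by
  rw [tv_ct]
  unfold tv
  have h1 : vecMulVec x (star x) * vecMulVec x (star x) = 0 := by
    rw [vecMulVec_mul_vecMulVec, star_dot, hx, zero_smul, vecMulVec_zero]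
  have h2 : vecMulVec x (star x) + vecMulVec x (star x) = 0 := by
    ext i j; exact add_self_F4 _
  rw [Matrix.add_mul, Matrix.mul_add, Matrix.mul_add, h1, Matrix.one_mul, Matrix.one_mul, Matrix.mul_one, add_zero, add_assoc, h2, add_zero]

theorem tv_det (x : V6) (hx : ∑ i, x i ^ 3 = 0) : (tv x).det = 1 := by
  unfold tv
  rw [vecMulVec_eq Unit, det_one_add_replicateCol_mul_replicateRow, star_dot, hx, add_zero]

theorem ker_ga : ga.ker = Subgroup.center SU6 := by
  ext g
  rw [MonoidHom.mem_ker, ga_one_iff, Subgroup.mem_center_iff]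
  constructor
  · intro h k
    have hs := fix_scalar h
    apply Subtype.ext
    apply Subtype.ext
    show k.1.1 * g.1.1 = g.1.1 * k.1.1
    rw [hs, Matrix.mul_smul, Matrix.smul_mul, Matrix.mul_one, Matrix.one_mul]
  · intro h x hx
    by_cases h0 : x = 0
    · exact ⟨0, by rw [h0, mulVec_zero, smul_zero]⟩
    · let t : SU6 := ⟨⟨tv x, mem_unitaryGroup_iff'.2 (tv_unitary x hx)⟩, tv_det x hx⟩
      have h1 : tv x * g.1.1 = g.1.1 * tv x := congrArg (fun s : SU6 => s.1.1) (h t)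
      unfold tv at h1
      rw [Matrix.add_mul, Matrix.mul_add, Matrix.one_mul, Matrix.mul_one] at h1
      have h2 := add_left_cancel h1
      obtain ⟨j, hj⟩ := Function.ne_iff.1 h0
      have hj' : star (x j) ≠ 0 := star_ne_zero.mpr hj
      rw [vecMulVec_mul, mul_vecMulVec] at h2
      refine ⟨(star (x j))⁻¹ * ((star x) ᵥ* g.1.1) j, ?_⟩
      funext i
      have h3 := congrFun (congrFun h2 i) j
      rw [vecMulVec_apply, vecMulVec_apply, Pi.star_apply] at h3
      rw [Pi.smul_apply, smul_eq_mul]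
      field_simp
      linear_combination -h3

theorem dot_PSU : Nonempty (↥dot222 ≃* PSU6) := by
  have e1 : ↥dot222 ≃* bet.range := MonoidHom.ofInjective bet_injective
  have e2 : bet.range ≃* ga.range := MulEquiv.subgroupCongr range_eq.symm
  have e3 : ga.range ≃* (SU6 ⧸ ga.ker) := (QuotientGroup.quotientKerEquivRange ga).symm
  have e4 : (SU6 ⧸ ga.ker) ≃* (SU6 ⧸ Subgroup.center SU6) := QuotientGroup.quotientMulEquivOfEq ker_ga
  exact ⟨((e1.trans e2).trans e3).trans e4⟩

end

/-- Conway's isomorphisms: `·222_AB ≅ PSU(6,4)` of order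
`9196830720`; `∘222_AB ≅ O(Λ₂₂)` of order `2·6·9196830720`; and
`O(Λ₂₂)/{±Id} ≅ PΓU(6,4)`. -/
theorem conway_isomorphisms :
    Nonempty (↥dot222 ≃* PSU6) ∧
    Nat.card ↥dot222 = 9196830720 ∧
    Nonempty (↥circ222 ≃* ↥OLam22) ∧
    Nat.card ↥OLam22 = 2 * 6 * 9196830720 ∧
    (∃ f : ↥OLam22 →* ↥PGammaU, Function.Surjective f ∧
      ∀ g : ↥OLam22, f g = 1 ↔
        ((∀ w : ↥W22, (g : ↥W22 ≃ₗ[ℚ] ↥W22) w = w) ∨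
         (∀ w : ↥W22, (g : ↥W22 ≃ₗ[ℚ] ↥W22) w = -w))) := by 
  exact ⟨dot_PSU, card_dot, ⟨MulEquiv.ofBijective res ⟨res_injective, res_surjective⟩⟩,
    card_OLam22, fOm, fOm_surjective, fOm_ker⟩
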